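/- For every constant 0 < c < 1/2 there exist a constant t > 0 and d₀ ∈ ℕ such that the following holds for every real d ≥ d₀: every finite graph with average degree at least d contains an ℓ-balanced subdivision TK_k^(ℓ) of the complete graph K_k with k ≥ t·d^c, for some ℓ ∈ ℕ. -/

import Mathlib

open Real

namespace Balanced

variable {V : Type*}

/-- The external neighbourhood of a vertex set `X` in `G`. -/
def extNbr (G : SimpleGraph V) (X : Set V) : Set V := {v | v ∉ X ∧ ∃ u ∈ X, G.Adj u v}

/-- The Komlós–Szemerédi expansion function `ε(x, ε₁, k)`. -/
noncomputable def epsFn (ε₁ k x : ℝ) : ℝ :=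
  if x < k / 5 then 0 else ε₁ / (Real.log (15 * x / k)) ^ 2

/-- `G` is an `(ε₁, k)`-expander. -/
def IsExpander (G : SimpleGraph V) (ε₁ k : ℝ) : Prop :=
  ∀ X : Set V, k / 2 ≤ (X.ncard : ℝ) → (X.ncard : ℝ) ≤ (Nat.card V : ℝ) / 2 →
    epsFn ε₁ k (X.ncard : ℝ) * (X.ncard : ℝ) ≤ ((extNbr G X).ncard : ℝ)

/-- `G` is bipartite. -/
def IsBip (G : SimpleGraph V) : Prop := ∃ f : V → Bool, ∀ u v, G.Adj u v → f u ≠ f v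

/-- The average degree `2|E(G)|/|V(G)|` of `G`. -/
noncomputable def avgDeg (G : SimpleGraph V) : ℝ :=
  2 * (Nat.card G.edgeSet : ℝ) / (Nat.card V : ℝ)

/-- The minimum degree of `G` is at least `d`. -/
def MinDegGE (G : SimpleGraph V) (d : ℝ) : Prop :=
  ∀ v : V, d ≤ ((G.neighborSet v).ncard : ℝ)

/-- The support of a walk, as a set of vertices. -/
def suppSet {G : SimpleGraph V} {a b : V} (w : G.Walk a b) : Set V := {x | x ∈ w.support}

/-- `G` contains an `ℓ`-balanced subdivision `TK_k^(ℓ)` of the complete graph `K_k`: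
there are `k` core vertices joined pairwise by internally vertex-disjoint paths of
length exactly `ℓ`, whose internal vertices avoid all core vertices. -/
def ContainsBalSub (G : SimpleGraph V) (k ℓ : ℕ) : Prop :=
  ∃ c : Fin k → V, Function.Injective c ∧
    ∃ P : ∀ i j : Fin k, i < j → G.Walk (c i) (c j),
      (∀ i j (h : i < j), (P i j h).IsPath ∧ (P i j h).length = ℓ) ∧
      (∀ i j (h : i < j) (q : Fin k), c q ∈ (P i j h).support → q = i ∨ q = j) ∧
      (∀ i j (h : i < j) i' j' (h' : i' < j'), (i, j) ≠ (i', j') →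
        ∀ x, x ∈ (P i j h).support → x ∈ (P i' j' h').support →
          (x = c i ∨ x = c j) ∧ (x = c i' ∨ x = c j'))

/-- The subgraph `F` of `G` is a `(D, m)`-expansion of the vertex `v`:
`|V(F)| = D` and every vertex of `F` is at distance at most `m` from `v` in `F`. -/
def IsExpansion (G : SimpleGraph V) (F : G.Subgraph) (v : V) (D m : ℝ) : Prop :=
  ∃ hv : v ∈ F.verts, ((F.verts.ncard : ℝ) = D ∧
    ∀ u, ∀ hu : u ∈ F.verts, ∃ w : F.coe.Walk ⟨v, hv⟩ ⟨u, hu⟩, (w.length : ℝ) ≤ m)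

/-- `G` contains a `(D, m, k)`-adjuster. -/
def HasAdjuster (G : SimpleGraph V) (D m : ℝ) (k : ℕ) : Prop :=
  ∃ (v₁ v₂ : V) (F₁ F₂ : G.Subgraph) (A : Set V),
    Disjoint A F₁.verts ∧ Disjoint A F₂.verts ∧ Disjoint F₁.verts F₂.verts ∧
    IsExpansion G F₁ v₁ D m ∧ IsExpansion G F₂ v₂ D m ∧
    (A.ncard : ℝ) ≤ 10 * m * (k : ℝ) ∧
    ∃ ℓ : ℕ, ∀ i : ℕ, i ≤ k → ∃ w : G.Walk v₁ v₂, w.IsPath ∧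
      w.length = ℓ + 2 * i ∧ ∀ x ∈ w.support, x ∈ A ∪ {v₁, v₂}

open Classical in
/-- `π(u, v, G)` for a connected bipartite graph `G`: `0` if `u = v`, `1` if `u, v`
lie in different classes of the bipartition (equivalently, are joined by an odd walk),
and `2` otherwise. -/
noncomputable def piVal (G : SimpleGraph V) (u v : V) : ℕ :=
  if u = v then 0 else if ∃ w : G.Walk u v, Odd w.length then 1 else 2

/-- The ball of radius `r` around `v` in the subgraph of `G` induced on `S`,
viewed as a subset of `V`. -/
def ballIn (G : SimpleGraph V) (S : Set V) (v : V) (r : ℕ) : Set V :=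
  {u | ∃ w : G.Walk v u, w.length ≤ r ∧ ∀ x ∈ w.support, x ∈ S}

/-- The ball of radius `r` around the set `Y` in the subgraph of `G` induced on `S`. -/
def ballSetIn (G : SimpleGraph V) (S : Set V) (Y : Set V) (r : ℕ) : Set V :=
  {u | ∃ y ∈ Y, ∃ w : G.Walk y u, w.length ≤ r ∧ ∀ x ∈ w.support, x ∈ S}

/-- `P 0, …, P (q-1)` are consecutive shortest paths from `v` in the vertex set `W`:
each `P i` is a shortest path between its endpoints in the graph induced on
`(W \ ⋃_{j<i} V(P j)) ∪ {v}`. -/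
def ConsecSP (G : SimpleGraph V) (v : V) (W : Set V) {q : ℕ}
    (P : Fin q → Σ u : V, G.Walk v u) : Prop :=
  ∀ i : Fin q,
    (∀ x ∈ suppSet (P i).2,
      x ∈ (W \ ⋃ (j : Fin q) (_ : j < i), suppSet (P j).2) ∪ {v}) ∧
    ((P i).2).IsPath ∧
    ∀ w' : G.Walk v (P i).1,
      (∀ x ∈ suppSet w',
        x ∈ (W \ ⋃ (j : Fin q) (_ : j < i), suppSet (P j).2) ∪ {v}) →
      ((P i).2).length ≤ w'.length

/-- `v` is an end vertex of the path `p`. -/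
def IsEnd (G : SimpleGraph V) (v : V) (p : Σ a b : V, G.Walk a b) : Prop :=
  v = p.1 ∨ v = p.2.1

/-- `t` is the subpath `p(v, r)` of `p` of length `r` having `v` as an end vertex. -/
def IsTrunc (G : SimpleGraph V) (r : ℕ) (p : Σ a b : V, G.Walk a b) (v : V)
    (t : Σ u : V, G.Walk v u) : Prop :=
  t.2.length = r ∧ ∃ (c : V) (w' : G.Walk t.1 c),
    (⟨v, c, t.2.append w'⟩ : Σ a b : V, G.Walk a b) = p ∨
    (⟨v, c, t.2.append w'⟩ : Σ a b : V, G.Walk a b) = ⟨p.2.1, p.1, p.2.2.reverse⟩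

set_option linter.unusedSectionVars false

section Basics
open scoped Classical
variable [Fintype V] {G : SimpleGraph V}

/-- The external neighbourhood of a finset, as a finset. -/
noncomputable def nbr (G : SimpleGraph V) (X : Finset V) : Finset V :=
  Finset.univ.filter fun v => v ∉ X ∧ ∃ u ∈ X, G.Adj u v

/-- The ball around `A`, grown by repeatedly adding neighbours outside `F`. -/
noncomputable def ball (G : SimpleGraph V) (F A : Finset V) : ℕ → Finset V
  | 0 => A
  | i + 1 => ball G F A i ∪ (nbr G (ball G F A i) \ F)

/-- `v` can be reached from `u` by a walk of length at most `n` inside `S`. -/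
def Reach (G : SimpleGraph V) (S : Finset V) (n : ℕ) (u v : V) : Prop :=
  ∃ w : G.Walk u v, w.length ≤ n ∧ ∀ x ∈ w.support, x ∈ S

/-- There is a path of length `n` from `u` to `v` with set of interior vertices `S`. -/
def Link (G : SimpleGraph V) (u v : V) (n : ℕ) (S : Finset V) : Prop :=
  ∃ w : G.Walk u v, w.IsPath ∧ w.length = n ∧ ∀ x, x ∈ S ↔ x ∈ w.support ∧ x ≠ u ∧ x ≠ v

theorem mem_nbr {X : Finset V} {v : V} : v ∈ nbr G X ↔ v ∉ X ∧ ∃ u ∈ X, G.Adj u v := by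
  simp [nbr]

theorem ball_succ (F A : Finset V) (i : ℕ) :
    ball G F A (i + 1) = ball G F A i ∪ (nbr G (ball G F A i) \ F) := rfl

theorem ball_subset_succ (F A : Finset V) (i : ℕ) : ball G F A i ⊆ ball G F A (i + 1) :=
  Finset.subset_union_left

theorem ball_mono (F A : Finset V) : Monotone (ball G F A) :=
  monotone_nat_of_le_succ (ball_subset_succ F A)

theorem subset_ball (F A : Finset V) (i : ℕ) : A ⊆ ball G F A i :=
  ball_mono F A (Nat.zero_le i)

theorem mem_ball_succ_of_adj {F A : Finset V} {i : ℕ} {u v : V} (hu : u ∈ ball G F A i)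
    (h : G.Adj u v) (hv : v ∉ F) : v ∈ ball G F A (i + 1) := by
  rw [ball_succ]
  by_cases hb : v ∈ ball G F A i
  · exact Finset.mem_union_left _ hb
  · exact Finset.mem_union_right _ (Finset.mem_sdiff.2 ⟨mem_nbr.2 ⟨hb, u, hu, h⟩, hv⟩)

theorem ball_disjoint {F A : Finset V} (h : Disjoint A F) (i : ℕ) :
    Disjoint (ball G F A i) F := by
  induction i with
  | zero => exact h
  | succ i ih =>
    rw [ball_succ, Finset.disjoint_union_left]
    exact ⟨ih, Finset.sdiff_disjoint⟩

/-- Balls grow with the start set and shrink with the forbidden set. -/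
theorem ball_subset_ball {F F' A A' : Finset V} (hA : A ⊆ A') (hF : F' ⊆ F) (i : ℕ) :
    ball G F A i ⊆ ball G F' A' i := by
  induction i with
  | zero => exact hA
  | succ i ih =>
    intro x hx
    rw [ball_succ, Finset.mem_union, Finset.mem_sdiff, mem_nbr] at hx
    rcases hx with hx | ⟨⟨-, u, hu, huv⟩, hxF⟩
    · exact ball_subset_succ _ _ _ (ih hx)
    · exact mem_ball_succ_of_adj (ih hu) huv fun h => hxF (hF h)

theorem ball_add (F A : Finset V) (i j : ℕ) :
    ball G F (ball G F A i) j = ball G F A (i + j) := by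
  induction j with
  | zero => rfl
  | succ j ih => rw [ball_succ, ih, ← add_assoc, ball_succ]

/-- The next ball is at least as large as the current one plus the usable neighbours. -/
theorem card_ball_succ (F A : Finset V) (i : ℕ) :
    (ball G F A i).card + (nbr G (ball G F A i)).card
      ≤ (ball G F A (i + 1)).card + (nbr G (ball G F A i) ∩ F).card := by
  rw [ball_succ, Finset.card_union_of_disjoint]
  · have := Finset.card_sdiff_add_card_inter (nbr G (ball G F A i)) F
    omega
  · rw [Finset.disjoint_left]
    intro x hx hx'
    exact (mem_nbr.1 (Finset.mem_sdiff.1 hx').1).1 hx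

theorem Reach.refl {S : Finset V} {u : V} (n : ℕ) (h : u ∈ S) : Reach G S n u u :=
  ⟨.nil, by simp, by simpa using h⟩

theorem Reach.mono {S T : Finset V} {n m : ℕ} {u v : V} (h : Reach G S n u v) (hS : S ⊆ T)
    (hn : n ≤ m) : Reach G T m u v := by
  obtain ⟨w, hw, hs⟩ := h
  exact ⟨w, hw.trans hn, fun x hx => hS (hs x hx)⟩

theorem Reach.symm {S : Finset V} {n : ℕ} {u v : V} (h : Reach G S n u v) :
    Reach G S n v u := by
  obtain ⟨w, hw, hs⟩ := h
  exact ⟨w.reverse, by simpa using hw, fun x hx => hs x (by simpa using hx)⟩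

theorem Reach.trans {S T : Finset V} {n m : ℕ} {u v w : V} (h : Reach G S n u v)
    (h' : Reach G T m v w) : Reach G (S ∪ T) (n + m) u w := by
  obtain ⟨p, hp, hs⟩ := h
  obtain ⟨q, hq, ht⟩ := h'
  refine ⟨p.append q, by rw [SimpleGraph.Walk.length_append]; omega, fun x hx => ?_⟩
  rw [SimpleGraph.Walk.mem_support_append_iff] at hx
  rw [Finset.mem_union]
  exact hx.imp (hs x) (ht x)

theorem Reach.trans_same {S : Finset V} {n m : ℕ} {u v w : V} (h : Reach G S n u v)
    (h' : Reach G S m v w) : Reach G S (n + m) u w := by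
  simpa using h.trans h'

theorem Reach.of_adj {u v : V} (h : G.Adj u v) : Reach G {u, v} 1 u v :=
  ⟨.cons h .nil, by simp, by simp⟩

theorem Reach.mem_left {S : Finset V} {n : ℕ} {u v : V} (h : Reach G S n u v) : u ∈ S := by
  obtain ⟨w, -, hs⟩ := h
  exact hs _ w.start_mem_support

theorem Reach.mem_right {S : Finset V} {n : ℕ} {u v : V} (h : Reach G S n u v) : v ∈ S :=
  h.symm.mem_left

theorem Reach.tail {S : Finset V} {n : ℕ} {u v w : V} (h : Reach G S n u v) (hvw : G.Adj v w)
    (hw : w ∈ S) : Reach G S (n + 1) u w := by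
  refine (h.trans (Reach.of_adj hvw)).mono ?_ le_rfl
  intro x
  have := h.mem_right
  simp only [Finset.mem_union, Finset.mem_insert, Finset.mem_singleton]
  rintro (h | rfl | rfl) <;> assumption

theorem Reach.subset_ball {S A F : Finset V} {n : ℕ} {u v : V} (h : Reach G S n u v)
    (hu : u ∈ A) (hS : Disjoint S F) : v ∈ ball G F A n := by
  obtain ⟨w, hn, hs⟩ := h
  refine ball_mono F A hn ?_
  clear hn
  induction w generalizing A with
  | nil => exact hu
  | cons hadj p ih =>
    rename_i x y z
    rw [SimpleGraph.Walk.length_cons, add_comm, ← ball_add]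
    refine ih ?_ fun x hx => hs x (List.mem_cons_of_mem _ hx)
    refine mem_ball_succ_of_adj hu hadj ?_
    exact Finset.disjoint_left.1 hS (hs _ (List.mem_cons_of_mem _ p.start_mem_support))

/-- Every vertex of a ball is reached from the start set inside the ball. -/
theorem exists_reach_of_mem_ball {F A : Finset V} {i : ℕ} {x : V} (hx : x ∈ ball G F A i) :
    ∃ a ∈ A, Reach G (ball G F A i) i a x := by
  induction i generalizing x with
  | zero => exact ⟨x, hx, .refl 0 hx⟩
  | succ i ih =>
    have hx' := hx
    rw [ball_succ, Finset.mem_union, Finset.mem_sdiff, mem_nbr] at hx'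
    rcases hx' with hx' | ⟨⟨-, u, hu, huv⟩, -⟩
    · obtain ⟨a, ha, h⟩ := ih hx'
      exact ⟨a, ha, h.mono (ball_subset_succ _ _ _) (by omega)⟩
    · obtain ⟨a, ha, h⟩ := ih hu
      exact ⟨a, ha, (h.mono (ball_subset_succ _ _ _) le_rfl).tail huv hx⟩

/-- Geodesic sets: a vertex of a ball is reached from the start set inside a set meeting the
balls of smaller radius in few vertices. -/
theorem exists_thin_reach {F A : Finset V} {i : ℕ} {x : V} (hx : x ∈ ball G F A i) :
    ∃ P ⊆ ball G F A i, ∃ a ∈ A, Reach G P i a x ∧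
      ∀ l, (P ∩ ball G F A l).card ≤ l + 1 := by
  induction i generalizing x with
  | zero =>
    refine ⟨{x}, by simpa using hx, x, hx, .refl 0 (by simp), fun l => ?_⟩
    calc _ ≤ ({x} : Finset V).card := Finset.card_le_card Finset.inter_subset_left
      _ ≤ l + 1 := by simp
  | succ i ih =>
    have hx' := hx
    by_cases hxi : x ∈ ball G F A i
    · obtain ⟨P, hP, a, ha, h, hl⟩ := ih hxi
      exact ⟨P, hP.trans (ball_subset_succ _ _ _), a, ha, h.mono subset_rfl (by omega), hl⟩
    rw [ball_succ, Finset.mem_union, Finset.mem_sdiff, mem_nbr] at hx'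
    rcases hx' with hx' | ⟨⟨-, u, hu, huv⟩, -⟩
    · exact absurd hx' hxi
    obtain ⟨P, hP, a, ha, h, hl⟩ := ih hu
    refine ⟨insert x P, ?_, a, ha, ?_, fun l => ?_⟩
    · exact Finset.insert_subset hx (hP.trans (ball_subset_succ _ _ _))
    · exact (h.mono (Finset.subset_insert _ _) le_rfl).tail huv (Finset.mem_insert_self _ _)
    · by_cases hli : l ≤ i
      · rw [Finset.insert_inter_of_notMem fun h => hxi (ball_mono F A hli h)]
        exact hl l
      · have h1 := hl i
        have h2 : P ∩ ball G F A i = P := Finset.inter_eq_left.2 hP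
        rw [h2] at h1
        calc _ ≤ (insert x P).card := Finset.card_le_card Finset.inter_subset_left
          _ ≤ P.card + 1 := Finset.card_insert_le _ _
          _ ≤ l + 1 := by omega

theorem Link.notMem_left {u v : V} {n : ℕ} {S : Finset V} (h : Link G u v n S) : u ∉ S := by
  obtain ⟨w, -, -, hs⟩ := h
  intro hu
  exact ((hs u).1 hu).2.1 rfl

theorem Link.notMem_right {u v : V} {n : ℕ} {S : Finset V} (h : Link G u v n S) : v ∉ S := by
  obtain ⟨w, -, -, hs⟩ := h
  intro hu
  exact ((hs v).1 hu).2.2 rfl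

theorem Link.symm {u v : V} {n : ℕ} {S : Finset V} (h : Link G u v n S) : Link G v u n S := by
  obtain ⟨w, hp, hl, hs⟩ := h
  refine ⟨w.reverse, hp.reverse, by simpa using hl, fun x => ?_⟩
  rw [hs]
  simp
  tauto

theorem Link.card_le {u v : V} {n : ℕ} {S : Finset V} (h : Link G u v n S) : S.card ≤ n := by
  obtain ⟨w, hp, hl, hs⟩ := h
  have h1 : insert u S ⊆ w.support.toFinset := by
    intro x hx
    rw [List.mem_toFinset]
    rcases Finset.mem_insert.1 hx with rfl | hx
    · exact w.start_mem_support
    · exact ((hs x).1 hx).1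
  have h2 := Finset.card_le_card h1
  have h3 := List.toFinset_card_le w.support
  rw [SimpleGraph.Walk.length_support] at h3
  rw [Finset.card_insert_of_notMem] at h2
  · omega
  · intro hu
    exact ((hs u).1 hu).2.1 rfl

theorem Link.of_adj {u v : V} (h : G.Adj u v) : Link G u v 1 ∅ := by
  refine ⟨.cons h .nil, ?_, rfl, fun x => ?_⟩
  · simp [h.ne]
  · simp
    tauto

/-- A walk within a set yields a path with interior in that set. -/
theorem Reach.exists_link {S : Finset V} {n : ℕ} {u v : V} (h : Reach G S n u v) :
    ∃ m ≤ n, ∃ T ⊆ S, Link G u v m T := by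
  obtain ⟨w, hn, hs⟩ := h
  refine ⟨w.bypass.length, w.length_bypass_le_length.trans hn,
    w.bypass.support.toFinset \ {u, v}, ?_, w.bypass, w.bypass_isPath, rfl, fun x => by simp⟩
  intro x hx
  simp only [Finset.mem_sdiff, List.mem_toFinset] at hx
  exact hs x (w.support_bypass_subset_support hx.1)

/-- Concatenation of paths. -/
theorem Link.trans {u v w : V} {n m : ℕ} {S T : Finset V} (h : Link G u v n S)
    (h' : Link G v w m T) (hST : Disjoint S T) (hu : u ∉ T) (hw : w ∉ S) (huv : u ≠ v)
    (hvw : v ≠ w) (huw : u ≠ w) : Link G u w (n + m) (insert v (S ∪ T)) := by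
  have hvS := h.notMem_right
  obtain ⟨p, hp, hl, hs⟩ := h
  obtain ⟨q, hq, hl', hs'⟩ := h'
  have key : ∀ x, x ∈ p.support → x ∈ q.support → x = v := by
    intro x hx hx'
    by_contra hxv
    by_cases hxu : x = u
    · subst hxu
      exact hu ((hs' x).2 ⟨hx', hxv, huw⟩)
    · have h1 := (hs x).2 ⟨hx, hxu, hxv⟩
      by_cases hxw : x = w
      · subst hxw
        exact hw h1
      · exact Finset.disjoint_left.1 hST h1 ((hs' x).2 ⟨hx', hxv, hxw⟩)
  refine ⟨p.append q, ?_, by simp [hl, hl'], fun x => ?_⟩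
  · rw [SimpleGraph.Walk.isPath_def, SimpleGraph.Walk.support_append, List.nodup_append]
    refine ⟨hp.support_nodup, hq.support_nodup.tail, fun a ha b hb hab => ?_⟩
    subst hab
    have := key a ha (List.mem_of_mem_tail hb)
    subst this
    have h2 := hq.support_nodup
    rw [← SimpleGraph.Walk.cons_tail_support, List.nodup_cons] at h2
    exact h2.1 hb
  · rw [Finset.mem_insert, Finset.mem_union, hs, hs', SimpleGraph.Walk.mem_support_append_iff]
    constructor
    · rintro (rfl | ⟨h1, h2, h3⟩ | ⟨h1, h2, h3⟩)
      · exact ⟨Or.inl p.end_mem_support, huv.symm, hvw⟩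
      · refine ⟨Or.inl h1, h2, ?_⟩
        rintro rfl
        exact hw ((hs x).2 ⟨h1, h2, h3⟩)
      · refine ⟨Or.inr h1, ?_, h3⟩
        rintro rfl
        exact hu ((hs' x).2 ⟨h1, h2, h3⟩)
    · rintro ⟨h1, h2, h3⟩
      by_cases hxv : x = v
      · exact Or.inl hxv
      · exact Or.inr (h1.imp (fun h => ⟨h, h2, hxv⟩) (fun h => ⟨h, hxv, h3⟩))

/-- Disjoint choices can be made one after the other. -/
theorem exists_disjoint_choice {ι α : Type*} [Fintype ι] (Pr : ι → α → Prop)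
    (body : ι → α → Finset V) (b : ℕ)
    (h : ∀ i (Φ : Finset V), Φ.card ≤ Fintype.card ι * b →
      ∃ a, Pr i a ∧ (body i a).card ≤ b ∧ Disjoint (body i a) Φ) :
    ∃ f : ι → α, (∀ i, Pr i (f i)) ∧
      ∀ i j, i ≠ j → Disjoint (body i (f i)) (body j (f j)) := by
  choose f0 hf0 using fun i => h i ∅ (by simp)
  have key : ∀ s : Finset ι, ∃ f : ι → α, (∀ i ∈ s, Pr i (f i) ∧ (body i (f i)).card ≤ b) ∧
      ∀ i ∈ s, ∀ j ∈ s, i ≠ j → Disjoint (body i (f i)) (body j (f j)) := by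
    intro s
    induction s using Finset.induction_on with
    | empty => exact ⟨f0, by simp, by simp⟩
    | insert i s hi ih =>
      obtain ⟨f, hf, hd⟩ := ih
      obtain ⟨a, ha, hab, hdis⟩ := h i (s.biUnion fun j => body j (f j)) <| by
        refine (Finset.card_biUnion_le_card_mul _ _ b fun j hj => (hf j hj).2).trans ?_
        exact Nat.mul_le_mul_right _ (Finset.card_le_univ s)
      rw [Finset.disjoint_biUnion_right] at hdis
      have hne : ∀ j ∈ s, j ≠ i := fun j hj h => hi (h ▸ hj)
      refine ⟨Function.update f i a, ?_, ?_⟩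
      · intro j hj
        rcases Finset.mem_insert.1 hj with rfl | hj
        · simpa using ⟨ha, hab⟩
        · simpa [Function.update_of_ne (hne j hj)] using hf j hj
      · intro j hj l hl hjl
        rw [Finset.mem_insert] at hj hl
        rcases hj with rfl | hj <;> rcases hl with rfl | hl
        · exact absurd rfl hjl
        · simpa [Function.update_of_ne (hne l hl)] using hdis l hl
        · simpa [Function.update_of_ne (hne j hj)] using (hdis j hj).symm
        · simpa [Function.update_of_ne (hne l hl), Function.update_of_ne (hne j hj)] using
            hd j hj l hl hjl
  obtain ⟨f, hf, hd⟩ := key Finset.univ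
  exact ⟨f, fun i => (hf i (Finset.mem_univ i)).1,
    fun i j => hd i (Finset.mem_univ i) j (Finset.mem_univ j)⟩

/-- Internally disjoint paths of the same length between core vertices form a balanced
subdivision. -/
theorem containsBalSub_of_links {k ℓ : ℕ} (c : Fin k → V) (hc : Function.Injective c)
    (S : Fin k → Fin k → Finset V) (hS : ∀ i j, i < j → Link G (c i) (c j) ℓ (S i j))
    (hcS : ∀ i j, i < j → ∀ q, c q ∉ S i j)
    (hd : ∀ i j, i < j → ∀ i' j', i' < j' → (i, j) ≠ (i', j') → Disjoint (S i j) (S i' j')) :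
    ContainsBalSub G k ℓ := by
  choose w hp hl hs using hS
  have hcase : ∀ i j (h : i < j) x, x ∈ (w i j h).support → x = c i ∨ x = c j ∨ x ∈ S i j := by
    intro i j h x hx
    have := hs i j h x
    tauto
  refine ⟨c, hc, w, fun i j h => ⟨hp i j h, hl i j h⟩, fun i j h q hq => ?_, ?_⟩
  · rcases hcase i j h _ hq with h1 | h1 | h1
    · exact Or.inl (hc h1)
    · exact Or.inr (hc h1)
    · exact absurd h1 (hcS i j h q)
  · intro i j h i' j' h' hne x hx hx'
    rcases hcase i j h _ hx with h1 | h1 | h1 <;> rcases hcase i' j' h' _ hx' with h2 | h2 | h2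
    all_goals first
      | exact ⟨by tauto, by tauto⟩
      | (subst h2; exact absurd h1 (hcS i j h _))
      | (subst h1; exact absurd h2 (hcS i' j' h' _))
      | exact absurd h2 (Finset.disjoint_left.1 (hd i j h i' j' h' hne) h1)

/-- If core vertices can be joined by a path of length `ℓ` avoiding any small set, there is a
balanced subdivision. -/
theorem containsBalSub_of_robust {k ℓ : ℕ} (c : Fin k → V) (hc : Function.Injective c)
    (h : ∀ i j, i < j → ∀ F : Finset V, F.card ≤ k * k * ℓ →
      ∃ S, Link G (c i) (c j) ℓ S ∧ Disjoint S F ∧ ∀ q, c q ∉ S) :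
    ContainsBalSub G k ℓ := by
  obtain ⟨f, hf, hd⟩ := exists_disjoint_choice (ι := {p : Fin k × Fin k // p.1 < p.2})
    (fun p S => Link G (c p.1.1) (c p.1.2) ℓ S ∧ ∀ q, c q ∉ S) (fun _ S => S) ℓ <| by
      intro p Φ hΦ
      obtain ⟨S, h1, h2, h3⟩ := h p.1.1 p.1.2 p.2 Φ <| hΦ.trans <| Nat.mul_le_mul_right _ <| by
        refine (Fintype.card_subtype_le _).trans ?_
        simp
      exact ⟨S, ⟨h1, h3⟩, h1.card_le, h2⟩
  refine containsBalSub_of_links c hc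
    (fun i j => if h : i < j then f ⟨(i, j), h⟩ else ∅) ?_ ?_ ?_
  · intro i j hij
    simpa [hij] using (hf ⟨(i, j), hij⟩).1
  · intro i j hij
    simpa [hij] using (hf ⟨(i, j), hij⟩).2
  · intro i j hij i' j' hij' hne
    simpa [hij, hij'] using hd ⟨(i, j), hij⟩ ⟨(i', j'), hij'⟩ (by simpa using hne)

end Basics

section DependentChoice
open scoped Classical
variable [Fintype V] {G : SimpleGraph V}

/-- If any small set can be avoided with some length at most `L`, one length works for all. -/
theorem exists_robust_length (Q : ℕ → Finset V → Prop) (hQ : ∀ n, Antitone (Q n))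
    (D : Finset V) (L ω : ℕ)
    (h : ∀ W : Finset V, W.card ≤ (L + 1) * ω → Disjoint W D → ∃ n ≤ L, Q n W) :
    ∃ n ≤ L, ∀ W : Finset V, W.card ≤ ω → Disjoint W D → Q n W := by
  by_contra! hcon
  have : ∀ n, ∃ W : Finset V, W.card ≤ ω ∧ Disjoint W D ∧ (n ≤ L → ¬ Q n W) := fun n => by
    by_cases hn : n ≤ L
    · obtain ⟨W, h1, h2, h3⟩ := hcon n hn
      exact ⟨W, h1, h2, fun _ => h3⟩
    · exact ⟨∅, by simp, by simp, fun h => absurd h hn⟩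
  choose W hW hWD hWQ using this
  obtain ⟨n, hn, hq⟩ := h ((Finset.range (L + 1)).biUnion W)
    ((Finset.card_biUnion_le_card_mul _ _ ω fun n _ => hW n).trans (by simp))
    (by rw [Finset.disjoint_biUnion_left]; exact fun n _ => hWD n)
  exact hWQ n hn (hQ n (Finset.subset_biUnion_of_mem W (Finset.mem_range.2 (by omega))) hq)

/-- Dependent random choice: if all vertices of `S` have large enough outneighbourhoods on
average, there are `k` vertices with pairwise many common outneighbours. -/
theorem exists_many_common (S : Finset V) (Γ : V → Finset V) (hΓ : ∀ x ∈ S, Γ x ⊆ S)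
    (k m l s : ℕ) (hl : 0 < l) (hN : 0 < S.card)
    (hdeg : S.card * S.card ≤ l * ∑ x ∈ S, (Γ x).card)
    (h1 : 2 * k * l ^ (s + 1) ≤ S.card) (h2 : 2 * (l * m) ^ (s + 1) ≤ S.card ^ s) :
    ∃ U ⊆ S, U.card = k ∧ ∀ x ∈ U, ∀ y ∈ U, x ≠ y → m ≤ (Γ x ∩ Γ y).card := by
  set t := s + 1 with ht
  set N := S.card with hNdef
  set 𝒯 := Fintype.piFinset fun _ : Fin t => S with h𝒯
  let U : (Fin t → V) → Finset V := fun T => S.filter fun x => ∀ i, T i ∈ Γ x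
  let bad : Finset (V × V) := (S ×ˢ S).filter fun p => (Γ p.1 ∩ Γ p.2).card < m
  let Bd : (Fin t → V) → Finset (V × V) := fun T =>
    bad.filter fun p => ∀ i, T i ∈ Γ p.1 ∩ Γ p.2
  have hcount : ∀ A : Finset V, A ⊆ S → (𝒯.filter fun T => ∀ i, T i ∈ A).card = A.card ^ t := by
    intro A hA
    have : (𝒯.filter fun T => ∀ i, T i ∈ A) = Fintype.piFinset fun _ : Fin t => A := by
      ext T
      simp only [h𝒯, Finset.mem_filter, Fintype.mem_piFinset]
      exact ⟨fun h => h.2, fun h => ⟨fun i => hA (h i), h⟩⟩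
    rw [this, Fintype.card_piFinset]
    simp
  have hU : ∑ T ∈ 𝒯, (U T).card = ∑ x ∈ S, (Γ x).card ^ t := by
    rw [show ∑ T ∈ 𝒯, (U T).card = ∑ x ∈ S, (𝒯.filter fun T => ∀ i, T i ∈ Γ x).card from
      Finset.sum_card_bipartiteAbove_eq_sum_card_bipartiteBelow _]
    exact Finset.sum_congr rfl fun x hx => hcount _ (hΓ x hx)
  have hB : ∑ T ∈ 𝒯, (Bd T).card ≤ N ^ 2 * m ^ t := by
    rw [show ∑ T ∈ 𝒯, (Bd T).card
        = ∑ p ∈ bad, (𝒯.filter fun T => ∀ i, T i ∈ Γ p.1 ∩ Γ p.2).card from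
      Finset.sum_card_bipartiteAbove_eq_sum_card_bipartiteBelow _]
    calc _ ≤ ∑ p ∈ bad, m ^ t := by
          refine Finset.sum_le_sum fun p hp => ?_
          simp only [bad, Finset.mem_filter, Finset.mem_product] at hp
          rw [hcount _ (Finset.inter_subset_left.trans (hΓ _ hp.1.1))]
          exact Nat.pow_le_pow_left hp.2.le _
      _ = bad.card * m ^ t := by simp
      _ ≤ N ^ 2 * m ^ t := by
          refine Nat.mul_le_mul_right _ ((Finset.card_filter_le _ _).trans ?_)
          rw [Finset.card_product, pow_two]
  have hpm : N ^ (t + 1) ≤ l ^ t * ∑ x ∈ S, (Γ x).card ^ t := by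
    have h3 := pow_sum_le_card_mul_sum_pow (s := S) (f := fun x => (Γ x).card)
      (fun _ _ => Nat.zero_le _) s
    refine Nat.le_of_mul_le_mul_left (c := N ^ s) ?_ (by positivity)
    calc N ^ s * N ^ (t + 1) = (N * N) ^ t := by rw [ht]; ring
      _ ≤ (l * ∑ x ∈ S, (Γ x).card) ^ t := Nat.pow_le_pow_left hdeg _
      _ = l ^ t * (∑ x ∈ S, (Γ x).card) ^ t := mul_pow _ _ _
      _ ≤ l ^ t * (N ^ s * ∑ x ∈ S, (Γ x).card ^ t) := Nat.mul_le_mul_left _ h3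
      _ = _ := by ring
  have h𝒯c : 𝒯.card = N ^ t := by
    rw [h𝒯, Fintype.card_piFinset]
    simp [hNdef]
  obtain ⟨T, hT, hTk⟩ : ∃ T ∈ 𝒯, k + (Bd T).card ≤ (U T).card := by
    by_contra! hcon
    have h4 : ∑ T ∈ 𝒯, ((U T).card + 1) ≤ ∑ T ∈ 𝒯, (k + (Bd T).card) :=
      Finset.sum_le_sum fun T hT => hcon T hT
    rw [Finset.sum_add_distrib, Finset.sum_add_distrib, hU] at h4
    simp only [Finset.sum_const, smul_eq_mul, h𝒯c, mul_one] at h4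
    have h5 : 0 < N ^ t := by positivity
    have h6 : l ^ t * (∑ x ∈ S, (Γ x).card ^ t + N ^ t) ≤ l ^ t * (N ^ t * k + N ^ 2 * m ^ t) :=
      Nat.mul_le_mul_left _ (h4.trans (Nat.add_le_add_left hB _))
    have h7 : 2 * (l ^ t * (N ^ t * k)) ≤ N ^ (t + 1) := by
      calc 2 * (l ^ t * (N ^ t * k)) = N ^ t * (2 * k * l ^ t) := by ring
        _ ≤ N ^ t * N := Nat.mul_le_mul_left _ h1
        _ = _ := by ring
    have h8 : 2 * (l ^ t * (N ^ 2 * m ^ t)) ≤ N ^ (t + 1) := by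
      calc 2 * (l ^ t * (N ^ 2 * m ^ t)) = N ^ 2 * (2 * (l * m) ^ t) := by ring
        _ ≤ N ^ 2 * N ^ s := Nat.mul_le_mul_left _ h2
        _ = _ := by rw [ht]; ring
    have h9 : 0 < l ^ t * N ^ t := by positivity
    nlinarith
  have hle : k ≤ (U T \ (Bd T).image Prod.fst).card := by
    have h10 := Finset.le_card_sdiff ((Bd T).image Prod.fst) (U T)
    have h11 : ((Bd T).image Prod.fst).card ≤ (Bd T).card := Finset.card_image_le
    omega
  obtain ⟨W, hW, hWk⟩ := Finset.exists_subset_card_eq hle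
  refine ⟨W, fun x hx => ?_, hWk, fun x hx y hy hxy => ?_⟩
  · exact (Finset.mem_filter.1 (Finset.mem_sdiff.1 (hW hx)).1).1
  · by_contra! hlt
    have hx' := Finset.mem_sdiff.1 (hW hx)
    have hy' := Finset.mem_sdiff.1 (hW hy)
    simp only [U, Finset.mem_filter] at hx' hy'
    apply hx'.2
    rw [Finset.mem_image]
    refine ⟨(x, y), ?_, rfl⟩
    simp only [Bd, bad, Finset.mem_filter, Finset.mem_product, Finset.mem_inter]
    exact ⟨⟨⟨hx'.1.1, hy'.1.1⟩, hlt⟩, fun i => ⟨hx'.1.2 i, hy'.1.2 i⟩⟩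

/-- A set whose pairs are robustly joined by paths of few possible lengths yields a balanced
subdivision. -/
theorem exists_containsBalSub_of_colouring (S : Finset V) (χ : V → V → ℕ) (k L ω m s : ℕ)
    (hk : 0 < k) (hL : 0 < L) (hχL : ∀ x ∈ S, ∀ y ∈ S, x ≠ y → χ x y ≤ L)
    (hχ : ∀ x ∈ S, ∀ y ∈ S, x ≠ y → ∀ W : Finset V, W.card ≤ ω → x ∉ W → y ∉ W →
      ∃ T, Link G x y (χ x y) T ∧ Disjoint T W)
    (hm : k * k * (2 * L) + k < m) (hω : k * k * (2 * L) + k + L ≤ ω)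
    (h1 : 2 * k * (4 * L) ^ (s + 1) ≤ S.card) (h2 : 2 * (4 * L * m) ^ (s + 1) ≤ S.card ^ s) :
    ∃ ℓ, ContainsBalSub G k ℓ := by
  have hN : 2 ≤ S.card := by
    refine le_trans ?_ h1
    have : 0 < k * (4 * L) ^ (s + 1) := by positivity
    nlinarith
  obtain ⟨α, hαL, hα⟩ : ∃ α ∈ Finset.range (L + 1), S.offDiag.card
      ≤ (L + 1) * (S.offDiag.filter fun p => χ p.1 p.2 = α).card := by
    by_contra! hcon
    have h3 : S.offDiag.card = ∑ α ∈ Finset.range (L + 1),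
        (S.offDiag.filter fun p => χ p.1 p.2 = α).card := by
      refine Finset.card_eq_sum_card_fiberwise fun p hp => ?_
      have hp' := Finset.mem_offDiag.1 hp
      simpa [Nat.lt_succ_iff] using hχL _ hp'.1 _ hp'.2.1 hp'.2.2
    have h4 := Finset.sum_lt_sum_of_nonempty (s := Finset.range (L + 1)) (by simp) hcon
    rw [← Finset.mul_sum, ← h3] at h4
    simp at h4
  let Γ : V → Finset V := fun x => S.filter fun y => x ≠ y ∧ χ x y = α
  have hΓsum : ∑ x ∈ S, (Γ x).card = (S.offDiag.filter fun p => χ p.1 p.2 = α).card := by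
    rw [Finset.card_eq_sum_card_fiberwise (f := Prod.fst) (t := S)]
    · refine Finset.sum_congr rfl fun x hx => ?_
      refine Finset.card_bij (fun y _ => (x, y)) ?_ ?_ ?_
      · intro y hy
        simp only [Γ, Finset.mem_filter] at hy
        simp [hx, hy.1, hy.2.1, hy.2.2]
      · intro y _ y' _ h
        simpa using h
      · rintro ⟨x', y⟩ hp
        simp only [Finset.mem_filter, Finset.mem_offDiag] at hp
        obtain ⟨⟨⟨h3, h4, h5⟩, h6⟩, rfl⟩ := hp
        exact ⟨y, by simp [Γ, h4, h5, h6], rfl⟩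
    · intro p hp
      simp only [Finset.coe_filter, Finset.mem_offDiag, Set.mem_ofPred_eq] at hp
      exact hp.1.1
  have hdeg : S.card * S.card ≤ (4 * L) * ∑ x ∈ S, (Γ x).card := by
    rw [hΓsum]
    rw [Finset.offDiag_card] at hα
    have h3 : S.card * S.card ≤ 2 * (S.card * S.card - S.card) := by
      have : 2 * S.card ≤ S.card * S.card := Nat.mul_le_mul_right _ hN
      omega
    calc _ ≤ 2 * (S.card * S.card - S.card) := h3
      _ ≤ 2 * ((L + 1) * _) := Nat.mul_le_mul_left _ hα
      _ ≤ 2 * ((2 * L) * _) := by gcongr; omega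
      _ = _ := by ring
  obtain ⟨U, hUS, hUk, hU⟩ := exists_many_common S Γ (fun x _ => Finset.filter_subset _ _)
    k m (4 * L) s (by positivity) (by omega) hdeg h1 h2
  refine ⟨α + α, containsBalSub_of_robust (fun i => (U.equivFin.symm (i.cast hUk.symm) : V)) ?_ ?_⟩
  · intro i j hij
    simpa using hij
  set c : Fin k → V := fun i => (U.equivFin.symm (i.cast hUk.symm) : V) with hc
  have hcU : ∀ i, c i ∈ U := fun i => (U.equivFin.symm (i.cast hUk.symm)).2
  intro i j hij F hF
  have hne : c i ≠ c j := by
    intro h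
    exact hij.ne (by simpa [hc] using h)
  rw [Finset.mem_range] at hαL
  have hF' : F.card ≤ k * k * (2 * L) := hF.trans (Nat.mul_le_mul_left _ (by omega))
  have hFU : (F ∪ U).card ≤ k * k * (2 * L) + k := (Finset.card_union_le _ _).trans (by omega)
  obtain ⟨y, hy, hyF⟩ := Finset.exists_mem_notMem_of_card_lt_card
    (lt_of_lt_of_le (lt_of_le_of_lt hFU hm) (hU _ (hcU i) _ (hcU j) hne))
  simp only [Γ, Finset.mem_inter, Finset.mem_filter] at hy
  rw [Finset.mem_union, not_or] at hyF
  obtain ⟨⟨hyS, hiy, hiα⟩, -, hjy, hjα⟩ := hy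
  obtain ⟨T1, hT1, hd1⟩ := hχ _ (hUS (hcU i)) y hyS hiy ((F ∪ U).erase (c i))
    ((Finset.card_le_card (Finset.erase_subset _ _)).trans (by omega)) (by simp)
    (by simp [hyF])
  have hT1c := hT1.card_le
  rw [hiα] at hT1c hT1
  obtain ⟨T2, hT2, hd2⟩ := hχ _ (hUS (hcU j)) y hyS hjy ((F ∪ U ∪ T1).erase (c j))
    ((Finset.card_le_card (Finset.erase_subset _ _)).trans
      ((Finset.card_union_le _ _).trans (by omega))) (by simp)
    (by simp [hyF, hT1.notMem_right])
  rw [hjα] at hT2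
  have hjT1 : c j ∉ T1 := fun h => Finset.disjoint_left.1 hd1 h (by simp [hcU j, hne.symm])
  have hiT2 : c i ∉ T2 := fun h => Finset.disjoint_left.1 hd2 h (by simp [hcU i, hne])
  have hd12 : Disjoint T1 T2 := by
    rw [Finset.disjoint_left]
    intro x h1 h2
    refine Finset.disjoint_left.1 hd2 h2 (Finset.mem_erase.2 ⟨?_, by simp [h1]⟩)
    rintro rfl
    exact hjT1 h1
  refine ⟨_, hT1.trans hT2.symm hd12 hiT2 hjT1 hiy hjy.symm hne, ?_, fun q => ?_⟩
  · rw [Finset.disjoint_left]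
    intro x hx hxF
    simp only [Finset.mem_insert, Finset.mem_union] at hx
    rcases hx with rfl | hx | hx
    · exact hyF.1 hxF
    · refine Finset.disjoint_left.1 hd1 hx (Finset.mem_erase.2 ⟨?_, by simp [hxF]⟩)
      rintro rfl
      exact hT1.notMem_left hx
    · refine Finset.disjoint_left.1 hd2 hx (Finset.mem_erase.2 ⟨?_, by simp [hxF]⟩)
      rintro rfl
      exact hT2.notMem_left hx
  · simp only [Finset.mem_insert, Finset.mem_union, not_or]
    refine ⟨?_, fun hx => ?_, fun hx => ?_⟩
    · intro h
      exact hyF.2 (h ▸ hcU q)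
    · refine Finset.disjoint_left.1 hd1 hx
        (Finset.mem_erase.2 ⟨?_, Finset.mem_union_right _ (hcU q)⟩)
      intro h
      exact hT1.notMem_left (h ▸ hx)
    · refine Finset.disjoint_left.1 hd2 hx
        (Finset.mem_erase.2 ⟨?_, Finset.mem_union_left _ (Finset.mem_union_right _ (hcU q))⟩)
      intro h
      exact hT2.notMem_left (h ▸ hx)

/-- A convenient choice of parameters in `exists_containsBalSub_of_colouring`. -/
theorem exists_containsBalSub_of_colouring' (S : Finset V) (χ : V → V → ℕ) (a j L ω : ℕ)
    (ha : 0 < a) (hj : 0 < j) (hL : 0 < L) (hχL : ∀ x ∈ S, ∀ y ∈ S, x ≠ y → χ x y ≤ L)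
    (hχ : ∀ x ∈ S, ∀ y ∈ S, x ≠ y → ∀ W : Finset V, W.card ≤ ω → x ∉ W → y ∉ W →
      ∃ T, Link G x y (χ x y) T ∧ Disjoint T W)
    (hω : 4 * L * j ^ (2 * a) ≤ ω) (hS : j ^ (2 * a + 1) * (8 * L) ^ (2 * a + 2) ≤ S.card) :
    ∃ ℓ, ContainsBalSub G (j ^ a) ℓ := by
  obtain ⟨k, hk⟩ : ∃ k, k = j ^ a := ⟨_, rfl⟩
  have hk0 : 0 < k := by rw [hk]; positivity
  have hkk : j ^ (2 * a) = k * k := by rw [hk]; ring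
  rw [hkk] at hω
  have h3 : k ≤ k * k := Nat.le_mul_of_pos_left _ hk0
  have h4 : L ≤ L * (k * k) := Nat.le_mul_of_pos_right _ (by positivity)
  have h5 : k * k ≤ L * (k * k) := Nat.le_mul_of_pos_left _ hL
  rw [← hk]
  refine exists_containsBalSub_of_colouring S χ k L ω (4 * L * (k * k) + 1) (2 * a) hk0 hL hχL hχ
    (by nlinarith) (by nlinarith) ?_ ?_
  · refine le_trans ?_ hS
    calc 2 * k * (4 * L) ^ (2 * a + 1) = k * (2 * (4 * L) ^ (2 * a + 1)) := by ring
      _ ≤ j ^ (2 * a + 1) * (8 * L) ^ (2 * a + 2) := by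
        refine Nat.mul_le_mul ?_ ?_
        · rw [hk]
          exact Nat.pow_le_pow_right hj (by omega)
        · rw [pow_succ (8 * L) (2 * a + 1), mul_comm]
          exact Nat.mul_le_mul (Nat.pow_le_pow_left (by omega) _) (by omega)
  · calc 2 * (4 * L * (4 * L * (k * k) + 1)) ^ (2 * a + 1)
        ≤ (2 * (4 * L * (4 * L * (k * k) + 1))) ^ (2 * a + 1) := by
          rw [mul_pow 2]
          refine Nat.mul_le_mul_right _ ?_
          calc 2 = 2 ^ 1 := rfl
            _ ≤ 2 ^ (2 * a + 1) := Nat.pow_le_pow_right (by norm_num) (by omega)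
      _ ≤ ((8 * L) ^ 2 * (k * k)) ^ (2 * a + 1) := by
          refine Nat.pow_le_pow_left ?_ _
          nlinarith
      _ = j ^ ((2 * a + 1) * (2 * a)) * (8 * L) ^ (4 * a + 2) := by
          rw [mul_pow, ← hkk, ← pow_mul, ← pow_mul, mul_comm]
          ring_nf
      _ ≤ j ^ ((2 * a + 1) * (2 * a)) * (8 * L) ^ ((2 * a + 2) * (2 * a)) := by
          gcongr
          · omega
          · nlinarith
      _ = (j ^ (2 * a + 1) * (8 * L) ^ (2 * a + 2)) ^ (2 * a) := by
          rw [mul_pow (j ^ _), ← pow_mul, ← pow_mul]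
      _ ≤ _ := Nat.pow_le_pow_left hS _

/-- A large set whose pairs are robustly joined by short paths yields a balanced subdivision. -/
theorem exists_containsBalSub_of_connected (S : Finset V) (a j L ω : ℕ)
    (ha : 0 < a) (hj : 0 < j) (hL : 0 < L)
    (hc : ∀ x ∈ S, ∀ y ∈ S, x ≠ y → ∀ W : Finset V, W.card ≤ ω → x ∉ W → y ∉ W →
      ∃ n ≤ L, ∃ T, Link G x y n T ∧ Disjoint T W)
    (hω : (L + 1) * (4 * L * j ^ (2 * a)) ≤ ω)
    (hS : j ^ (2 * a + 1) * (8 * L) ^ (2 * a + 2) ≤ S.card) :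
    ∃ ℓ, ContainsBalSub G (j ^ a) ℓ := by
  have : ∀ x y, ∃ n, x ∈ S → y ∈ S → x ≠ y → n ≤ L ∧ ∀ W : Finset V,
      W.card ≤ 4 * L * j ^ (2 * a) → Disjoint W {x, y} → ∃ T, Link G x y n T ∧ Disjoint T W := by
    intro x y
    by_cases h : x ∈ S ∧ y ∈ S ∧ x ≠ y
    · obtain ⟨n, hn, hnW⟩ := exists_robust_length
        (fun n W => ∃ T, Link G x y n T ∧ Disjoint T W)
        (fun n W W' hW ⟨T, hT, hd⟩ => ⟨T, hT, hd.mono_right hW⟩) {x, y} L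
        (4 * L * j ^ (2 * a)) fun W hW hd => by
          simp only [Finset.disjoint_insert_right, Finset.disjoint_singleton_right] at hd
          exact hc x h.1 y h.2.1 h.2.2 W (hW.trans hω) hd.1 hd.2
      exact ⟨n, fun _ _ _ => ⟨hn, hnW⟩⟩
    · exact ⟨0, fun h1 h2 h3 => absurd ⟨h1, h2, h3⟩ h⟩
  choose χ hχ using this
  refine exists_containsBalSub_of_colouring' S χ a j L _ ha hj hL
    (fun x hx y hy hxy => (hχ x y hx hy hxy).1) (fun x hx y hy hxy W hW hxW hyW => ?_) le_rfl hS
  exact (hχ x y hx hy hxy).2 W hW (by simp [hxW, hyW])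

end DependentChoice

section Expander
open scoped Classical

theorem ContainsBalSub.map {V' : Type*} {G' : SimpleGraph V'} {G : SimpleGraph V} (f : G' →g G)
    (hf : Function.Injective f) {k ℓ : ℕ} (h : ContainsBalSub G' k ℓ) : ContainsBalSub G k ℓ := by
  obtain ⟨c, hc, P, h1, h2, h3⟩ := h
  refine ⟨f ∘ c, hf.comp hc, fun i j hij => (P i j hij).map f, fun i j hij => ⟨?_, ?_⟩,
    fun i j hij q hq => ?_, fun i j hij i' j' hij' hne x hx hx' => ?_⟩
  · exact (h1 i j hij).1.map hf
  · rw [SimpleGraph.Walk.length_map]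
    exact (h1 i j hij).2
  · rw [SimpleGraph.Walk.support_map, List.mem_map] at hq
    obtain ⟨z, hz, hzq⟩ := hq
    rw [hf hzq] at hz
    exact h2 i j hij q hz
  · rw [SimpleGraph.Walk.support_map, List.mem_map] at hx hx'
    obtain ⟨z, hz, rfl⟩ := hx
    obtain ⟨z', hz', hzz⟩ := hx'
    rw [hf hzz] at hz'
    simpa [hf.eq_iff] using h3 i j hij i' j' hij' hne z hz hz'

variable [Fintype V] {G : SimpleGraph V}

/-- The number of ordered pairs of adjacent vertices in `S`. -/
noncomputable def adjPairs (G : SimpleGraph V) (S : Finset V) : ℕ :=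
  ((S ×ˢ S).filter fun p => G.Adj p.1 p.2).card

/-- The bipartite spanning subgraph of a two-colouring. -/
def cutGraph (G : SimpleGraph V) (f : V → Bool) : SimpleGraph V where
  Adj u v := G.Adj u v ∧ f u ≠ f v
  symm := ⟨fun _ _ h => ⟨h.1.symm, h.2.symm⟩⟩
  loopless := ⟨fun _ h => h.2 rfl⟩

theorem card_adj_eq : adjPairs G Finset.univ = 2 * Nat.card G.edgeSet := by
  have h1 := G.sum_degrees_eq_twice_card_edges
  rw [Nat.card_eq_fintype_card, ← SimpleGraph.edgeFinset_card, ← h1, adjPairs,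
    Finset.card_filter, Finset.sum_product]
  refine Finset.sum_congr rfl fun v _ => ?_
  rw [← Finset.card_filter, ← SimpleGraph.card_neighborFinset_eq_degree]
  congr 1
  ext w
  simp

theorem exists_cutGraph (G : SimpleGraph V) :
    ∃ f : V → Bool, adjPairs G Finset.univ ≤ 2 * adjPairs (cutGraph G f) Finset.univ := by
  by_contra! hcon
  have h1 : ∑ f : V → Bool, 2 * adjPairs (cutGraph G f) Finset.univ
      < ∑ f : V → Bool, adjPairs G Finset.univ :=
    Finset.sum_lt_sum_of_nonempty Finset.univ_nonempty fun f _ => hcon f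
  have h2 : ∀ a b : V, a ≠ b → 2 * (Finset.univ.filter fun f : V → Bool => f a ≠ f b).card
      = Fintype.card (V → Bool) := by
    intro a b hab
    have h3 : (Finset.univ.filter fun f : V → Bool => f a ≠ f b).card
        = (Finset.univ.filter fun f : V → Bool => ¬ f a ≠ f b).card := by
      refine Finset.card_bij' (fun f _ => Function.update f a (!f a))
        (fun f _ => Function.update f a (!f a)) ?_ ?_ ?_ ?_
      · intro f hf
        simp only [Finset.mem_filter, Finset.mem_univ, true_and] at hf ⊢
        rw [Function.update_self, Function.update_of_ne hab.symm]
        cases h : f a <;> cases h' : f b <;> simp_all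
      · intro f hf
        simp only [Finset.mem_filter, Finset.mem_univ, true_and] at hf ⊢
        rw [Function.update_self, Function.update_of_ne hab.symm]
        cases h : f a <;> cases h' : f b <;> simp_all
      · intro f _
        simp
      · intro f _
        simp
    have h4 := Finset.card_filter_add_card_filter_not (s := (Finset.univ : Finset (V → Bool)))
      (fun f => f a ≠ f b)
    rw [Finset.card_univ] at h4
    omega
  have h5 : ∑ f : V → Bool, 2 * adjPairs (cutGraph G f) Finset.univ
      = ∑ f : V → Bool, adjPairs G Finset.univ := by
    simp only [adjPairs, Finset.card_filter]
    rw [← Finset.mul_sum, Finset.sum_comm,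
      Finset.sum_comm (s := (Finset.univ : Finset (V → Bool))), Finset.mul_sum]
    refine Finset.sum_congr rfl fun p _ => ?_
    by_cases h : G.Adj p.1 p.2
    · simp only [cutGraph, h, true_and, if_true, ← Finset.card_filter, Finset.sum_const,
        smul_eq_mul, mul_one, Finset.card_univ]
      exact h2 _ _ h.ne
    · simp [cutGraph, h]
  omega

theorem adjPairs_le_add (X : Finset V) :
    adjPairs G Finset.univ ≤ adjPairs G (X ∪ nbr G X) + adjPairs G Xᶜ := by
  unfold adjPairs
  refine le_trans (Finset.card_le_card ?_) (Finset.card_union_le _ _)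
  rintro ⟨u, v⟩ huv
  simp only [Finset.mem_filter, Finset.mem_product, Finset.mem_univ, Finset.mem_union,
    Finset.mem_compl, mem_nbr, true_and] at huv ⊢
  by_cases hu : u ∈ X <;> by_cases hv : v ∈ X
  · exact Or.inl ⟨⟨Or.inl hu, Or.inl hv⟩, huv⟩
  · exact Or.inl ⟨⟨Or.inl hu, Or.inr ⟨hv, u, hu, huv⟩⟩, huv⟩
  · exact Or.inl ⟨⟨Or.inr ⟨hu, v, hv, huv.symm⟩, Or.inl hv⟩, huv⟩
  · exact Or.inr ⟨⟨hu, hv⟩, huv⟩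

theorem adjPairs_le_singleton (v : V) :
    adjPairs G Finset.univ ≤ adjPairs G {v}ᶜ + 2 * (nbr G {v}).card := by
  have h : adjPairs G Finset.univ ≤ (((({v}ᶜ : Finset V) ×ˢ {v}ᶜ).filter fun p => G.Adj p.1 p.2)
      ∪ ((nbr G {v}).image (fun u => (u, v)) ∪ (nbr G {v}).image (fun u => (v, u)))).card := by
    refine Finset.card_le_card ?_
    rintro ⟨x, y⟩ hxy
    simp only [Finset.mem_filter, Finset.mem_product, Finset.mem_univ, true_and, Finset.mem_union,
      Finset.mem_compl, Finset.mem_singleton, Finset.mem_image, mem_nbr, Prod.mk.injEq] at hxy ⊢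
    by_cases hx : x = v
    · subst hx
      exact Or.inr (Or.inr ⟨y, ⟨hxy.ne', x, rfl, hxy⟩, rfl, rfl⟩)
    · by_cases hy : y = v
      · subst hy
        exact Or.inr (Or.inl ⟨x, ⟨hx, y, rfl, hxy.symm⟩, rfl, rfl⟩)
      · exact Or.inl ⟨⟨hx, hy⟩, hxy⟩
  refine h.trans ((Finset.card_union_le _ _).trans ?_)
  have h1 := Finset.card_union_le ((nbr G {v}).image (fun u => (u, v)))
    ((nbr G {v}).image (fun u => (v, u)))
  have h2 : ((nbr G {v}).image (fun u => (u, v))).card ≤ (nbr G {v}).card := Finset.card_image_le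
  have h3 : ((nbr G {v}).image (fun u => (v, u))).card ≤ (nbr G {v}).card := Finset.card_image_le
  unfold adjPairs
  omega

theorem adjPairs_induce (S : Finset V) (X : Finset S) :
    adjPairs (G.induce (S : Set V)) X = adjPairs G (X.map (Function.Embedding.subtype _)) := by
  unfold adjPairs
  refine Finset.card_bij (fun p _ => ((p.1 : V), (p.2 : V))) ?_ ?_ ?_
  · rintro ⟨a, b⟩ h
    simpa using h
  · rintro ⟨a, b⟩ _ ⟨a', b'⟩ _ h
    exact Prod.ext (Subtype.ext (Prod.mk.inj h).1) (Subtype.ext (Prod.mk.inj h).2)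
  · rintro ⟨a, b⟩ h
    simp only [Finset.mem_filter, Finset.mem_product, Finset.mem_map,
      Function.Embedding.subtype_apply] at h
    obtain ⟨⟨⟨a, ha, rfl⟩, ⟨b, hb, rfl⟩⟩, h⟩ := h
    exact ⟨(a, b), Finset.mem_filter.2 ⟨Finset.mem_product.2 ⟨ha, hb⟩, h⟩, rfl⟩

/-- The density profile against which edges are counted. -/
noncomputable def profile (m : ℝ) : ℝ := 2 - 1 / (1 + Real.log m)

theorem profile_mono {m n : ℝ} (hm : 1 ≤ m) (h : m ≤ n) : profile m ≤ profile n := by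
  unfold profile
  have h1 : 0 ≤ Real.log m := Real.log_nonneg hm
  have h2 : Real.log m ≤ Real.log n := Real.log_le_log (by linarith) h
  have h3 : 1 / (1 + Real.log n) ≤ 1 / (1 + Real.log m) :=
    one_div_le_one_div_of_le (by linarith) (by linarith)
  linarith

theorem one_le_profile {m : ℝ} (hm : 1 ≤ m) : 1 ≤ profile m := by
  have h1 : 0 ≤ Real.log m := Real.log_nonneg hm
  have : 1 / (1 + Real.log m) ≤ 1 := by
    rw [div_le_one (by linarith)]
    linarith
  unfold profile
  linarith

theorem profile_le_two {m : ℝ} (hm : 1 ≤ m) : profile m ≤ 2 := by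
  have h1 : 0 ≤ Real.log m := Real.log_nonneg hm
  have : 0 ≤ 1 / (1 + Real.log m) := by positivity
  unfold profile
  linarith

theorem profile_sub {m n : ℝ} (hm : 1 ≤ m) (hn : 1 ≤ n) :
    profile n - profile m
      = (Real.log n - Real.log m) / ((1 + Real.log m) * (1 + Real.log n)) := by
  have h1 : 0 ≤ Real.log m := Real.log_nonneg hm
  have h2 : 0 ≤ Real.log n := Real.log_nonneg hn
  unfold profile
  have h3 : 1 + Real.log m ≠ 0 := by positivity
  have h4 : 1 + Real.log n ≠ 0 := by positivity
  field_simp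
  ring

/-- A nonempty graph extremal for the edge-density profile. -/
structure IsCritical (G : SimpleGraph V) (D : ℝ) : Prop where
  card_pos : 0 < Fintype.card V
  le : D * Fintype.card V * profile (Fintype.card V) ≤ adjPairs G Finset.univ
  lt : ∀ X : Finset V, X.Nonempty → X.card < Fintype.card V →
    (adjPairs G X : ℝ) < D * X.card * profile X.card

theorem exists_isCritical [Nonempty V] (D : ℝ) (hD : 0 ≤ D)
    (h : D * Fintype.card V * 2 ≤ adjPairs G Finset.univ) :
    ∃ S : Finset V, IsCritical (G.induce (S : Set V)) D := by
  let 𝒮 := (Finset.univ : Finset (Finset V)).filter fun S => S.Nonempty ∧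
    D * S.card * profile S.card ≤ adjPairs G S
  have hne : 𝒮.Nonempty := by
    refine ⟨Finset.univ, ?_⟩
    simp only [𝒮, Finset.mem_filter, Finset.mem_univ, true_and, Finset.univ_nonempty,
      Finset.card_univ]
    refine le_trans ?_ h
    refine mul_le_mul_of_nonneg_left (profile_le_two ?_) (by positivity)
    exact_mod_cast Fintype.card_pos
  obtain ⟨S, hS, hmin⟩ := Finset.exists_min_image 𝒮 Finset.card hne
  simp only [𝒮, Finset.mem_filter, Finset.mem_univ, true_and] at hS hmin
  refine ⟨S, ?_, ?_, ?_⟩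
  · simpa using Finset.card_pos.2 hS.1
  · rw [adjPairs_induce]
    have h1 : (Finset.univ : Finset S).map (Function.Embedding.subtype _) = S := by
      ext x
      simp
    have h2 : Fintype.card (S : Set V) = S.card := by simp
    rw [h2]
    convert hS.2 using 3
  · intro X hX hXc
    rw [adjPairs_induce]
    by_contra! hcon
    have h2 : Fintype.card (S : Set V) = S.card := by simp
    have h3 := hmin (X.map (Function.Embedding.subtype _)) ⟨by simpa using hX, by
      rw [Finset.card_map]
      exact hcon⟩
    rw [Finset.card_map] at h3
    omega

theorem IsCritical.le_degree {D : ℝ} (h : IsCritical G D) (hD : 0 < D) (v : V) :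
    D / 2 ≤ (nbr G {v}).card := by
  have h1 : (adjPairs G Finset.univ : ℝ) ≤ adjPairs G {v}ᶜ + 2 * (nbr G {v}).card := by
    exact_mod_cast adjPairs_le_singleton v
  have hc : (({v} : Finset V)ᶜ).card = Fintype.card V - 1 := by simp [Finset.card_compl]
  have hn1 : (1 : ℝ) ≤ Fintype.card V := by exact_mod_cast h.card_pos
  have hp := one_le_profile hn1
  rcases Nat.lt_or_ge 1 (Fintype.card V) with hn | hn
  · have h2 := h.lt {v}ᶜ (Finset.card_pos.1 (by omega)) (by omega)
    have h3 := h.le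
    rw [hc, Nat.cast_sub h.card_pos, Nat.cast_one] at h2
    have h4 : profile (Fintype.card V - 1) ≤ profile (Fintype.card V) := by
      refine profile_mono ?_ (by linarith)
      have : (2 : ℝ) ≤ Fintype.card V := by exact_mod_cast hn
      linarith
    have h5 : D * (Fintype.card V - 1) * profile (Fintype.card V - 1)
        ≤ D * (Fintype.card V - 1) * profile (Fintype.card V) :=
      mul_le_mul_of_nonneg_left h4 (mul_nonneg hD.le (by linarith))
    nlinarith
  · have h2 : ({v}ᶜ : Finset V) = ∅ := by rw [← Finset.card_eq_zero]; omega
    have h3 := h.le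
    have h4 : adjPairs G (∅ : Finset V) = 0 := by simp [adjPairs]
    rw [h2, h4] at h1
    push_cast at h1
    have h5 : D * 1 ≤ D * Fintype.card V * profile (Fintype.card V) := by
      rw [mul_assoc]
      refine mul_le_mul_of_nonneg_left ?_ hD.le
      nlinarith
    linarith

theorem IsCritical.expand {D : ℝ} (h : IsCritical G D) (hD : 0 < D) {X : Finset V}
    (hX : X.Nonempty) (hm : X.card + (nbr G X).card < Fintype.card V) :
    X.card * ((Real.log (Fintype.card V) - Real.log (X.card + (nbr G X).card))
      / ((1 + Real.log (X.card + (nbr G X).card)) * (1 + Real.log (Fintype.card V))))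
      ≤ 2 * (nbr G X).card := by
  have hXpos := Finset.card_pos.2 hX
  have h1 : (adjPairs G Finset.univ : ℝ) ≤ adjPairs G (X ∪ nbr G X) + adjPairs G Xᶜ := by
    exact_mod_cast adjPairs_le_add X
  have hu : (X ∪ nbr G X).card = X.card + (nbr G X).card := by
    refine Finset.card_union_of_disjoint ?_
    rw [Finset.disjoint_right]
    exact fun x hx => (mem_nbr.1 hx).1
  have h2 := h.lt (X ∪ nbr G X) (hX.mono Finset.subset_union_left) (by omega)
  have hcc : Xᶜ.card = Fintype.card V - X.card := Finset.card_compl X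
  have h3 := h.lt Xᶜ (Finset.card_pos.1 (by omega)) (by omega)
  have h4 := h.le
  rw [hu] at h2
  rw [hcc, Nat.cast_sub (by omega)] at h3
  have hx1 : (1 : ℝ) ≤ X.card := by exact_mod_cast hXpos
  have hg0 : (0 : ℝ) ≤ (nbr G X).card := by positivity
  have hmn : ((X.card : ℝ) + (nbr G X).card) + 1 ≤ Fintype.card V := by exact_mod_cast hm
  rw [← profile_sub (by linarith) (by linarith)]
  push_cast at h2
  have h5 : profile (Fintype.card V - X.card) ≤ profile (Fintype.card V) :=
    profile_mono (by linarith) (by linarith)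
  have h6 : D * (Fintype.card V - X.card) * profile (Fintype.card V - X.card)
      ≤ D * (Fintype.card V - X.card) * profile (Fintype.card V) :=
    mul_le_mul_of_nonneg_left h5 (mul_nonneg hD.le (by linarith))
  have h7 := profile_le_two (m := X.card + (nbr G X).card) (by linarith)
  have h8 : D * (X.card * profile (Fintype.card V))
      ≤ D * ((X.card + (nbr G X).card) * profile (X.card + (nbr G X).card)) := by
    nlinarith
  have h9 := le_of_mul_le_mul_left h8 hD
  nlinarith

/-- The expansion properties used below: minimum degree at least `δ`, expansion of sets of at most
half of the vertices, and much better expansion of sets of at most `√n` vertices. -/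
structure IsGoodExpander (G : SimpleGraph V) (H y₀ δ Λ : ℕ) : Prop where
  bip : IsBip G
  card_pos : 0 < Fintype.card V
  card_lt : Fintype.card V < 2 ^ Λ
  two_le : 2 ≤ Λ
  le_degree : ∀ v, δ ≤ (nbr G {v}).card
  expand : ∀ X : Finset V, 2 * X.card ≤ Fintype.card V → X.card ≤ 8 * Λ ^ 2 * (nbr G X).card
  expand_small : ∀ y, y₀ ≤ y → ∀ X : Finset V, y ^ H ≤ X.card → X.card ^ 2 ≤ Fintype.card V →
    2 * y ^ (H - 1) ≤ (nbr G X).card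

theorem IsCritical.expand_half {D : ℝ} (h : IsCritical G D) (hD : 0 < D) (X : Finset V)
    (hX2 : 2 * X.card ≤ Fintype.card V) :
    X.card ≤ 8 * (Nat.log 2 (Fintype.card V) + 2) ^ 2 * (nbr G X).card := by
  set n := Fintype.card V with hn
  set x := X.card with hx
  set g := (nbr G X).card with hg
  rcases Finset.eq_empty_or_nonempty X with hX | hX
  · simp [hx, hX]
  have hx0 : 0 < x := Finset.card_pos.2 hX
  rcases Nat.lt_or_ge (4 * (x + g)) (3 * n) with hm | hm
  · have h1 := h.expand hD hX (by omega)
    rw [← hx, ← hg, ← hn] at h1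
    have hx1 : (1 : ℝ) ≤ x := by exact_mod_cast hx0
    have hg0 : (0 : ℝ) ≤ g := by positivity
    have hn0 : (0 : ℝ) < n := by exact_mod_cast h.card_pos
    have hmn : 4 * ((x : ℝ) + g) < 3 * n := by exact_mod_cast hm
    have hlm : 0 ≤ Real.log (x + g) := Real.log_nonneg (by linarith)
    have hlmn : Real.log (x + g) ≤ Real.log n := Real.log_le_log (by linarith) (by linarith)
    have hd : 1 / 4 ≤ Real.log n - Real.log (x + g) := by
      rw [← Real.log_div (by positivity) (by positivity)]
      have h2 := Real.one_sub_inv_le_log_of_pos (x := n / (x + g)) (by positivity)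
      rw [inv_div] at h2
      have h3 : ((x : ℝ) + g) / n ≤ 3 / 4 := by
        rw [div_le_iff₀ hn0]
        linarith
      linarith
    set lam : ℝ := ((Nat.log 2 n + 2 : ℕ) : ℝ) with hlam
    have hL : 1 + Real.log n ≤ lam := by
      have h4 : (n : ℝ) ≤ 2 ^ (Nat.log 2 n + 1) := by
        exact_mod_cast (Nat.lt_pow_succ_log_self (by norm_num) n).le
      have h5 := Real.log_le_log hn0 h4
      rw [Real.log_pow] at h5
      have h6 : Real.log 2 ≤ 1 := by linarith [Real.log_two_lt_d9]
      rw [hlam]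
      push_cast at h5 ⊢
      nlinarith [Nat.cast_nonneg (α := ℝ) (Nat.log 2 n)]
    have hprod : (1 + Real.log (x + g)) * (1 + Real.log n) ≤ lam ^ 2 := by
      rw [pow_two]
      exact mul_le_mul (by linarith) hL (by linarith) (by linarith)
    have h7 : 1 / 4 / lam ^ 2 ≤ (Real.log n - Real.log (x + g))
        / ((1 + Real.log (x + g)) * (1 + Real.log n)) :=
      div_le_div₀ (by linarith) hd (by positivity) hprod
    have h8 : (x : ℝ) * (1 / 4 / lam ^ 2) ≤ 2 * g :=
      (mul_le_mul_of_nonneg_left h7 (by linarith)).trans h1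
    have hlam0 : 0 < lam ^ 2 := by
      have : 0 < lam := by linarith
      positivity
    rw [div_div, mul_one_div, div_le_iff₀ (by positivity)] at h8
    have h9 : (x : ℝ) ≤ 8 * lam ^ 2 * g := by linarith
    rw [hlam] at h9
    exact_mod_cast h9
  · calc x ≤ 2 * g := by omega
      _ ≤ 8 * (Nat.log 2 n + 2) ^ 2 * g := by
        refine Nat.mul_le_mul_right _ ?_
        nlinarith [Nat.zero_le (Nat.log 2 n)]

theorem exists_threshold (H : ℕ) : ∃ y₀ : ℕ, 2 ≤ y₀ ∧ ∀ y : ℕ, y₀ ≤ y →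
    32 * (1 + Real.log 2 + H * Real.log y) ≤ y := by
  have h1 : (fun y : ℝ => 32 * (1 + Real.log 2 + H * Real.log y)) =o[Filter.atTop] (id : ℝ → ℝ) :=
    ((Asymptotics.isLittleO_const_id_atTop _).add
      (Real.isLittleO_log_id_atTop.const_mul_left _)).const_mul_left _
  have h2 := h1.bound one_pos
  have h3 := tendsto_natCast_atTop_atTop (R := ℝ) |>.eventually h2
  obtain ⟨N, hN⟩ := Filter.eventually_atTop.1 h3
  refine ⟨max N 2, le_max_right _ _, fun y hy => ?_⟩
  have h4 := hN y (le_trans (le_max_left _ _) hy)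
  simp only [Real.norm_eq_abs, id, one_mul, Nat.abs_cast] at h4
  exact (le_abs_self _).trans h4

theorem IsCritical.expand_small {D : ℝ} (h : IsCritical G D) (hD : 0 < D) {H y : ℕ} (hH : 2 ≤ H)
    (hy2 : 2 ≤ y) (hy : 32 * (1 + Real.log 2 + H * Real.log y) ≤ y) (X : Finset V)
    (hyX : y ^ H ≤ X.card) (hXn : X.card ^ 2 ≤ Fintype.card V) :
    2 * y ^ (H - 1) ≤ (nbr G X).card := by
  set n := Fintype.card V with hn
  set x := X.card with hx
  set g := (nbr G X).card with hg
  obtain ⟨e, rfl⟩ : ∃ e, H = e + 1 := ⟨H - 1, by omega⟩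
  rw [Nat.add_sub_cancel]
  have h4x : 4 ≤ x := by
    calc 4 = 2 ^ 2 := rfl
      _ ≤ y ^ 2 := Nat.pow_le_pow_left hy2 2
      _ ≤ y ^ (e + 1) := Nat.pow_le_pow_right (by omega) hH
      _ ≤ x := hyX
  have hX : X.Nonempty := Finset.card_pos.1 (by omega)
  rcases Nat.lt_or_ge g x with hgx | hgx
  swap
  · calc 2 * y ^ e ≤ y * y ^ e := Nat.mul_le_mul_right _ hy2
      _ = y ^ (e + 1) := by ring
      _ ≤ g := hyX.trans hgx
  by_contra! hcon
  have h1 := h.expand hD hX (by nlinarith)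
  rw [← hx, ← hg, ← hn] at h1
  have hx4 : (4 : ℝ) ≤ x := by exact_mod_cast h4x
  have hxn : (x : ℝ) ^ 2 ≤ n := by exact_mod_cast hXn
  have hgx' : (g : ℝ) + 1 ≤ x := by exact_mod_cast hgx
  have hg0 : (0 : ℝ) ≤ g := by positivity
  have hcon' : (g : ℝ) < 2 * y ^ e := by exact_mod_cast hcon
  have hyX' : (y : ℝ) ^ (e + 1) ≤ x := by exact_mod_cast hyX
  have hy2' : (2 : ℝ) ≤ y := by exact_mod_cast hy2
  have hlx : 1.1 ≤ Real.log x := by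
    have h2 : Real.log 4 ≤ Real.log x := Real.log_le_log (by norm_num) hx4
    have h3 : Real.log 4 = 2 * Real.log 2 := by
      rw [show (4 : ℝ) = 2 ^ 2 by norm_num, Real.log_pow]
      norm_num
    linarith [Real.log_two_gt_d9]
  have hlm0 : 0 ≤ Real.log (x + g) := Real.log_nonneg (by linarith)
  have hlm : Real.log (x + g) ≤ Real.log 2 + Real.log x := by
    rw [← Real.log_mul (by norm_num) (by linarith)]
    exact Real.log_le_log (by linarith) (by linarith)
  have hln : 2 * Real.log x ≤ Real.log n := by
    have h2 := Real.log_le_log (by positivity) hxn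
    rwa [Real.log_pow, Nat.cast_ofNat] at h2
  have hl2 := Real.log_two_lt_d9
  have hl2' := Real.log_two_gt_d9
  have h5 : 1 / 8 / (1 + Real.log (x + g)) ≤ (Real.log n - Real.log (x + g))
        / ((1 + Real.log (x + g)) * (1 + Real.log n)) := by
    rw [div_div, div_le_div_iff₀ (by positivity) (by nlinarith)]
    have : 1 + Real.log n ≤ 8 * (Real.log n - Real.log (x + g)) := by linarith
    nlinarith
  have h6 := (mul_le_mul_of_nonneg_left h5 (show (0 : ℝ) ≤ x by linarith)).trans h1
  rw [div_div, mul_one_div, div_le_iff₀ (by positivity)] at h6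
  set A : ℝ := 1 + Real.log 2 + (e + 1 : ℕ) * Real.log y with hA
  have hly : 0 ≤ Real.log y := Real.log_nonneg (by linarith)
  have hA1 : 1 ≤ A := by
    have : 0 ≤ ((e + 1 : ℕ) : ℝ) * Real.log y := by positivity
    linarith
  have hyp : (0 : ℝ) < y ^ (e + 1) := by positivity
  set z : ℝ := x / y ^ (e + 1) with hz
  have hxz : (x : ℝ) = y ^ (e + 1) * z := by
    rw [hz]
    field_simp
  have hz1 : 1 ≤ z := by
    rw [hz, le_div_iff₀ hyp]
    linarith
  clear_value z A
  have h7 : 1 + Real.log (x + g) ≤ A * z := by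
    have h8 : Real.log x = (e + 1 : ℕ) * Real.log y + Real.log z := by
      rw [hxz, Real.log_mul hyp.ne' (by linarith), Real.log_pow]
    have h9 := Real.log_le_sub_one_of_pos (show 0 < z by linarith)
    nlinarith
  have h10 : (x : ℝ) < 32 * y ^ e * (A * z) := by
    have h11 : (x : ℝ) ≤ 16 * g * (1 + Real.log (x + g)) := by linarith
    have h12 : (g : ℝ) * (1 + Real.log (x + g)) ≤ g * (A * z) :=
      mul_le_mul_of_nonneg_left h7 hg0
    have h13 : (g : ℝ) * (A * z) < 2 * y ^ e * (A * z) :=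
      mul_lt_mul_of_pos_right hcon' (by positivity)
    linarith
  have h14 : (y : ℝ) ^ (e + 1) * z ≥ 32 * y ^ e * (A * z) := by
    have h15 : (0 : ℝ) ≤ y ^ e * z := by positivity
    calc 32 * (y : ℝ) ^ e * (A * z) = y ^ e * z * (32 * A) := by ring
      _ ≤ y ^ e * z * y := mul_le_mul_of_nonneg_left hy h15
      _ = _ := by ring
  linarith

theorem exists_isGoodExpander (H : ℕ) (hH : 2 ≤ H) : ∃ y₀ : ℕ, 2 ≤ y₀ ∧
    ∀ (V : Type) [Fintype V] (G : SimpleGraph V) (δ : ℕ), 0 < δ → 8 * (δ : ℝ) ≤ avgDeg G →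
      ∃ (V' : Type) (_ : Fintype V') (G' : SimpleGraph V'),
        IsGoodExpander G' H y₀ δ (Nat.log 2 (Fintype.card V') + 2) ∧
        ∀ k ℓ, ContainsBalSub G' k ℓ → ContainsBalSub G k ℓ := by
  obtain ⟨y₀, hy2, hy₀⟩ := exists_threshold H
  refine ⟨y₀, hy2, fun V _ G δ hδ hG => ?_⟩
  have hV : Nonempty V := by
    by_contra hV
    rw [not_nonempty_iff] at hV
    rw [avgDeg, Nat.card_of_isEmpty (α := V)] at hG
    rw [Nat.cast_zero, div_zero] at hG
    have : (0 : ℝ) < δ := by exact_mod_cast hδ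
    linarith
  obtain ⟨f, hf⟩ := exists_cutGraph G
  have hn : (0 : ℝ) < Fintype.card V := by exact_mod_cast Fintype.card_pos
  have hD : (0 : ℝ) < 2 * δ := by positivity
  obtain ⟨S, hS⟩ := exists_isCritical (G := cutGraph G f) (2 * δ) hD.le <| by
    rw [avgDeg, Nat.card_eq_fintype_card (α := V), le_div_iff₀ hn] at hG
    have h1 : (adjPairs G Finset.univ : ℝ) ≤ 2 * adjPairs (cutGraph G f) Finset.univ := by
      exact_mod_cast hf
    rw [card_adj_eq] at h1
    push_cast at h1
    linarith
  refine ⟨(S : Set V), inferInstance, (cutGraph G f).induce (S : Set V),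
    ⟨?_, ?_, ?_, ?_, ?_, ?_, ?_⟩, ?_⟩
  · exact ⟨fun x => f x, fun u v h => h.2⟩
  · exact hS.card_pos
  · exact (Nat.lt_pow_succ_log_self (by norm_num) _).trans
      (Nat.pow_lt_pow_right (by norm_num) (by omega))
  · omega
  · intro v
    have h1 := hS.le_degree hD v
    have h2 : (δ : ℝ) ≤ (nbr ((cutGraph G f).induce (S : Set V)) {v}).card := by
      linarith
    exact_mod_cast h2
  · intro X hX
    exact hS.expand_half hD X hX
  · intro y hy X hyX hXn
    exact hS.expand_small hD hH (hy2.trans hy) (hy₀ y hy) X hyX hXn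
  · intro k ℓ h
    exact ContainsBalSub.map (G' := (cutGraph G f).induce (S : Set V))
      ⟨Subtype.val, fun {a b} h => (show (cutGraph G f).Adj a b from h).1⟩
      Subtype.val_injective h

end Expander

section Growth
open scoped Classical
variable [Fintype V] {G : SimpleGraph V} {H y₀ δ Λ : ℕ}

theorem IsGoodExpander.card_lt_two_mul_ball (h : IsGoodExpander G H y₀ δ Λ) {F A : Finset V}
    (hA : A.Nonempty) (hF : 16 * Λ ^ 2 * F.card ≤ A.card) :
    Fintype.card V < 2 * (ball G F A (16 * Λ ^ 3)).card := by
  by_contra! hcon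
  have hΛ := h.two_le
  have step : ∀ i, i < 16 * Λ ^ 3 → (ball G F A i).card
      ≤ 16 * Λ ^ 2 * ((ball G F A (i + 1)).card - (ball G F A i).card) := by
    intro i hi
    have h1 : (ball G F A i).card ≤ (ball G F A (16 * Λ ^ 3)).card :=
      Finset.card_le_card (ball_mono F A hi.le)
    have h2 := h.expand (ball G F A i) (by omega)
    have h3 := card_ball_succ (G := G) F A i
    have h4 : (nbr G (ball G F A i) ∩ F).card ≤ F.card :=
      Finset.card_le_card Finset.inter_subset_right
    have h5 : A.card ≤ (ball G F A i).card := Finset.card_le_card (subset_ball F A i)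
    have h6 : 2 * F.card ≤ (nbr G (ball G F A i)).card := by
      refine Nat.le_of_mul_le_mul_left (c := 8 * Λ ^ 2) ?_ (by positivity)
      calc 8 * Λ ^ 2 * (2 * F.card) = 16 * Λ ^ 2 * F.card := by ring
        _ ≤ _ := hF.trans (h5.trans h2)
    calc (ball G F A i).card ≤ 8 * Λ ^ 2 * (nbr G (ball G F A i)).card := h2
      _ ≤ 8 * Λ ^ 2 * (2 * ((ball G F A (i + 1)).card - (ball G F A i).card)) :=
        Nat.mul_le_mul_left _ (by omega)
      _ = _ := by ring
  have dbl : ∀ s, s ≤ Λ → 2 ^ s * A.card ≤ (ball G F A (16 * Λ ^ 2 * s)).card := by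
    intro s hs
    induction s with
    | zero => simp [ball]
    | succ s ih =>
      have ih := ih (by omega)
      set b := (ball G F A (16 * Λ ^ 2 * s)).card with hb
      have lin : ∀ u, u ≤ 16 * Λ ^ 2 →
          16 * Λ ^ 2 * b + u * b ≤ 16 * Λ ^ 2 * (ball G F A (16 * Λ ^ 2 * s + u)).card := by
        intro u hu
        induction u with
        | zero => simp [hb]
        | succ u ihu =>
          have ihu := ihu (by omega)
          have h1 := step (16 * Λ ^ 2 * s + u) <| by
            calc 16 * Λ ^ 2 * s + u < 16 * Λ ^ 2 * s + 16 * Λ ^ 2 := by omega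
              _ = 16 * Λ ^ 2 * (s + 1) := by ring
              _ ≤ 16 * Λ ^ 2 * Λ := Nat.mul_le_mul_left _ hs
              _ = _ := by ring
          have h2 : b ≤ (ball G F A (16 * Λ ^ 2 * s + u)).card :=
            Finset.card_le_card (ball_mono F A (by omega))
          have h3 : (ball G F A (16 * Λ ^ 2 * s + u)).card
              ≤ (ball G F A (16 * Λ ^ 2 * s + u + 1)).card :=
            Finset.card_le_card (ball_subset_succ F A _)
          rw [Nat.mul_sub] at h1
          have h4 := Nat.mul_le_mul_left (16 * Λ ^ 2) h3
          rw [add_mul, one_mul, ← add_assoc]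
          rw [← add_assoc]
          omega
      have h1 := lin _ le_rfl
      have h2 : 2 * b ≤ (ball G F A (16 * Λ ^ 2 * (s + 1))).card := by
        refine Nat.le_of_mul_le_mul_left (c := 16 * Λ ^ 2) ?_ (by positivity)
        rw [mul_add (16 * Λ ^ 2) s 1, mul_one]
        linarith
      calc 2 ^ (s + 1) * A.card = 2 * (2 ^ s * A.card) := by ring
        _ ≤ 2 * b := Nat.mul_le_mul_left _ ih
        _ ≤ _ := h2
  have h1 := dbl Λ le_rfl
  rw [show 16 * Λ ^ 2 * Λ = 16 * Λ ^ 3 by ring] at h1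
  have h2 : 2 ^ Λ * 1 ≤ 2 ^ Λ * A.card := Nat.mul_le_mul_left _ (Finset.card_pos.2 hA)
  have h3 := h.card_lt
  omega

theorem exists_mem_ball_of_inter {F A B : Finset V} {r s : ℕ} {x : V} (hB : Disjoint B F)
    (hx : x ∈ ball G F A r) (hx' : x ∈ ball G F B s) : ∃ b ∈ B, b ∈ ball G F A (r + s) := by
  obtain ⟨b, hb, h⟩ := exists_reach_of_mem_ball hx'
  refine ⟨b, hb, ?_⟩
  rw [← ball_add]
  exact h.symm.subset_ball hx (ball_disjoint hB s)

/-- Two large sets are joined by a short path avoiding a much smaller set. -/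
theorem IsGoodExpander.exists_mem_ball (h : IsGoodExpander G H y₀ δ Λ) {F A B : Finset V}
    (hA : A.Nonempty) (hB : B.Nonempty) (hBF : Disjoint B F)
    (hAc : 16 * Λ ^ 2 * F.card ≤ A.card) (hBc : 16 * Λ ^ 2 * F.card ≤ B.card) :
    ∃ b ∈ B, b ∈ ball G F A (32 * Λ ^ 3) := by
  have h1 := h.card_lt_two_mul_ball hA hAc
  have h2 := h.card_lt_two_mul_ball hB hBc
  obtain ⟨x, hx⟩ : (ball G F A (16 * Λ ^ 3) ∩ ball G F B (16 * Λ ^ 3)).Nonempty := by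
    rw [← Finset.card_pos]
    have h3 := Finset.card_union_add_card_inter (ball G F A (16 * Λ ^ 3))
      (ball G F B (16 * Λ ^ 3))
    have h4 := Finset.card_le_univ (ball G F A (16 * Λ ^ 3) ∪ ball G F B (16 * Λ ^ 3))
    omega
  rw [Finset.mem_inter] at hx
  rw [show 32 * Λ ^ 3 = 16 * Λ ^ 3 + 16 * Λ ^ 3 by ring]
  exact exists_mem_ball_of_inter hBF hx.1 hx.2

theorem succ_pow_add_le (y e : ℕ) (hy : 0 < y) :
    (y + 1) ^ (e + 1) + y ^ e ≤ y ^ (e + 1) + 2 ^ (e + 1) * y ^ e := by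
  induction e with
  | zero => simp
  | succ e ih =>
    have h1 := Nat.mul_le_mul_right (y + 1) ih
    have h2 : y ^ e ≤ y ^ e * y := Nat.le_mul_of_pos_right _ hy
    obtain ⟨c, hc⟩ : ∃ c, 2 ^ (e + 1) = c + 1 := ⟨2 ^ (e + 1) - 1, by
      have : 0 < 2 ^ (e + 1) := by positivity
      omega⟩
    have h3 : c * y ^ e ≤ c * (y ^ e * y) := Nat.mul_le_mul_left _ h2
    rw [hc] at h1
    rw [pow_succ 2 (e + 1), hc]
    simp only [pow_succ] at h1 ⊢
    nlinarith

theorem IsGoodExpander.growth_step (h : IsGoodExpander G H y₀ δ Λ) (hH : 0 < H) {F A : Finset V}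
    {y : ℕ} (hy : y₀ ≤ y) (hy0 : 0 < y) (hA : y ^ H ≤ A.card)
    (herr : ∀ i, i < 2 ^ H → (nbr G (ball G F A i) ∩ F).card ≤ y ^ (H - 1))
    (hn : (y + 1) ^ (2 * H) ≤ Fintype.card V) :
    (y + 1) ^ H ≤ (ball G F A (2 ^ H)).card := by
  by_contra! hcon
  have key : ∀ s, s ≤ 2 ^ H → y ^ H + s * y ^ (H - 1) ≤ (ball G F A s).card := by
    intro s hs
    induction s with
    | zero => simpa [ball] using hA
    | succ s ih =>
      have ih := ih (by omega)
      have h1 : (ball G F A s).card ≤ (ball G F A (2 ^ H)).card :=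
        Finset.card_le_card (ball_mono F A (by omega))
      have h2 := h.expand_small y hy (ball G F A s) (by omega) <| by
        calc (ball G F A s).card ^ 2 ≤ ((y + 1) ^ H) ^ 2 := Nat.pow_le_pow_left (by omega) _
          _ = (y + 1) ^ (2 * H) := by rw [← pow_mul]; ring_nf
          _ ≤ _ := hn
      have h3 := card_ball_succ (G := G) F A s
      have h4 := herr s (by omega)
      rw [add_mul, one_mul]
      omega
  have h1 := key _ le_rfl
  obtain ⟨e, rfl⟩ : ∃ e, H = e + 1 := ⟨H - 1, by omega⟩
  have h2 := succ_pow_add_le y e hy0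
  rw [Nat.add_sub_cancel] at h1
  omega

/-- Balls grow polynomially when the forbidden set meets their boundary in few vertices. -/
theorem IsGoodExpander.growth (h : IsGoodExpander G H y₀ δ Λ) (hH : 0 < H) {F A : Finset V}
    {y : ℕ} (hy : y₀ ≤ y) (hy0 : 0 < y) (hA : y ^ H ≤ A.card) (m : ℕ)
    (herr : ∀ i, i < m * 2 ^ H →
      (nbr G (ball G F A i) ∩ F).card ≤ (y + i / 2 ^ H) ^ (H - 1))
    (hn : (y + m) ^ (2 * H) ≤ Fintype.card V) :
    (y + m) ^ H ≤ (ball G F A (m * 2 ^ H)).card := by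
  induction m with
  | zero => simpa [ball] using hA
  | succ m ih =>
    have hp : 0 < 2 ^ H := by positivity
    have h1 := ih (fun i hi => herr i (hi.trans_le (Nat.mul_le_mul_right _ (by omega))))
      ((Nat.pow_le_pow_left (by omega) _).trans hn)
    rw [add_mul m 1, one_mul, ← ball_add, ← add_assoc]
    refine h.growth_step hH (by omega) (by omega) h1 (fun i hi => ?_) hn
    rw [ball_add]
    refine (herr (m * 2 ^ H + i) (by rw [add_mul, one_mul]; omega)).trans ?_
    rw [mul_comm m, Nat.mul_add_div hp, Nat.div_eq_of_lt hi, add_zero]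

/-- Many vertices of large degree yield a balanced subdivision. -/
theorem IsGoodExpander.exists_of_large_degrees (h : IsGoodExpander G H y₀ δ Λ) (Z : Finset V)
    (a j L ω : ℕ) (ha : 0 < a) (hj : 0 < j) (hL : L = 32 * Λ ^ 3 + 2)
    (hω : ω = (L + 1) * (4 * L * j ^ (2 * a)))
    (hZ : ∀ z ∈ Z, 16 * Λ ^ 2 * ω + ω < (nbr G {z}).card)
    (hc : j ^ (2 * a + 1) * (8 * L) ^ (2 * a + 2) ≤ Z.card) :
    ∃ ℓ, ContainsBalSub G (j ^ a) ℓ := by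
  refine exists_containsBalSub_of_connected Z a j L ω ha hj (by omega) ?_ hω.ge hc
  intro x hx y hy hxy W hW hxW hyW
  have hlarge : ∀ z ∈ Z, 16 * Λ ^ 2 * W.card < (nbr G {z} \ W).card := by
    intro z hz
    have h1 := Finset.le_card_sdiff W (nbr G {z})
    have h2 := hZ z hz
    have h3 := Nat.mul_le_mul_left (16 * Λ ^ 2) hW
    omega
  have hx1 := hlarge x hx
  have hy1 := hlarge y hy
  obtain ⟨b, hb, hbA⟩ := h.exists_mem_ball (F := W) (A := nbr G {x} \ W) (B := nbr G {y} \ W)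
    (Finset.card_pos.1 (by omega)) (Finset.card_pos.1 (by omega)) Finset.sdiff_disjoint
    hx1.le hy1.le
  obtain ⟨a', ha', hr⟩ := exists_reach_of_mem_ball hbA
  rw [Finset.mem_sdiff, mem_nbr] at hb ha'
  obtain ⟨⟨-, u, hu, hua⟩, -⟩ := ha'
  obtain ⟨⟨-, u', hu', hub⟩, -⟩ := hb
  rw [Finset.mem_singleton] at hu hu'
  subst hu hu'
  have hsub : ball G W (nbr G {u} \ W) (32 * Λ ^ 3) ⊆ Wᶜ := by
    rw [Finset.subset_compl_iff_disjoint_right]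
    exact ball_disjoint Finset.sdiff_disjoint _
  have hr1 : Reach G Wᶜ (32 * Λ ^ 3 + 1) u b := by
    refine (((Reach.of_adj hua).trans hr).mono ?_ (by omega))
    refine Finset.union_subset ?_ hsub
    have := hsub hr.mem_left
    intro z
    simp only [Finset.mem_insert, Finset.mem_singleton]
    rintro (rfl | rfl)
    · simpa using hxW
    · exact this
  have hr2 := hr1.tail hub.symm (by simpa using hyW)
  obtain ⟨m, hm, T, hT, hl⟩ := hr2.exists_link
  exact ⟨m, by omega, T, hl, Finset.subset_compl_iff_disjoint_right.1 hT⟩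

end Growth

section Pieces
open scoped Classical
variable [Fintype V] {G : SimpleGraph V}

/-- A connected set of radius at most `r` outside `Z` with many neighbours in `Z`. -/
def IsPiece (G : SimpleGraph V) (Z : Finset V) (q s₀ R : ℕ) (X : Finset V) (r : ℕ) : Prop :=
  r ≤ R ∧ Disjoint X Z ∧ (∃ v ∈ X, ∀ x ∈ X, Reach G X r v x) ∧
    s₀ * (r + 1) ^ q ≤ (nbr G X ∩ Z).card

theorem card_nbr_le {Z B : Finset V} {Δ : ℕ} (hΔ : ∀ v, v ∉ Z → (nbr G {v}).card ≤ Δ)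
    (hB : Disjoint B Z) : (nbr G B).card ≤ B.card * Δ := by
  refine le_trans (Finset.card_le_card (t := B.biUnion fun b => nbr G {b}) ?_)
    (Finset.card_biUnion_le_card_mul _ _ _ fun b hb => hΔ b (Finset.disjoint_left.1 hB hb))
  intro x hx
  obtain ⟨hxB, u, hu, hux⟩ := mem_nbr.1 hx
  rw [Finset.mem_biUnion]
  refine ⟨u, hu, mem_nbr.2 ⟨?_, u, by simp, hux⟩⟩
  rw [Finset.mem_singleton]
  exact hux.ne'

theorem card_ball_le {Z F A : Finset V} {Δ : ℕ} (hΔ : ∀ v, v ∉ Z → (nbr G {v}).card ≤ Δ)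
    (hZF : Z ⊆ F) (hA : Disjoint A Z) (i : ℕ) :
    (ball G F A i).card ≤ A.card * (Δ + 1) ^ i := by
  have hd : ∀ i, Disjoint (ball G F A i) Z := by
    intro i
    exact (ball_disjoint hA i).mono_left (ball_subset_ball subset_rfl hZF i)
  induction i with
  | zero => simp [ball]
  | succ i ih =>
    rw [ball_succ]
    have h1 := Finset.card_union_le (ball G F A i) (nbr G (ball G F A i) \ F)
    have h2 : (nbr G (ball G F A i) \ F).card ≤ (nbr G (ball G F A i)).card :=
      Finset.card_le_card Finset.sdiff_subset
    have h3 := card_nbr_le hΔ (hd i)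
    calc _ ≤ (ball G F A i).card * (Δ + 1) := by rw [mul_add, mul_one]; omega
      _ ≤ A.card * (Δ + 1) ^ i * (Δ + 1) := Nat.mul_le_mul_right _ ih
      _ = _ := by ring

/-- Two neighbours of a connected set are joined through it. -/
theorem exists_link_through {X : Finset V} {r : ℕ} {v z z' : V}
    (hX : ∀ x ∈ X, Reach G X r v x) (hz : z ∈ nbr G X) (hz' : z' ∈ nbr G X) (hne : z ≠ z') :
    ∃ n ≤ 2 * r + 2, ∃ T ⊆ X, Link G z z' n T := by
  obtain ⟨hzX, u, hu, huz⟩ := mem_nbr.1 hz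
  obtain ⟨hzX', u', hu', huz'⟩ := mem_nbr.1 hz'
  have h1 : Reach G X (r + r) u u' := (hX u hu).symm.trans_same (hX u' hu')
  have h2 : Reach G (insert z (insert z' X)) (1 + (r + r) + 1) z z' := by
    refine Reach.tail (((Reach.of_adj huz.symm).trans h1).mono ?_ le_rfl) huz' (by simp)
    intro x
    simp only [Finset.mem_union, Finset.mem_insert, Finset.mem_singleton]
    rintro ((rfl | rfl) | hx)
    · exact Or.inl rfl
    · exact Or.inr (Or.inr hu)
    · exact Or.inr (Or.inr hx)
  obtain ⟨m, hm, T, hT, hl⟩ := h2.exists_link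
  refine ⟨m, by omega, T, fun x hx => ?_, hl⟩
  have h3 := hT hx
  rw [Finset.mem_insert, Finset.mem_insert] at h3
  rcases h3 with rfl | rfl | h3
  · exact absurd hx hl.notMem_left
  · exact absurd hx hl.notMem_right
  · exact h3

/-- If all members of a disjoint family meeting a property were hit by `W`, there would be at
most `|W|` of them. -/
theorem exists_disjoint_of_card_lt {ι : Type*} (I : Finset ι) (X : ι → Finset V) (W : Finset V)
    (hd : ∀ i ∈ I, ∀ j ∈ I, i ≠ j → Disjoint (X i) (X j)) (hW : W.card < I.card) :
    ∃ i ∈ I, Disjoint (X i) W := by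
  by_contra! hcon
  have : ∀ i, ∃ w, i ∈ I → w ∈ X i ∧ w ∈ W := by
    intro i
    by_cases hi : i ∈ I
    · obtain ⟨w, h1, h2⟩ := Finset.not_disjoint_iff.1 (hcon i hi)
      exact ⟨w, fun _ => ⟨h1, h2⟩⟩
    · obtain ⟨i', hi'⟩ : I.Nonempty := Finset.card_pos.1 (by omega)
      obtain ⟨w, h1, h2⟩ := Finset.not_disjoint_iff.1 (hcon i' hi')
      exact ⟨w, fun h => absurd h hi⟩
  choose f hf using this
  obtain ⟨i, hi, j, hj, hij, hfij⟩ := Finset.exists_ne_map_eq_of_card_lt_of_maps_to hW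
    (f := f) fun i hi => (hf i hi).2
  exact Finset.disjoint_left.1 (hd i hi j hj hij) (hf i hi).1 (hfij ▸ (hf j hj).1)

/-- Many disjoint pieces yield a balanced subdivision. -/
theorem exists_of_pieces {Z : Finset V} {a j R N : ℕ} (ha : 0 < a) (hj : 0 < j)
    (hN : Z.card * Z.card * (2 * R + 3) * (8 * (R + 1) * j ^ (2 * a)) < N)
    (X : Fin N → Finset V) (r : Fin N → ℕ)
    (hX : ∀ i, IsPiece G Z (2 * a + 2) (j ^ (2 * a + 1) * 16 ^ (2 * a + 2)) R (X i) (r i))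
    (hd : ∀ i j, i ≠ j → Disjoint (X i) (X j)) : ∃ ℓ, ContainsBalSub G (j ^ a) ℓ := by
  set ω := 8 * (R + 1) * j ^ (2 * a) with hω
  have hlam : ∀ i z z', ∃ n, z ∈ nbr G (X i) → z' ∈ nbr G (X i) → z ≠ z' →
      n ≤ 2 * r i + 2 ∧ ∃ T ⊆ X i, Link G z z' n T := by
    intro i z z'
    by_cases h : z ∈ nbr G (X i) ∧ z' ∈ nbr G (X i) ∧ z ≠ z'
    · obtain ⟨-, -, ⟨v, -, hv⟩, -⟩ := hX i
      obtain ⟨n, hn, T, hT, hl⟩ := exists_link_through hv h.1 h.2.1 h.2.2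
      exact ⟨n, fun _ _ _ => ⟨hn, T, hT, hl⟩⟩
    · exact ⟨0, fun h1 h2 h3 => absurd ⟨h1, h2, h3⟩ h⟩
  choose lam hlam using hlam
  let Idx : V → V → ℕ → Finset (Fin N) := fun z z' n => Finset.univ.filter fun i =>
    z ∈ nbr G (X i) ∧ z' ∈ nbr G (X i) ∧ lam i z z' = n
  let poor : Finset (V × V × ℕ) := (Z ×ˢ Z ×ˢ Finset.range (2 * R + 3)).filter fun p =>
    (Idx p.1 p.2.1 p.2.2).card ≤ ω
  obtain ⟨i, -, hi⟩ : ∃ i ∈ (Finset.univ : Finset (Fin N)),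
      i ∉ poor.biUnion fun p => Idx p.1 p.2.1 p.2.2 := by
    refine Finset.exists_mem_notMem_of_card_lt_card ?_
    calc _ ≤ poor.card * ω := Finset.card_biUnion_le_card_mul _ _ _ fun p hp =>
          (Finset.mem_filter.1 hp).2
      _ ≤ Z.card * Z.card * (2 * R + 3) * ω := by
        refine Nat.mul_le_mul_right _ ((Finset.card_filter_le _ _).trans ?_)
        rw [Finset.card_product, Finset.card_product, Finset.card_range, mul_assoc]
      _ < N := hN
      _ = _ := by simp
  obtain ⟨hr, hXZ, -, hcard⟩ := hX i
  refine exists_containsBalSub_of_colouring' (nbr G (X i) ∩ Z) (lam i) a j (2 * r i + 2) ω ha hj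
    (by omega) ?_ ?_ ?_ ?_
  · intro x hx y hy hxy
    exact (hlam i x y (Finset.mem_inter.1 hx).1 (Finset.mem_inter.1 hy).1 hxy).1
  · intro x hx y hy hxy W hW _ _
    rw [Finset.mem_inter] at hx hy
    have hrich : ω < (Idx x y (lam i x y)).card := by
      by_contra! hcon
      apply hi
      rw [Finset.mem_biUnion]
      refine ⟨(x, y, lam i x y), ?_, ?_⟩
      · simp only [poor, Finset.mem_filter, Finset.mem_product, Finset.mem_range]
        refine ⟨⟨hx.2, hy.2, ?_⟩, hcon⟩
        have := (hlam i x y hx.1 hy.1 hxy).1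
        omega
      · simp [Idx, hx.1, hy.1]
    obtain ⟨i', hi', hdW⟩ := exists_disjoint_of_card_lt (Idx x y (lam i x y)) X W
      (fun i _ j _ => hd i j) (by omega)
    simp only [Idx, Finset.mem_filter, Finset.mem_univ, true_and] at hi'
    obtain ⟨-, T, hT, hl⟩ := hlam i' x y hi'.1 hi'.2.1 hxy
    rw [hi'.2.2] at hl
    exact ⟨T, hl, hdW.mono_left hT⟩
  · rw [hω]
    refine Nat.mul_le_mul_right _ ?_
    omega
  · refine le_trans (le_of_eq ?_) hcard
    rw [show 8 * (2 * r i + 2) = 16 * (r i + 1) by ring, mul_pow, mul_assoc]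

/-- Either there is a balanced subdivision, or all pieces meet a bounded set. -/
theorem exists_of_pieces_or_hit {Z : Finset V} {a j R Δ N : ℕ} (ha : 0 < a) (hj : 0 < j)
    (hΔ : ∀ v, v ∉ Z → (nbr G {v}).card ≤ Δ)
    (hN : Z.card * Z.card * (2 * R + 3) * (8 * (R + 1) * j ^ (2 * a)) < N) :
    (∃ ℓ, ContainsBalSub G (j ^ a) ℓ) ∨ ∃ P : Finset V, P.card ≤ N * (Δ + 1) ^ R ∧
      ∀ X r, IsPiece G Z (2 * a + 2) (j ^ (2 * a + 1) * 16 ^ (2 * a + 2)) R X r →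
        ¬ Disjoint X P := by
  by_contra! hcon
  obtain ⟨hno, hP⟩ := hcon
  obtain ⟨f, hf, hd⟩ := exists_disjoint_choice (ι := Fin N) (α := Finset V × ℕ)
    (fun _ p => IsPiece G Z (2 * a + 2) (j ^ (2 * a + 1) * 16 ^ (2 * a + 2)) R p.1 p.2)
    (fun _ p => p.1) ((Δ + 1) ^ R) <| by
      intro _ Φ hΦ
      obtain ⟨X, r, hX, hXΦ⟩ := hP Φ (by simpa using hΦ)
      refine ⟨(X, r), hX, ?_, hXΦ⟩
      obtain ⟨hr, hXZ, ⟨v, hv, hreach⟩, -⟩ := hX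
      have h1 : X ⊆ ball G Z {v} r := fun x hx => (hreach x hx).subset_ball (by simp) hXZ
      refine (Finset.card_le_card h1).trans ((card_ball_le hΔ subset_rfl ?_ r).trans ?_)
      · simpa using Finset.disjoint_left.1 hXZ hv
      · simpa using Nat.pow_le_pow_right (by omega) hr
  obtain ⟨ℓ, hℓ⟩ := exists_of_pieces ha hj hN (fun i => (f i).1) (fun i => (f i).2) hf hd
  exact hno ℓ hℓ

/-- Some vertex is far from a small set. -/
theorem exists_far {Z U : Finset V} {Δ ρ : ℕ} (hΔ : ∀ v, v ∉ Z → (nbr G {v}).card ≤ Δ)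
    (hn : U.card * (Δ + 1) ^ ρ + Z.card < Fintype.card V) :
    ∃ v, v ∉ Z ∧ Disjoint (ball G Z {v} ρ) U := by
  obtain ⟨v, -, hv⟩ : ∃ v ∈ (Finset.univ : Finset V), v ∉ ball G Z (U \ Z) ρ ∪ Z := by
    refine Finset.exists_mem_notMem_of_card_lt_card ?_
    have h1 := Finset.card_union_le (ball G Z (U \ Z) ρ) Z
    have h2 := card_ball_le (A := U \ Z) hΔ subset_rfl Finset.sdiff_disjoint ρ
    have h3 : (U \ Z).card * (Δ + 1) ^ ρ ≤ U.card * (Δ + 1) ^ ρ :=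
      Nat.mul_le_mul_right _ (Finset.card_le_card Finset.sdiff_subset)
    rw [Finset.card_univ]
    omega
  rw [Finset.mem_union, not_or] at hv
  refine ⟨v, hv.2, ?_⟩
  rw [Finset.disjoint_left]
  intro x hx hxU
  have hd : Disjoint ({v} : Finset V) Z := by simpa using hv.2
  obtain ⟨u, hu, hr⟩ := exists_reach_of_mem_ball hx
  rw [Finset.mem_singleton] at hu
  subst hu
  have hxZ := Finset.disjoint_left.1 (ball_disjoint hd ρ) hx
  exact hv.1 (hr.symm.subset_ball (by simp [hxU, hxZ]) (ball_disjoint hd ρ))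

end Pieces

section Routing
open scoped Classical
variable [Fintype V] {G : SimpleGraph V}

/-- Disjoint hubs, each with two adjacent centres (labels `0` and `1`) and several legs (labels
`2, …, K - 1`, the legs `2, 3` being attached to the second centre), such that centres of different
hubs can be joined robustly, by paths of prescribed lengths, through any two of their legs. -/
structure HubSystem (G : SimpleGraph V) (ι : Type*) (K L w : ℕ) where
  lab : V → Option (ι × ℕ)
  hub : ι × ℕ → V
  lab_hub : ∀ x, x.2 < 2 → lab (hub x) = some x
  adj : ∀ i, G.Adj (hub (i, 0)) (hub (i, 1))
  len : ι × ℕ → ι × ℕ → ℕ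
  len_le : ∀ x y, x.1 ≠ y.1 → 2 ≤ x.2 → x.2 < K → 2 ≤ y.2 → y.2 < K → len x y ≤ L
  link : ∀ x y, x.1 ≠ y.1 → 2 ≤ x.2 → x.2 < K → 2 ≤ y.2 → y.2 < K →
    ∀ W : Finset V, W.card ≤ w → (∀ z ∈ W, lab z = none) →
      ∃ S, Link G (hub (x.1, if x.2 < 4 then 1 else 0)) (hub (y.1, if y.2 < 4 then 1 else 0))
        (len x y) S ∧ Disjoint S W ∧ ∀ z ∈ S, ∀ l, lab z = some l → l = x ∨ l = y

namespace HubSystem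
variable {ι : Type*} {K L w : ℕ} (s : HubSystem G ι K L w)

/-- Two centres are robustly joined by paths of length `n` using only labels in `A`. -/
def Route (A : Set (ι × ℕ)) (x y : ι × ℕ) (n : ℕ) : Prop :=
  ∀ F : Finset V, F.card + n ≤ w → ∃ S, Link G (s.hub x) (s.hub y) n S ∧
    (∀ z ∈ S, ∀ l, s.lab z = some l → l ∈ A) ∧ ∀ z ∈ S, s.lab z = none → z ∉ F

variable {s} {A A' B : Set (ι × ℕ)} {x y z : ι × ℕ} {n m : ℕ}

theorem hub_ne (hx : x.2 < 2) (hy : y.2 < 2) (h : x ≠ y) : s.hub x ≠ s.hub y := by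
  intro he
  have h1 := s.lab_hub x hx
  rw [he, s.lab_hub y hy] at h1
  exact h (Option.some_injective _ h1).symm

theorem Route.comp (h : s.Route A x y n) (h' : s.Route A' y z m) (hx : x.2 < 2) (hy : y.2 < 2)
    (hz : z.2 < 2) (hxy : x ≠ y) (hyz : y ≠ z) (hxz : x ≠ z) (hA : ∀ l ∈ A, l ∉ A')
    (hxA : x ∉ A') (hzA : z ∉ A) (hB : ∀ l ∈ A, l ∈ B) (hB' : ∀ l ∈ A', l ∈ B) (hyB : y ∈ B) :
    s.Route B x z (n + m) := by
  intro F hF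
  obtain ⟨S, hS, hSA, hSF⟩ := h F (by omega)
  obtain ⟨T, hT, hTA, hTF⟩ := h' (F ∪ S) (by
    have := Finset.card_union_le F S
    have := hS.card_le
    omega)
  refine ⟨_, hS.trans hT ?_ ?_ ?_ (hub_ne hx hy hxy) (hub_ne hy hz hyz) (hub_ne hx hz hxz), ?_, ?_⟩
  · rw [Finset.disjoint_left]
    intro u huS huT
    rcases hl : s.lab u with _ | l
    · exact hTF u huT hl (Finset.mem_union_right _ huS)
    · exact hA l (hSA u huS l hl) (hTA u huT l hl)
  · exact fun hxT => hxA (hTA _ hxT _ (s.lab_hub x hx))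
  · exact fun hzS => hzA (hSA _ hzS _ (s.lab_hub z hz))
  · intro u hu l hl
    rw [Finset.mem_insert, Finset.mem_union] at hu
    rcases hu with rfl | hu | hu
    · rw [s.lab_hub y hy] at hl
      exact Option.some_injective _ hl ▸ hyB
    · exact hB l (hSA u hu l hl)
    · exact hB' l (hTA u hu l hl)
  · intro u hu hl
    rw [Finset.mem_insert, Finset.mem_union] at hu
    rcases hu with rfl | hu | hu
    · rw [s.lab_hub y hy] at hl
      cases hl
    · exact hSF u hu hl
    · exact fun huF => hTF u hu hl (Finset.mem_union_left _ huF)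

theorem Route.adj (i : ι) : s.Route ∅ (i, 0) (i, 1) 1 := fun F _ =>
  ⟨∅, Link.of_adj (s.adj i), by simp, by simp⟩

theorem Route.symm (h : s.Route A x y n) : s.Route A y x n := by
  intro F hF
  obtain ⟨S, hS, hSA, hSF⟩ := h F hF
  exact ⟨S, hS.symm, hSA, hSF⟩

theorem Route.leg {i i' : ι} {e e' b b' : ℕ} (hi : i ≠ i') (he : 2 ≤ e) (he' : 2 ≤ e') (heK : e < K)
    (heK' : e' < K) (hb : b = if e < 4 then 1 else 0) (hb' : b' = if e' < 4 then 1 else 0) :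
    s.Route {(i, e), (i', e')} (i, b) (i', b') (s.len (i, e) (i', e')) := by
  intro F hF
  obtain ⟨S, hS, hSF, hSl⟩ := s.link (i, e) (i', e') hi he heK he' heK'
    (F.filter fun z => s.lab z = none) ((Finset.card_filter_le _ _).trans (by omega)) (by simp)
  subst hb hb'
  refine ⟨S, hS, ?_, ?_⟩
  · intro z hz l hl
    simpa using hSl z hz l hl
  · intro z hz hl hzF
    exact Finset.disjoint_left.1 hSF hz (by simp [hzF, hl])

/-- The labels of the hubs in `J` except for the two end centres and the reserved legs. -/
def region (J : Set ι) (f g : ι) : Set (ι × ℕ) :=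
  {l | l.1 ∈ J ∧ l ≠ (f, 0) ∧ l ≠ (f, 5) ∧ l ≠ (g, 0) ∧ l ≠ (g, 8)}

variable (s) in
/-- Robust routes of all lengths `p, p + 2, …, p + 2M` from the hub `f` to the hub `g`. -/
def Flex (J : Set ι) (f g : ι) (p M : ℕ) : Prop :=
  f ∈ J ∧ g ∈ J ∧ f ≠ g ∧ ∀ m ≤ M, s.Route (region J f g) (f, 0) (g, 0) (p + 2 * m)

theorem exists_adjuster (hK : 9 ≤ K) {i i' j j' : ι} (hd : [i, i', j, j'].Nodup)
    (h : s.len (i, 6) (i', 6) + s.len (j, 2) (j', 5) =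
      s.len (j, 6) (j', 6) + s.len (i, 2) (i', 5)) :
    ∃ p ≤ 3 * L, s.Flex {i, i', j, j'} i j' p 1 := by
  simp only [List.nodup_cons, List.mem_cons, List.not_mem_nil, not_or, or_false,
    not_false_eq_true, List.nodup_nil, and_true] at hd
  obtain ⟨⟨h1, h2, h3⟩, ⟨h4, h5⟩, h6⟩ := hd
  have l1 := s.len_le (i, 6) (i', 6) h1 (by norm_num) (by simp; omega) (by norm_num)
    (by simp; omega)
  have l2 := s.len_le (i', 7) (j, 3) h4 (by norm_num) (by simp; omega) (by norm_num)
    (by simp; omega)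
  have l3 := s.len_le (j, 2) (j', 5) h6 (by norm_num) (by simp; omega) (by norm_num)
    (by simp; omega)
  have rmid : s.Route {(i', 7), (j, 3)} (i', 0) (j, 1) (s.len (i', 7) (j, 3)) :=
    Route.leg h4 (by norm_num) (by norm_num) (by omega) (by omega) rfl rfl
  have rY1 : s.Route {(i, 6), (i', 6)} (i, 0) (i', 0) (s.len (i, 6) (i', 6)) :=
    Route.leg h1 (by norm_num) (by norm_num) (by omega) (by omega) rfl rfl
  have rX2 : s.Route {(j, 2), (j', 5)} (j, 1) (j', 0) (s.len (j, 2) (j', 5)) :=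
    Route.leg h6 (by norm_num) (by norm_num) (by omega) (by omega) rfl rfl
  have rX1 : s.Route {(i, 2), (i', 5)} (i, 1) (i', 0) (s.len (i, 2) (i', 5)) :=
    Route.leg h1 (by norm_num) (by norm_num) (by omega) (by omega) rfl rfl
  have rY2 : s.Route {(j, 6), (j', 6)} (j, 0) (j', 0) (s.len (j, 6) (j', 6)) :=
    Route.leg h6 (by norm_num) (by norm_num) (by omega) (by omega) rfl rfl
  have rX1' : s.Route {(i, 1), (i, 2), (i', 5)} (i, 0) (i', 0) (1 + s.len (i, 2) (i', 5)) :=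
    (Route.adj i).comp rX1 (by simp) (by simp) (by simp) (by simp) (by simp [h1]) (by simp [h1])
      (by simp) (by simp [h1]) (by simp) (by simp) (by simp) (by simp)
  have rY2' : s.Route {(j, 0), (j, 6), (j', 6)} (j, 1) (j', 0) (1 + s.len (j, 6) (j', 6)) :=
    (Route.adj j).symm.comp rY2 (by simp) (by simp) (by simp) (by simp) (by simp [h6])
      (by simp [h6]) (by simp) (by simp [h6]) (by simp) (by simp) (by simp) (by simp)
  refine ⟨s.len (i, 6) (i', 6) + s.len (i', 7) (j, 3) + s.len (j, 2) (j', 5), by omega,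
    by simp, by simp, h3, ?_⟩
  intro m hm
  have h1' := Ne.symm h1
  have h2' := Ne.symm h2
  have h3' := Ne.symm h3
  have h4' := Ne.symm h4
  have h5' := Ne.symm h5
  have h6' := Ne.symm h6
  interval_cases m
  · rw [mul_zero, add_zero]
    refine Route.comp (B := region {i, i', j, j'} i j') (y := (j, 1))
      (Route.comp (B := {(i, 6), (i', 6), (i', 7), (j, 3), (i', 0)}) rY1 rmid
        ?_ ?_ ?_ ?_ ?_ ?_ ?_ ?_
        ?_ ?_ ?_ ?_) rX2 ?_ ?_ ?_ ?_ ?_ ?_ ?_ ?_ ?_ ?_ ?_ ?_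
    all_goals simp [region, h1, h2, h3, h4, h5, h6, h1', h2', h3', h4', h5', h6']
  · rw [show s.len (i, 6) (i', 6) + s.len (i', 7) (j, 3) + s.len (j, 2) (j', 5) + 2 * 1 =
      (1 + s.len (i, 2) (i', 5)) + s.len (i', 7) (j, 3) + (1 + s.len (j, 6) (j', 6)) by omega]
    refine Route.comp (B := region {i, i', j, j'} i j') (y := (j, 1))
      (Route.comp (B := {(i, 1), (i, 2), (i', 5), (i', 7), (j, 3), (i', 0)}) rX1' rmid ?_ ?_ ?_ ?_
        ?_ ?_ ?_ ?_ ?_ ?_ ?_ ?_) rY2' ?_ ?_ ?_ ?_ ?_ ?_ ?_ ?_ ?_ ?_ ?_ ?_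
    all_goals simp [region, h1, h2, h3, h4, h5, h6, h1', h2', h3', h4', h5', h6']

theorem Flex.comp (hK : 9 ≤ K) {J J' : Set ι} {f g f' g' : ι} {p p' M M' : ℕ}
    (h : s.Flex J f g p M) (h' : s.Flex J' f' g' p' M') (hJ : Disjoint J J') :
    ∃ q ≤ p + L + p', s.Flex (J ∪ J') f g' q (M + M') := by
  obtain ⟨hf, hg, hfg, hr⟩ := h
  obtain ⟨hf', hg', hfg', hr'⟩ := h'
  have hne : ∀ a ∈ J, ∀ b ∈ J', a ≠ b := fun a ha b hb hab =>
    Set.disjoint_left.1 hJ ha (hab ▸ hb)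
  have hnot : ∀ a ∈ J, a ∉ J' := fun a ha hb => Set.disjoint_left.1 hJ ha hb
  have l1 := s.len_le (g, 8) (f', 5) (hne _ hg _ hf') (by norm_num) (by simp; omega) (by norm_num)
    (by simp; omega)
  have rmid : s.Route {(g, 8), (f', 5)} (g, 0) (f', 0) (s.len (g, 8) (f', 5)) :=
    Route.leg (hne _ hg _ hf') (by norm_num) (by norm_num) (by omega) (by omega) rfl rfl
  refine ⟨p + s.len (g, 8) (f', 5) + p', by omega, Or.inl hf, Or.inr hg', hne _ hf _ hg', ?_⟩
  intro m hm
  obtain ⟨m1, hm1, m2, hm2, rfl⟩ : ∃ m1 ≤ M, ∃ m2 ≤ M', m = m1 + m2 :=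
    ⟨min m M, min_le_right _ _, m - min m M, by omega, by omega⟩
  rw [show p + s.len (g, 8) (f', 5) + p' + 2 * (m1 + m2) =
    (p + 2 * m1 + s.len (g, 8) (f', 5)) + (p' + 2 * m2) by ring]
  have e1 := hne _ hg _ hf'
  have e2 := hne _ hf _ hf'
  have e3 := hne _ hf _ hg'
  have e4 := hne _ hg _ hg'
  have e5 := hnot _ hf
  have e6 := hnot _ hg
  have e7 : f' ∉ J := fun h => hnot _ h hf'
  have e8 : g' ∉ J := fun h => hnot _ h hg'
  refine Route.comp (y := (f', 0))
    (Route.comp (B := region J f g ∪ {(g, 8), (f', 5), (g, 0)}) (hr m1 hm1) rmid ?_ ?_ ?_ ?_ ?_ ?_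
      ?_ ?_ ?_ ?_ ?_ ?_) (hr' m2 hm2) ?_ ?_ ?_ ?_ ?_ ?_ ?_ ?_ ?_ ?_ ?_ ?_
  all_goals simp only [region, Set.mem_ofPred_eq, Set.mem_union, Set.mem_insert_iff,
    Set.mem_singleton_iff, Prod.forall, Prod.mk.injEq, ne_eq]
  all_goals clear hr hr' rmid l1 hne hJ
  all_goals grind

theorem exists_adjuster_of_family (hK : 9 ≤ K) (e : Fin (2 * L + 2) × Bool → ι)
    (he : Function.Injective e) :
    ∃ J ⊆ Set.range e, ∃ f g, ∃ p ≤ 3 * L, s.Flex J f g p 1 := by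
  have hne : ∀ t, e (t, false) ≠ e (t, true) := fun t h => by simpa using he h
  have hX : ∀ t, s.len (e (t, false), 2) (e (t, true), 5) ≤ L := fun t =>
    s.len_le _ _ (hne t) (by norm_num) (by simp; omega) (by norm_num) (by simp; omega)
  have hY : ∀ t, s.len (e (t, false), 6) (e (t, true), 6) ≤ L := fun t =>
    s.len_le _ _ (hne t) (by norm_num) (by simp; omega) (by norm_num) (by simp; omega)
  obtain ⟨t, t', htt, ht⟩ := Fintype.exists_ne_map_eq_of_card_lt (β := Fin (2 * L + 1))
    (fun t => ⟨s.len (e (t, false), 6) (e (t, true), 6) + L -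
        s.len (e (t, false), 2) (e (t, true), 5),
      by have := hX t; have := hY t; omega⟩) (by simp)
  simp only [Fin.mk.injEq] at ht
  obtain ⟨p, hp, hf⟩ := exists_adjuster (s := s) hK (i := e (t, false)) (i' := e (t, true))
    (j := e (t', false)) (j' := e (t', true)) (by simp [he.eq_iff, htt]) (by
      have := hX t
      have := hX t'
      omega)
  refine ⟨_, ?_, _, _, p, hp, hf⟩
  rintro i (rfl | rfl | rfl | rfl) <;> exact ⟨_, rfl⟩

theorem exists_flex_of_family (hK : 9 ≤ K) (M : ℕ) :
    ∀ e : Fin (M + 1) × Fin (2 * L + 2) × Bool → ι, Function.Injective e →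
    ∃ J ⊆ Set.range e, ∃ f g, ∃ p ≤ 4 * (M + 1) * L, s.Flex J f g p (M + 1) := by
  induction M with
  | zero =>
    intro e he
    obtain ⟨J, hJ, f, g, p, hp, h⟩ := exists_adjuster_of_family (s := s) hK (fun x => e (0, x))
      fun x y hxy => by simpa using he hxy
    refine ⟨J, ?_, f, g, p, by omega, h⟩
    intro i hi
    obtain ⟨x, rfl⟩ := hJ hi
    exact ⟨_, rfl⟩
  | succ M ih =>
    intro e he
    obtain ⟨J, hJ, f, g, p, hp, h⟩ := ih (fun x => e (x.1.castSucc, x.2)) fun x y hxy => by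
      have h1 := he hxy
      simp only [Prod.mk.injEq, Fin.castSucc_inj] at h1
      exact Prod.ext h1.1 h1.2
    obtain ⟨J', hJ', f', g', p', hp', h'⟩ := exists_adjuster_of_family (s := s) hK
      (fun x => e (Fin.last _, x)) fun x y hxy => by simpa using he hxy
    obtain ⟨q, hq, h2⟩ := h.comp hK h' <| by
      rw [Set.disjoint_left]
      intro i hi hi'
      obtain ⟨x, rfl⟩ := hJ hi
      obtain ⟨y, hy⟩ := hJ' hi'
      have h1 := he hy
      simp only [Prod.mk.injEq] at h1
      exact absurd h1.1.symm (Fin.castSucc_lt_last x.1).ne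
    refine ⟨J ∪ J', ?_, f, g', q, hq.trans ?_, h2⟩
    · rintro i (hi | hi)
      · obtain ⟨x, rfl⟩ := hJ hi
        exact ⟨_, rfl⟩
      · obtain ⟨x, rfl⟩ := hJ' hi
        exact ⟨_, rfl⟩
    · linarith [show 4 * (M + 1 + 1) * L = 4 * (M + 1) * L + 4 * L by ring]

end HubSystem

theorem IsBip.even_of_link {f : V → Bool} (hf : ∀ u v, G.Adj u v → f u ≠ f v) {u v : V} {n : ℕ}
    {S : Finset V} (h : Link G u v n S) (huv : f u = f v) : Even n := by
  obtain ⟨p, -, rfl, -⟩ := h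
  have key : ∀ {u v : V} (p : G.Walk u v), Even p.length ↔ f u = f v := by
    intro u v p
    induction p with
    | nil => simp
    | @cons u v w h p ih =>
      rw [SimpleGraph.Walk.length_cons, Nat.even_add_one, ih]
      have := hf _ _ h
      revert this
      cases f u <;> cases f v <;> cases f w <;> simp
  exact (key p).2 huv

/-- Sufficiently many hubs yield a balanced subdivision. -/
theorem HubSystem.exists_containsBalSub (hbip : IsBip G) {k K L w P : ℕ}
    (hP : P = k * k * (4 * (L + 1) * L + 1))
    (s : HubSystem G (Fin (2 * k) ⊕ (Fin P × Fin (L + 1) × Fin (2 * L + 2) × Bool)) K L w)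
    (hK : k + 9 ≤ K) (hw : (k * k + 1) * (4 * (L + 1) * L + 2 * L + 1) ≤ w) :
    ∃ ℓ, ContainsBalSub G k ℓ := by
  obtain ⟨N, hN⟩ : ∃ N, N = 4 * (L + 1) * L := ⟨_, rfl⟩
  rw [← hN] at hP hw
  obtain ⟨col, hcol⟩ := hbip
  obtain ⟨b, hb⟩ := Fintype.exists_le_card_fiber_of_mul_le_card (n := k)
    (fun i : Fin (2 * k) => col (s.hub (Sum.inl i, 0))) (by simp)
  obtain ⟨c0⟩ := Function.Embedding.nonempty_of_card_le (α := Fin k)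
    (β := {i // i ∈ Finset.univ.filter fun i : Fin (2 * k) => col (s.hub (Sum.inl i, 0)) = b})
    (by rw [Fintype.card_coe, Fintype.card_fin]; exact hb)
  have hflex : ∀ x : Fin P, ∃ J ⊆ Set.range fun y => Sum.inr (x, y), ∃ f g, ∃ p ≤ N,
      s.Flex J f g p (L + 1) := fun x => hN ▸
    exists_flex_of_family (by omega) L (fun y => Sum.inr (x, y)) fun y z h => by simpa using h
  choose J hJ f g p hp hfl using hflex
  obtain ⟨p0, hp0⟩ := Fintype.exists_le_card_fiber_of_mul_le_card (n := k * k)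
    (fun x : Fin P => (⟨p x, by have := hp x; omega⟩ : Fin (N + 1)))
    (by simp [hP, mul_comm])
  obtain ⟨q0⟩ := Function.Embedding.nonempty_of_card_le (α := Fin k × Fin k)
    (β := {x // x ∈ Finset.univ.filter fun x : Fin P =>
      (⟨p x, by have := hp x; omega⟩ : Fin (N + 1)) = p0})
    (by rw [Fintype.card_coe, Fintype.card_prod, Fintype.card_fin]; exact hp0)
  let c : Fin k → Fin (2 * k) ⊕ (Fin P × Fin (L + 1) × Fin (2 * L + 2) × Bool) :=
    fun i => Sum.inl (c0 i)
  let q : Fin k × Fin k → Fin P := fun i => q0 i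
  have hqinj : Function.Injective q := fun i j h => q0.injective (Subtype.ext h)
  have hcinj : Function.Injective c := fun i j h => c0.injective (Subtype.ext (Sum.inl_injective h))
  have hccol : ∀ i, col (s.hub (c i, 0)) = b := fun i => (Finset.mem_filter.1 (c0 i).2).2
  have hqp : ∀ i, p (q i) = p0 := fun i => by
    have := (Finset.mem_filter.1 (q0 i).2).2
    exact congrArg Fin.val this
  have hcJ : ∀ i x, c i ∉ J x := fun i x h => by
    obtain ⟨y, hy⟩ := hJ x h
    simp [c] at hy
  have hJJ : ∀ x y i, i ∈ J x → i ∈ J y → x = y := fun x y i h h' => by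
    obtain ⟨u, rfl⟩ := hJ x h
    obtain ⟨v, hv⟩ := hJ y h'
    simp only [Sum.inr.injEq, Prod.mk.injEq] at hv
    exact hv.1.symm
  set ℓ := p0 + 2 * L + p0 % 2 with hℓ
  have hℓN : ℓ ≤ N + 2 * L + 1 := by
    have := p0.2
    omega
  let B : Fin k → Fin k →
      Set ((Fin (2 * k) ⊕ (Fin P × Fin (L + 1) × Fin (2 * L + 2) × Bool)) × ℕ) :=
    fun i j => {l | l = (c i, 4 + j.val) ∨ l = (c j, 4 + i.val) ∨ l.1 ∈ J (q (i, j))}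
  have hroute : ∀ i j : Fin k, i < j → s.Route (B i j) (c i, 0) (c j, 0) ℓ := by
    intro i j hij
    have hci := hcJ i (q (i, j))
    have hcj := hcJ j (q (i, j))
    have hccij : c i ≠ c j := hcinj.ne hij.ne
    have hi := i.2
    have hj := j.2
    have hpp := hqp (i, j)
    obtain ⟨hf, hg, hfg, hr⟩ := hfl (q (i, j))
    have h1 : c i ≠ f (q (i, j)) := fun h => hci (h ▸ hf)
    have h2 : c i ≠ g (q (i, j)) := fun h => hci (h ▸ hg)
    have h3 : c j ≠ f (q (i, j)) := fun h => hcj (h ▸ hf)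
    have h4 : g (q (i, j)) ≠ c j := fun h => hcj (h ▸ hg)
    have l1 := s.len_le (c i, 4 + j.val) (f (q (i, j)), 5) h1 (by simp; omega) (by simp; omega)
      (by norm_num) (by simp; omega)
    have l2 := s.len_le (g (q (i, j)), 8) (c j, 4 + i.val) h4 (by norm_num) (by simp; omega)
      (by simp; omega) (by simp; omega)
    have r1 : s.Route {(c i, 4 + j.val), (f (q (i, j)), 5)} (c i, 0) (f (q (i, j)), 0) _ :=
      Route.leg h1 (by omega) (by norm_num) (by omega) (by omega) (by simp) (by simp)
    have r2 : s.Route {(g (q (i, j)), 8), (c j, 4 + i.val)} (g (q (i, j)), 0) (c j, 0) _ :=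
      Route.leg h4 (by norm_num) (by omega) (by omega) (by omega) (by simp) (by simp)
    have hall : ∀ m ≤ L + 1, s.Route (B i j) (c i, 0) (c j, 0)
        (s.len (c i, 4 + j.val) (f (q (i, j)), 5) + (p (q (i, j)) + 2 * m) +
          s.len (g (q (i, j)), 8) (c j, 4 + i.val)) := by
      intro m hm
      refine Route.comp (y := (g (q (i, j)), 0)) (Route.comp
        (B := {l | l = (c i, 4 + j.val) ∨ l ≠ (g (q (i, j)), 0) ∧ l ≠ (g (q (i, j)), 8) ∧
          l.1 ∈ J (q (i, j))}) r1 (hr m hm) ?_ ?_ ?_ ?_ ?_ ?_ ?_ ?_ ?_ ?_ ?_ ?_) r2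
        ?_ ?_ ?_ ?_ ?_ ?_ ?_ ?_ ?_ ?_ ?_ ?_
      all_goals simp only [B, region, Set.mem_ofPred_eq, Set.mem_insert_iff,
        Set.mem_singleton_iff, Prod.forall, Prod.mk.injEq, ne_eq]
      all_goals clear r1 r2 hr l1 l2 hJ hfl hcJ hJJ hqp hp0 hb hw hK hP hpp
      all_goals grind
    have hev := hall 0 (by omega) ∅ (by
      rw [Finset.card_empty]
      have := p0.2
      nlinarith [Nat.zero_le (k * k)])
    obtain ⟨S, hS, -⟩ := hev
    have hpar := IsBip.even_of_link hcol hS (by rw [hccol, hccol])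
    rw [Nat.even_iff] at hpar
    have := hall ((2 * L + p0 % 2 - s.len (c i, 4 + j.val) (f (q (i, j)), 5) -
      s.len (g (q (i, j)), 8) (c j, 4 + i.val)) / 2) (by omega)
    convert this using 1
    omega
  obtain ⟨S, hS, hSd⟩ := exists_disjoint_choice (ι := Fin k × Fin k) (α := Finset V)
    (fun x S => x.1 < x.2 → Link G (s.hub (c x.1, 0)) (s.hub (c x.2, 0)) ℓ S ∧
      ∀ z ∈ S, ∀ l, s.lab z = some l → l ∈ B x.1 x.2)
    (fun _ S => S.filter fun z => s.lab z = none) ℓ <| by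
      intro x Φ hΦ
      by_cases hx : x.1 < x.2
      · obtain ⟨S, h1, h2, h3⟩ := hroute x.1 x.2 hx Φ (by
          rw [Fintype.card_prod, Fintype.card_fin] at hΦ
          nlinarith [Nat.mul_le_mul_left (k * k + 1) hℓN])
        refine ⟨S, fun _ => ⟨h1, h2⟩, (Finset.card_filter_le _ _).trans h1.card_le, ?_⟩
        rw [Finset.disjoint_left]
        intro z hz
        rw [Finset.mem_filter] at hz
        exact h3 z hz.1 hz.2
      · exact ⟨∅, fun h => absurd h hx, by simp, by simp⟩
  refine ⟨ℓ, containsBalSub_of_links (fun i => s.hub (c i, 0)) ?_ (fun i j => S (i, j))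
    (fun i j hij => (hS (i, j) hij).1) ?_ ?_⟩
  · intro i j hij
    by_contra hne
    exact hub_ne (s := s) (x := (c i, 0)) (y := (c j, 0)) (by simp) (by simp)
      (by simpa using hcinj.ne hne) hij
  · intro i j hij r hr
    have := (hS (i, j) hij).2 _ hr _ (s.lab_hub (c r, 0) (by simp))
    simp only [B, Set.mem_ofPred_eq, Prod.mk.injEq] at this
    rcases this with h | h | h
    · omega
    · omega
    · exact hcJ _ _ h
  · intro i j hij i' j' hij' hne
    rw [Finset.disjoint_left]
    intro z hz hz'
    rcases hl : s.lab z with _ | l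
    · exact Finset.disjoint_left.1 (hSd _ _ hne) (Finset.mem_filter.2 ⟨hz, hl⟩)
        (Finset.mem_filter.2 ⟨hz', hl⟩)
    · have h1 := (hS (i, j) hij).2 z hz l hl
      have h2 := (hS (i', j') hij').2 z hz' l hl
      simp only [B, Set.mem_ofPred_eq] at h1 h2
      rcases h1 with rfl | rfl | h1 <;> rcases h2 with h2 | h2 | h2
      all_goals try simp only [Prod.mk.injEq, hcinj.eq_iff] at h2
      all_goals simp only [Prod.mk.injEq, ne_eq] at hne
      · exact hne ⟨h2.1, Fin.ext (by omega)⟩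
      · exact absurd (h2.1 ▸ hij) (by
          have := Fin.ext (a := j) (b := i') (by omega)
          subst this
          exact fun h => absurd h (not_lt.2 hij'.le))
      · exact hcJ _ _ h2
      · exact absurd (h2.1 ▸ hij) (by
          have := Fin.ext (a := i) (b := j') (by omega)
          subst this
          exact fun h => absurd h (not_lt.2 hij'.le))
      · exact hne ⟨Fin.ext (by omega), h2.1⟩
      · exact hcJ _ _ h2
      · subst h2; exact hcJ _ _ h1
      · subst h2; exact hcJ _ _ h1
      · have := hqinj (hJJ _ _ _ h1 h2)
        simp only [Prod.mk.injEq] at this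
        exact hne this

end Routing

section Legs
open scoped Classical
variable [Fintype V] {G : SimpleGraph V}

theorem mem_ball_succ_of_mem_nbr {F A : Finset V} {i : ℕ} {z : V} (hz : z ∈ nbr G (ball G F A i))
    (hF : z ∉ F) : z ∈ ball G F A (i + 1) := by
  rw [ball_succ, Finset.mem_union, Finset.mem_sdiff]
  exact Or.inr ⟨hz, hF⟩

theorem exists_connected_subset {F : Finset V} {v : V} {D : ℕ} (hD : 0 < D) :
    ∀ r, D ≤ (ball G F {v} r).card →
      ∃ I ⊆ ball G F {v} r, I.card = D ∧ v ∈ I ∧ ∀ x ∈ I, Reach G I r v x := by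
  intro r
  induction r with
  | zero =>
    intro h
    have h1 : ball G F {v} 0 = {v} := rfl
    rw [h1, Finset.card_singleton] at h
    refine ⟨{v}, by simp [h1], by simp; omega, by simp, ?_⟩
    intro x hx
    rw [Finset.mem_singleton] at hx
    subst hx
    exact Reach.refl 0 (by simp)
  | succ r ih =>
    intro h
    by_cases hr : D ≤ (ball G F {v} r).card
    · obtain ⟨I, h1, h2, h3, h4⟩ := ih hr
      exact ⟨I, h1.trans (ball_subset_succ _ _ _), h2, h3, fun x hx =>
        (h4 x hx).mono subset_rfl (by omega)⟩
    · obtain ⟨I, h1, h2, h3⟩ := Finset.exists_subsuperset_card_eq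
        (ball_subset_succ (G := G) F {v} r) (by omega) h
      refine ⟨I, h2, h3, h1 (subset_ball _ _ _ (by simp)), ?_⟩
      intro x hx
      by_cases hxb : x ∈ ball G F {v} r
      · obtain ⟨a, ha, h4⟩ := exists_reach_of_mem_ball hxb
        rw [Finset.mem_singleton] at ha
        exact ha ▸ h4.mono h1 (by omega)
      · have h4 := h2 hx
        rw [ball_succ, Finset.mem_union, Finset.mem_sdiff, mem_nbr] at h4
        obtain ⟨⟨-, u, hu, hux⟩, -⟩ := h4.resolve_left hxb
        obtain ⟨a, ha, h5⟩ := exists_reach_of_mem_ball hu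
        rw [Finset.mem_singleton] at ha
        exact (ha ▸ h5.mono h1 le_rfl).tail hux hx

/-- A thin connection from `A` to its first point in `B`. -/
theorem exists_first_hit {F A B : Finset V} {r : ℕ} (h : ∃ b ∈ B, b ∈ ball G F A r) :
    ∃ Q ⊆ ball G F A r, ∃ x ∈ B, ∃ a ∈ A, (∀ z ∈ Q, z ∈ B → z = x) ∧ Reach G Q r a x ∧
      ∀ l, (Q ∩ ball G F A l).card ≤ l + 1 := by
  have hex : ∃ i, ∃ b ∈ B, b ∈ ball G F A i := ⟨r, h⟩
  obtain ⟨x, hxB, hx⟩ := Nat.find_spec hex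
  have hmin := fun j (hj : j < Nat.find hex) => Nat.find_min hex hj
  have hir : Nat.find hex ≤ r := Nat.find_min' hex h
  revert hx hmin hir
  generalize Nat.find hex = i
  intro hx hmin hir
  rcases i with _ | i
  · refine ⟨{x}, ?_, x, hxB, x, hx, by simp, Reach.refl _ (by simp), fun l => ?_⟩
    · rw [Finset.singleton_subset_iff]
      exact subset_ball _ _ _ hx
    · exact (Finset.card_le_card Finset.inter_subset_left).trans (by simp)
  · have hdis : ∀ z ∈ B, z ∉ ball G F A i := fun z hz hzi => hmin i (by omega) ⟨z, hz, hzi⟩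
    have h1 := hx
    rw [ball_succ, Finset.mem_union, Finset.mem_sdiff, mem_nbr] at h1
    obtain ⟨⟨-, u, hu, hux⟩, -⟩ := h1.resolve_left (hdis x hxB)
    obtain ⟨Q, hQ, a, ha, hreach, hthin⟩ := exists_thin_reach hu
    refine ⟨insert x Q, ?_, x, hxB, a, ha, ?_, ?_, ?_⟩
    · rw [Finset.insert_subset_iff]
      exact ⟨ball_mono F A hir hx, hQ.trans (ball_mono F A (by omega))⟩
    · intro z hz hzB
      rw [Finset.mem_insert] at hz
      exact hz.resolve_right fun h => hdis z hzB (hQ h)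
    · exact ((hreach.mono (Finset.subset_insert _ _) le_rfl).tail hux (by simp)).mono subset_rfl hir
    · intro l
      by_cases hl : l ≤ i
      · have : insert x Q ∩ ball G F A l ⊆ Q ∩ ball G F A l := by
          intro z hz
          rw [Finset.mem_inter, Finset.mem_insert] at hz
          rcases hz with ⟨rfl | hz, hzl⟩
          · exact absurd (ball_mono F A hl hzl) (hdis _ hxB)
          · exact Finset.mem_inter.2 ⟨hz, hzl⟩
        exact (Finset.card_le_card this).trans (hthin l)
      · have h2 := hthin i
        rw [Finset.inter_eq_left.2 hQ] at h2
        have h3 := Finset.card_le_card (Finset.inter_subset_left (s₁ := insert x Q)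
          (s₂ := ball G F A l))
        have h4 := Finset.card_insert_le x Q
        omega

/-- The vertices of `F ∪ S` next to a ball are controlled by those next to a larger ball. -/
theorem card_nbr_ball_inter_le {F F' A A' S : Finset V} {l : ℕ} (hF : F ⊆ F')
    (hA : A' ⊆ ball G F A l) (hAF : Disjoint A F) (i : ℕ) :
    (nbr G (ball G F' A' i) ∩ (F ∪ S)).card ≤
      (nbr G (ball G F A (i + l)) ∩ F).card + (S ∩ ball G F A (i + l + 1)).card := by
  have hsub : ball G F' A' i ⊆ ball G F A (i + l) := by
    refine (ball_subset_ball hA hF i).trans ?_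
    rw [ball_add, add_comm]
  refine (Finset.card_le_card ?_).trans (Finset.card_union_le _ _)
  intro z hz
  rw [Finset.mem_inter, Finset.mem_union, mem_nbr] at hz
  obtain ⟨⟨-, u, hu, huz⟩, hz⟩ := hz
  rw [Finset.mem_union, Finset.mem_inter, Finset.mem_inter]
  by_cases hzF : z ∈ F
  · exact Or.inl ⟨mem_nbr.2 ⟨fun h => Finset.disjoint_left.1 (ball_disjoint hAF _) h hzF, u,
      hsub hu, huz⟩, hzF⟩
  · exact Or.inr ⟨hz.resolve_left hzF, mem_ball_succ_of_adj (hsub hu) huz hzF⟩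

/-- Pairwise disjoint connected sets of the same size. -/
structure IsPortSystem {T : Type*} (G : SimpleGraph V) (I : T → Finset V) (D r : ℕ) : Prop where
  disj : ∀ t t', t ≠ t' → Disjoint (I t) (I t')
  card : ∀ t, (I t).card = D
  reach : ∀ t, ∀ x ∈ I t, ∀ y ∈ I t, Reach G (I t) r x y

/-- `S` is a leg starting at a neighbour `a` of the centre `c` and containing the port `I t`. -/
structure IsLeg {T : Type*} (G : SimpleGraph V) (I : T → Finset V) (s r : ℕ) (c : V)
    (S : Finset V) (t : T) (a : V) : Prop where
  adj : G.Adj c a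
  mem : a ∈ S
  sub : I t ⊆ S
  card : (S \ I t).card ≤ s
  reach : ∀ y ∈ I t, Reach G S r a y

theorem IsGoodExpander.exists_leg {H y₀ δ Λ : ℕ} (h : IsGoodExpander G H y₀ δ Λ) {T : Type*}
    [Fintype T] {I : T → Finset V} {D r₀ y m : ℕ} (hI : IsPortSystem G I D r₀) (hD : 0 < D)
    {F : Finset V} {c : V} (hH : 0 < H) (hy : y₀ ≤ y) (hy0 : 0 < y) (hF0 : F.Nonempty)
    (hA : y ^ H ≤ (nbr G {c} \ F).card)
    (herr : ∀ i < m * 2 ^ H,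
      (nbr G (ball G F (nbr G {c} \ F) i) ∩ F).card ≤ (y + i / 2 ^ H) ^ (H - 1))
    (hn : (y + m) ^ (2 * H) ≤ Fintype.card V) (hF : 16 * Λ ^ 2 * F.card ≤ (y + m) ^ H)
    (hT : (16 * Λ ^ 2 + 1) * F.card ≤ Fintype.card T) (hΛ : 0 < Λ) :
    ∃ S t a, IsLeg G I (m * 2 ^ H + 32 * Λ ^ 3 + 1) (m * 2 ^ H + 32 * Λ ^ 3 + r₀) c S t a ∧
      a ∈ nbr G {c} \ F ∧ Disjoint S F ∧ ∀ l, Disjoint (ball G F (nbr G {c} \ F) l) (I t) →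
        (S ∩ ball G F (nbr G {c} \ F) l).card ≤ l + 1 := by
  set A := nbr G {c} \ F with hAdef
  have hAF : Disjoint A F := Finset.sdiff_disjoint
  let free : Finset T := Finset.univ.filter fun t => Disjoint (I t) F
  have hfree : 16 * Λ ^ 2 * F.card ≤ free.card := by
    have h1 : (Finset.univ.filter fun t => ¬ Disjoint (I t) F).card ≤ F.card := by
      by_contra! hcon
      obtain ⟨t, ht, hd⟩ := exists_disjoint_of_card_lt _ I F
        (fun i _ j _ hij => hI.disj i j hij) hcon
      exact (Finset.mem_filter.1 ht).2 hd
    have h2 := Finset.card_filter_add_card_filter_not (s := (Finset.univ : Finset T))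
      (fun t => Disjoint (I t) F)
    rw [Finset.card_univ] at h2
    have h3 : free.card = (Finset.univ.filter fun t => Disjoint (I t) F).card := rfl
    rw [add_mul, one_mul] at hT
    omega
  have hFpos : 0 < F.card := Finset.card_pos.2 hF0
  have hfpos : 0 < free.card := lt_of_lt_of_le (by positivity) hfree
  set B := free.biUnion I with hB
  have hBc : free.card ≤ B.card := by
    rw [hB, Finset.card_biUnion fun t _ t' _ htt => hI.disj t t' htt]
    simp only [hI.card, Finset.sum_const, smul_eq_mul]
    exact Nat.le_mul_of_pos_right _ hD
  have hBF : Disjoint B F := by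
    rw [hB, Finset.disjoint_biUnion_left]
    exact fun t ht => (Finset.mem_filter.1 ht).2
  have hgrow := h.growth hH hy hy0 hA m herr hn
  have hAne : (ball G F A (m * 2 ^ H)).Nonempty := by
    rw [← Finset.card_pos]
    exact lt_of_lt_of_le (by positivity) hgrow
  obtain ⟨b, hbB, hb⟩ := h.exists_mem_ball hAne (Finset.card_pos.1 (hfpos.trans_le hBc)) hBF
    (hF.trans hgrow) (hfree.trans hBc)
  rw [ball_add] at hb
  obtain ⟨Q, hQ, x, hxB, a, ha, hQB, hreach, hthin⟩ := exists_first_hit ⟨b, hbB, hb⟩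
  rw [hB, Finset.mem_biUnion] at hxB
  obtain ⟨t, htf, hxt⟩ := hxB
  have ha' := ha
  rw [hAdef, Finset.mem_sdiff, mem_nbr] at ha'
  obtain ⟨⟨-, c', hc', hca⟩, haF⟩ := ha'
  rw [Finset.mem_singleton] at hc'
  subst hc'
  refine ⟨Q ∪ I t, t, a, ⟨hca, Finset.mem_union_left _ hreach.mem_left,
    Finset.subset_union_right, ?_, ?_⟩, ha, ?_, ?_⟩
  · have h1 := hthin (m * 2 ^ H + 32 * Λ ^ 3)
    rw [Finset.inter_eq_left.2 hQ] at h1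
    refine (Finset.card_le_card ?_).trans h1
    intro z hz
    rw [Finset.mem_sdiff, Finset.mem_union] at hz
    exact hz.1.resolve_right hz.2
  · exact fun z hz => hreach.trans (hI.reach t x hxt z hz)
  · rw [Finset.disjoint_union_left]
    exact ⟨(ball_disjoint hAF _).mono_left hQ, (Finset.mem_filter.1 htf).2⟩
  · intro l hl
    refine (Finset.card_le_card ?_).trans (hthin l)
    intro z hz
    rw [Finset.mem_inter, Finset.mem_union] at hz
    exact Finset.mem_inter.2 ⟨hz.1.resolve_right (Finset.disjoint_left.1 hl hz.2), hz.2⟩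

end Legs

section Gadgets
open scoped Classical
variable [Fintype V] {G : SimpleGraph V}

/-- Few vertices of `F` are seen from `c` and from the balls around `c` outside `F`. -/
structure IsRoom (G : SimpleGraph V) (F : Finset V) (c : V) (q o ρ E : ℕ) : Prop where
  deg : (nbr G {c} ∩ F).card ≤ E * o ^ q
  err : ∀ i ≤ ρ, (nbr G (ball G F (nbr G {c} \ F) i) ∩ F).card ≤ E * (i + o) ^ q

theorem IsRoom.union {F S : Finset V} {c : V} {q o ρ E : ℕ} (hr : IsRoom G F c q o ρ E)
    (hq : 0 < q) (ho : 2 ≤ o)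
    (hthin : ∀ l ≤ ρ + 1, (S ∩ ball G F (nbr G {c} \ F) l).card ≤ l + 1) :
    IsRoom G (F ∪ S) c q o ρ (E + 1) := by
  refine ⟨?_, fun i hi => ?_⟩
  · have h1 : nbr G {c} ∩ (F ∪ S) ⊆ nbr G {c} ∩ F ∪ S ∩ ball G F (nbr G {c} \ F) 0 := by
      intro z hz
      have h0 : ball G F (nbr G {c} \ F) 0 = nbr G {c} \ F := rfl
      rw [h0]
      simp only [Finset.mem_inter, Finset.mem_union, Finset.mem_sdiff] at hz ⊢
      tauto
    have h2 := (Finset.card_le_card h1).trans (Finset.card_union_le _ _)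
    have h3 := hthin 0 (by omega)
    have h4 := hr.deg
    have h5 : 1 ≤ o ^ q := Nat.one_le_pow _ _ (by omega)
    nlinarith
  · have h1 := card_nbr_ball_inter_le (G := G) (F := F) (F' := F ∪ S) (A := nbr G {c} \ F)
      (A' := nbr G {c} \ (F ∪ S)) (S := S) (l := 0) Finset.subset_union_left
      ((Finset.sdiff_subset_sdiff subset_rfl Finset.subset_union_left).trans
        (subset_ball _ _ _)) Finset.sdiff_disjoint i
    have h2 := hthin (i + 1) (by omega)
    have h3 := hr.err i hi
    have h4 : i + o ≤ (i + o) ^ q := Nat.le_self_pow hq.ne' _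
    simp only [add_zero] at h1
    nlinarith

theorem IsRoom.of_mem {F S : Finset V} {c a : V} {q o ρ E : ℕ}
    (hr : IsRoom G F c q o (ρ + 1) E) (hq : 0 < q) (ho : 2 ≤ o) (ha : a ∈ nbr G {c} \ F)
    (hthin : ∀ l ≤ ρ + 2, (S ∩ ball G F (nbr G {c} \ F) l).card ≤ l + 1) :
    IsRoom G (F ∪ S) a q (o + 1) ρ (E + 1) := by
  have hAF : Disjoint (nbr G {c} \ F) F := Finset.sdiff_disjoint
  have haF := (Finset.mem_sdiff.1 ha).2
  have hadj : ∀ z, z ∈ nbr G {a} → G.Adj a z := by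
    intro z hz
    rw [mem_nbr] at hz
    obtain ⟨-, u, hu, huz⟩ := hz
    rw [Finset.mem_singleton] at hu
    exact hu ▸ huz
  refine ⟨?_, fun i hi => ?_⟩
  · have h1 : nbr G {a} ∩ (F ∪ S) ⊆ nbr G (ball G F (nbr G {c} \ F) 0) ∩ F ∪
        S ∩ ball G F (nbr G {c} \ F) 1 := by
      intro z hz
      rw [Finset.mem_inter, Finset.mem_union] at hz
      rw [Finset.mem_union, Finset.mem_inter, Finset.mem_inter]
      by_cases hzF : z ∈ F
      · exact Or.inl ⟨mem_nbr.2 ⟨fun hh => Finset.disjoint_left.1 (ball_disjoint hAF 0) hh hzF,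
          a, subset_ball _ _ _ ha, hadj z hz.1⟩, hzF⟩
      · exact Or.inr ⟨hz.2.resolve_left hzF,
          mem_ball_succ_of_adj (subset_ball _ _ 0 ha) (hadj z hz.1) hzF⟩
    have h2 := (Finset.card_le_card h1).trans (Finset.card_union_le _ _)
    have h3 := hthin 1 (by omega)
    have h4 := hr.err 0 (by omega)
    have h5 : o + 1 ≤ (o + 1) ^ q := Nat.le_self_pow hq.ne' _
    have h6 : (0 + o) ^ q ≤ (o + 1) ^ q := Nat.pow_le_pow_left (by omega) _
    nlinarith
  · have hsub : nbr G {a} \ (F ∪ S) ⊆ ball G F (nbr G {c} \ F) 1 := by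
      intro z hz
      rw [Finset.mem_sdiff, Finset.mem_union] at hz
      exact mem_ball_succ_of_adj (subset_ball _ _ 0 ha) (hadj z hz.1) fun hh => hz.2 (Or.inl hh)
    have h1 := card_nbr_ball_inter_le (G := G) (F := F) (F' := F ∪ S) (A := nbr G {c} \ F)
      (A' := nbr G {a} \ (F ∪ S)) (S := S) (l := 1) Finset.subset_union_left hsub hAF i
    have h2 := hthin (i + 1 + 1) (by omega)
    have h3 := hr.err (i + 1) (by omega)
    have h4 : i + (o + 1) ≤ (i + (o + 1)) ^ q := Nat.le_self_pow hq.ne' _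
    rw [show i + 1 + o = i + (o + 1) by ring] at h3
    nlinarith

/-- The numerical conditions under which a leg can be grown in the presence of at most `f`
forbidden vertices. -/
structure LegBounds (n Λ δ H q N y m E f : ℕ) : Prop where
  deg : y ^ H + E * 3 ^ q ≤ δ
  err : ∀ i < m * 2 ^ H, E * (i + 3) ^ q ≤ (y + i / 2 ^ H) ^ (H - 1)
  card : (y + m) ^ (2 * H) ≤ n
  forbidden : 16 * Λ ^ 2 * f ≤ (y + m) ^ H
  ports : (16 * Λ ^ 2 + 1) * f ≤ N

variable {H y₀ δ Λ : ℕ} {T : Type*} [Fintype T] {I : T → Finset V} {D r₀ y m q E f : ℕ}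

theorem IsGoodExpander.exists_leg_of_isRoom (h : IsGoodExpander G H y₀ δ Λ)
    (hI : IsPortSystem G I D r₀) (hD : 0 < D) (hH : 0 < H) (hy : y₀ ≤ y) (hy0 : 0 < y)
    (hb : LegBounds (Fintype.card V) Λ δ H q (Fintype.card T) y m E f) {F : Finset V} {c : V}
    {o ρ E' : ℕ} (hr : IsRoom G F c q o ρ E') (ho : o ≤ 3) (hE : E' ≤ E) (hρ : m * 2 ^ H ≤ ρ)
    (hc : c ∈ F) (hf : F.card ≤ f) :
    ∃ S t a, IsLeg G I (m * 2 ^ H + 32 * Λ ^ 3 + 1) (m * 2 ^ H + 32 * Λ ^ 3 + r₀) c S t a ∧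
      a ∈ nbr G {c} \ F ∧ Disjoint S F ∧ ∀ l, Disjoint (ball G F (nbr G {c} \ F) l) (I t) →
        (S ∩ ball G F (nbr G {c} \ F) l).card ≤ l + 1 := by
  have hpow : ∀ i, E' * (i + o) ^ q ≤ E * (i + 3) ^ q := fun i =>
    Nat.mul_le_mul hE (Nat.pow_le_pow_left (by omega) _)
  refine h.exists_leg hI hD hH hy hy0 ⟨c, hc⟩ ?_ ?_ hb.card
    ((Nat.mul_le_mul_left _ hf).trans hb.forbidden) ((Nat.mul_le_mul_left _ hf).trans hb.ports)
    (by have := h.two_le; omega)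
  · have h1 := h.le_degree c
    have h2 := hr.deg
    have h3 := hb.deg
    have h4 := Finset.card_sdiff_add_card_inter (nbr G {c}) F
    have h5 := hpow 0
    simp only [zero_add] at h5
    omega
  · intro i hi
    exact ((hr.err i (by omega)).trans (hpow i)).trans (hb.err i hi)

theorem IsLeg.card_le {s r : ℕ} {c a : V} {S : Finset V} {t : T} (hl : IsLeg G I s r c S t a)
    (hI : IsPortSystem G I D r₀) : S.card ≤ s + D := by
  have h1 := Finset.card_sdiff_add_card_eq_card hl.sub
  have h2 := hl.card
  have h3 := hI.card t
  omega

theorem IsGoodExpander.exists_legs (h : IsGoodExpander G H y₀ δ Λ) [Nonempty T]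
    (hI : IsPortSystem G I D r₀) (hD : 0 < D) (hH : 0 < H) (hy : y₀ ≤ y) (hy0 : 0 < y)
    (hq : 0 < q) (hb : LegBounds (Fintype.card V) Λ δ H q (Fintype.card T) y m E f)
    {F : Finset V} {c : V} {ρ E₀ : ℕ} (hr : IsRoom G F c q 2 ρ E₀) (hρ : m * 2 ^ H ≤ ρ)
    (hc : c ∈ F) (hfar : ∀ t, Disjoint (ball G F (nbr G {c} \ F) (ρ + 1)) (I t)) :
    ∀ M, E₀ + M ≤ E → F.card + M * (m * 2 ^ H + 32 * Λ ^ 3 + 1 + D) ≤ f →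
    ∃ (S : ℕ → Finset V) (t : ℕ → T) (a : ℕ → V),
      (∀ e < M, IsLeg G I (m * 2 ^ H + 32 * Λ ^ 3 + 1) (m * 2 ^ H + 32 * Λ ^ 3 + r₀) c
        (S e) (t e) (a e)) ∧ (∀ e < M, Disjoint (S e) F) ∧
      (∀ e < M, ∀ e' < e, Disjoint (S e) (S e')) ∧
      IsRoom G (F ∪ (Finset.range M).biUnion S) c q 2 ρ (E₀ + M) := by
  intro M
  induction M with
  | zero =>
    intro _ _
    exact ⟨fun _ => ∅, fun _ => Classical.arbitrary T, fun _ => c, by simp, by simp, by simp,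
      by simpa using hr⟩
  | succ M ih =>
    intro hE hf
    obtain ⟨S, t, a, h1, h2, h3, h4⟩ := ih (by omega) (by rw [add_mul] at hf; omega)
    set F' := F ∪ (Finset.range M).biUnion S with hF'
    have hFF' : F ⊆ F' := Finset.subset_union_left
    have hcard : F'.card ≤ f := by
      have h5 : ((Finset.range M).biUnion S).card ≤ M * (m * 2 ^ H + 32 * Λ ^ 3 + 1 + D) := by
        refine (Finset.card_biUnion_le_card_mul _ _ _ fun e he =>
          (h1 e (Finset.mem_range.1 he)).card_le hI).trans (by simp)
      have h6 : F'.card ≤ F.card + ((Finset.range M).biUnion S).card :=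
        Finset.card_union_le _ _
      rw [add_mul] at hf
      omega
    obtain ⟨S', t', a', h5, h6, h7, h8⟩ := h.exists_leg_of_isRoom hI hD hH hy hy0 hb h4
      (by omega) (by omega) hρ (hFF' hc) hcard
    have hset : F ∪ (Finset.range (M + 1)).biUnion (Function.update S M S') = F' ∪ S' := by
      rw [Finset.range_add_one, Finset.biUnion_insert, Function.update_self, hF',
        Finset.union_assoc, Finset.union_comm S']
      congr 2
      exact Finset.biUnion_congr rfl fun e he => Function.update_of_ne
        (Finset.mem_range.1 he).ne _ _
    rw [Finset.disjoint_union_right, Finset.disjoint_biUnion_right] at h7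
    refine ⟨Function.update S M S', Function.update t M t', Function.update a M a', ?_, ?_, ?_, ?_⟩
    · intro e he
      rcases Nat.lt_succ_iff_lt_or_eq.1 he with he | rfl
      · simpa only [Function.update_of_ne he.ne] using h1 e he
      · simpa only [Function.update_self] using h5
    · intro e he
      rcases Nat.lt_succ_iff_lt_or_eq.1 he with he | rfl
      · simpa only [Function.update_of_ne he.ne] using h2 e he
      · simpa only [Function.update_self] using h7.1
    · intro e he e' he'
      rcases Nat.lt_succ_iff_lt_or_eq.1 he with he | rfl
      · simpa only [Function.update_of_ne he.ne, Function.update_of_ne (he'.trans he).ne] using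
          h3 e he e' he'
      · simpa only [Function.update_of_ne he'.ne, Function.update_self] using
          h7.2 e' (Finset.mem_range.2 he')
    · rw [hset]
      refine h4.union hq le_rfl fun l hl => h8 l ?_
      refine (hfar t').mono_left ((ball_mono _ _ hl).trans ?_)
      exact ball_subset_ball (Finset.sdiff_subset_sdiff subset_rfl hFF') hFF' _

/-- A hub: an edge `v w` together with sets attached to its ends, each containing a port. -/
structure Gadget (V T : Type*) where
  v : V
  w : V
  part : ℕ → Finset V
  port : ℕ → T

/-- The end of the edge to which a part is attached. -/
def Gadget.core (g : Gadget V T) (e : ℕ) : V := if e < 4 then g.w else g.v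

/-- All vertices of the first `K` parts. -/
noncomputable def Gadget.body (K : ℕ) (g : Gadget V T) : Finset V := (Finset.range K).biUnion g.part

structure IsGadget (G : SimpleGraph V) (I : T → Finset V) (Z : Finset V) (K s r : ℕ)
    (g : Gadget V T) : Prop where
  adj : G.Adj g.v g.w
  part_zero : g.part 0 = {g.v}
  part_one : g.part 1 = {g.w}
  disj : ∀ e < K, ∀ e' < e, Disjoint (g.part e) (g.part e')
  disjoint : ∀ e < K, Disjoint (g.part e) Z
  sub : ∀ e, 2 ≤ e → e < K → I (g.port e) ⊆ g.part e
  card : ∀ e, 2 ≤ e → e < K → (g.part e \ I (g.port e)).card ≤ s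
  reach : ∀ e, 2 ≤ e → e < K → ∀ y ∈ I (g.port e),
    Reach G (insert (g.core e) (g.part e)) r (g.core e) y

theorem IsLeg.reach_insert {s r : ℕ} {c a : V} {S : Finset V} {t : T} (hl : IsLeg G I s r c S t a)
    {y : V} (hy : y ∈ I t) : Reach G (insert c S) (r + 1) c y := by
  have h1 := (Reach.of_adj hl.adj).mono (T := insert c S) (m := 1) (by
    intro z hz
    simp only [Finset.mem_insert, Finset.mem_singleton] at hz ⊢
    rcases hz with rfl | rfl
    · exact Or.inl rfl
    · exact Or.inr hl.mem) le_rfl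
  exact (h1.trans_same ((hl.reach y hy).mono (Finset.subset_insert _ _) le_rfl)).mono subset_rfl
    (by omega)

theorem IsGoodExpander.exists_gadget (h : IsGoodExpander G H y₀ δ Λ) [Nonempty T]
    (hI : IsPortSystem G I D r₀) (hD : 0 < D) (hH : 0 < H) (hy : y₀ ≤ y) (hy0 : 0 < y)
    (hq : 0 < q) (hb : LegBounds (Fintype.card V) Λ δ H q (Fintype.card T) y m E f)
    {Z Φ : Finset V} {v : V} {ρ s₀ K : ℕ} (hvZ : v ∉ Z) (hρ : m * 2 ^ H + 1 ≤ ρ)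
    (hpiece : ∀ r ≤ ρ + 1, (nbr G (ball G Z {v} r) ∩ Z).card ≤ s₀ * (r + 1) ^ q)
    (hΦ : Disjoint (ball G Z {v} (ρ + 2)) Φ)
    (hfar : ∀ t, Disjoint (ball G Z {v} (ρ + 2)) (I t)) (hE : s₀ + 1 + K ≤ E)
    (hf : Z.card + Φ.card + 1 + K * (m * 2 ^ H + 32 * Λ ^ 3 + 1 + D) ≤ f) (hK : 4 ≤ K) :
    ∃ g : Gadget V T, IsGadget G I Z K (m * 2 ^ H + 32 * Λ ^ 3 + 1)
      (m * 2 ^ H + 32 * Λ ^ 3 + r₀ + 1) g ∧ Disjoint (g.body K) Φ := by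
  obtain ⟨M, rfl⟩ := Nat.exists_eq_add_of_le' hK
  set s := m * 2 ^ H + 32 * Λ ^ 3 + 1 with hs
  have hvball : v ∈ ball G Z {v} 0 := subset_ball _ _ _ (by simp)
  set F := insert v (Z ∪ Φ) with hF
  have hZF : Z ⊆ F := Finset.subset_union_left.trans (Finset.subset_insert _ _)
  have hadj : ∀ z, z ∈ nbr G {v} → G.Adj v z := by
    intro z hz
    rw [mem_nbr] at hz
    obtain ⟨-, u, hu, huz⟩ := hz
    rw [Finset.mem_singleton] at hu
    exact hu ▸ huz
  have hsub1 : nbr G {v} \ F ⊆ ball G Z {v} 1 := by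
    intro z hz
    rw [Finset.mem_sdiff] at hz
    exact mem_ball_succ_of_adj hvball (hadj z hz.1) fun hh => hz.2 (hZF hh)
  have hsub : ∀ i, ball G F (nbr G {v} \ F) i ⊆ ball G Z {v} (i + 1) := by
    intro i
    refine (ball_subset_ball hsub1 hZF i).trans ?_
    rw [ball_add, add_comm]
  have hnbr : ∀ i ≤ ρ + 1, ∀ X ⊆ ball G Z {v} i,
      (nbr G X ∩ F) ⊆ insert v (nbr G (ball G Z {v} i) ∩ Z) := by
    intro i hi X hX z hz
    rw [Finset.mem_inter, mem_nbr] at hz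
    obtain ⟨⟨-, u, hu, huz⟩, hzF⟩ := hz
    rw [hF, Finset.mem_insert, Finset.mem_union] at hzF
    rw [Finset.mem_insert, Finset.mem_inter]
    have hdZ := ball_disjoint (G := G) (F := Z) (A := {v}) (by simpa using hvZ) i
    by_cases hzZ : z ∈ Z
    · exact Or.inr ⟨mem_nbr.2 ⟨fun hh => Finset.disjoint_left.1 hdZ hh hzZ, u, hX hu, huz⟩, hzZ⟩
    · have h1 := mem_ball_succ_of_adj (hX hu) huz hzZ
      have h2 := Finset.disjoint_left.1 hΦ (ball_mono _ _ (by omega : i + 1 ≤ ρ + 2) h1)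
      tauto
  have hroom : IsRoom G F v q 2 ρ (s₀ + 1) := by
    refine ⟨?_, fun i hi => ?_⟩
    · have h0 : nbr G {v} ∩ F ⊆ nbr G (ball G Z {v} 0) ∩ Z := by
        intro z hz
        have h1 := hnbr 0 (by omega) {v} (by simpa using hvball) hz
        rw [Finset.mem_insert] at h1
        refine h1.resolve_left ?_
        rintro rfl
        exact G.irrefl (hadj _ (Finset.mem_inter.1 hz).1)
      have h1 := (Finset.card_le_card h0).trans (hpiece 0 (by omega))
      have h2 : (0 + 1) ^ q ≤ 2 ^ q := Nat.pow_le_pow_left (by omega) _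
      exact h1.trans (Nat.mul_le_mul (by omega) h2)
    · have h1 := (Finset.card_le_card (hnbr (i + 1) (by omega) _ (hsub i))).trans
        (Finset.card_insert_le _ _)
      have h2 := hpiece (i + 1) (by omega)
      have h3 : 1 ≤ (i + 2) ^ q := Nat.one_le_pow _ _ (by omega)
      rw [show i + 1 + 1 = i + 2 by ring] at h2
      nlinarith
  have hfarF : ∀ t, Disjoint (ball G F (nbr G {v} \ F) (ρ + 1)) (I t) := fun t =>
    (hfar t).mono_left (hsub _)
  have hFc : F.card ≤ Z.card + Φ.card + 1 :=
    (Finset.card_insert_le _ _).trans (Nat.add_le_add_right (Finset.card_union_le _ _) _)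
  have hvF : v ∈ F := Finset.mem_insert_self _ _
  obtain ⟨S, t, a, h1, h2, h3, h4⟩ := h.exists_legs hI hD hH hy hy0 hq hb hroom (by omega) hvF
    hfarF M (by omega) (by rw [← hs]; nlinarith)
  set F₁ := F ∪ (Finset.range M).biUnion S with hF₁
  have hFF₁ : F ⊆ F₁ := Finset.subset_union_left
  have hF₁c : F₁.card + (s + D) ≤ f := by
    have h5 : ((Finset.range M).biUnion S).card ≤ M * (s + D) := by
      refine (Finset.card_biUnion_le_card_mul _ _ _ fun e he =>
        (h1 e (Finset.mem_range.1 he)).card_le hI).trans (by simp [hs])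
    have h6 : F₁.card ≤ F.card + ((Finset.range M).biUnion S).card := Finset.card_union_le _ _
    nlinarith
  obtain ⟨S₁, t₁, w, h5, hw, h6, h7⟩ := h.exists_leg_of_isRoom hI hD hH hy hy0 hb h4
    (by omega) (by omega) (by omega) (hFF₁ hvF) (by omega)
  have hsubF₁ : ∀ l, ball G F₁ (nbr G {v} \ F₁) l ⊆ ball G F (nbr G {v} \ F) l := fun l =>
    ball_subset_ball (Finset.sdiff_subset_sdiff subset_rfl hFF₁) hFF₁ _
  obtain ⟨ρ', rfl⟩ := Nat.exists_eq_add_of_le' (show 1 ≤ ρ by omega)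
  have hroom₁ := h4.of_mem (S := S₁) hq le_rfl hw fun l hl => h7 l
    ((hfarF t₁).mono_left ((hsubF₁ l).trans (ball_mono _ _ (by omega))))
  have hF₂c : (F₁ ∪ S₁).card ≤ f := by
    have h8 := Finset.card_union_le F₁ S₁
    have h9 := h5.card_le hI
    omega
  obtain ⟨S₂, t₂, u, h8, -, h9, -⟩ := h.exists_leg_of_isRoom hI hD hH hy hy0 hb hroom₁
    (by omega) (by omega) (by omega) (Finset.mem_union_right _ h5.mem) hF₂c
  have hwI : w ∉ I t₁ := fun hh => Finset.disjoint_left.1 (hfarF t₁)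
    (subset_ball _ _ _ (Finset.sdiff_subset_sdiff subset_rfl hFF₁ hw)) hh
  have hIw : I t₁ ⊆ S₁.erase w := fun z hz =>
    Finset.mem_erase.2 ⟨fun hh => hwI (hh ▸ hz), h5.sub hz⟩
  have hwF₁ := (Finset.mem_sdiff.1 hw).2
  have hwS : ∀ e < M, w ∉ S e := fun e he hh => hwF₁ <| Finset.mem_union_right _ <|
    Finset.mem_biUnion.2 ⟨e, Finset.mem_range.2 he, hh⟩
  have hS₁ : Disjoint S₁ F ∧ ∀ e < M, Disjoint S₁ (S e) := by
    rw [hF₁, Finset.disjoint_union_right, Finset.disjoint_biUnion_right] at h6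
    exact ⟨h6.1, fun e he => h6.2 e (Finset.mem_range.2 he)⟩
  have hS₂ : Disjoint S₂ F ∧ Disjoint S₂ S₁ ∧ ∀ e < M, Disjoint S₂ (S e) := by
    rw [hF₁, Finset.disjoint_union_right, Finset.disjoint_union_right,
      Finset.disjoint_biUnion_right] at h9
    exact ⟨h9.1.1, h9.2, fun e he => h9.1.2 e (Finset.mem_range.2 he)⟩
  have hwF : w ∉ F := fun hh => hwF₁ (hFF₁ hh)
  have hvS : ∀ S' : Finset V, Disjoint S' F → v ∉ S' := fun S' hS' hh =>
    Finset.disjoint_left.1 hS' hh hvF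
  have hout : ∀ e < M + 4, e ≠ 0 → Disjoint (match e with
      | 0 => {v} | 1 => {w} | 2 => S₁.erase w | 3 => S₂ | e + 4 => S e) F := by
    intro e he he0
    match e with
    | 0 => exact absurd rfl he0
    | 1 => simpa using hwF
    | 2 => exact hS₁.1.mono_left (Finset.erase_subset _ _)
    | 3 => exact hS₂.1
    | e + 4 => exact h2 e (by omega)
  have hZΦ : Disjoint {v} (Z ∪ Φ) := by
    rw [Finset.disjoint_singleton_left, Finset.mem_union]
    exact fun hh => hh.elim hvZ (Finset.disjoint_left.1 hΦ (ball_mono _ _ (Nat.zero_le _) hvball))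
  have hout' : ∀ e < M + 4, Disjoint (match e with
      | 0 => {v} | 1 => {w} | 2 => S₁.erase w | 3 => S₂ | e + 4 => S e) (Z ∪ Φ) := by
    intro e he
    by_cases he0 : e = 0
    · subst he0
      exact hZΦ
    · exact (hout e he he0).mono_right (Finset.subset_insert _ _)
  refine ⟨⟨v, w, fun e => match e with
      | 0 => {v} | 1 => {w} | 2 => S₁.erase w | 3 => S₂ | e + 4 => S e,
    fun e => match e with
      | 0 => t₁ | 1 => t₁ | 2 => t₁ | 3 => t₂ | e + 4 => t e⟩,
    ⟨h5.adj, rfl, rfl, ?_, fun e he => (hout' e he).mono_right Finset.subset_union_left,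
      ?_, ?_, ?_⟩, ?_⟩
  · intro e he e' he'
    by_cases he0 : e' = 0
    · subst he0
      exact (hout e he (by omega)).mono_right (by simpa using hvF)
    match e, e' with
    | 0, _ => omega
    | 1, e' + 1 => omega
    | 2, 1 => simp
    | 2, e' + 2 => omega
    | 3, 1 => simpa using fun hh => Finset.disjoint_left.1 hS₂.2.1 hh h5.mem
    | 3, 2 => exact hS₂.2.1.mono_right (Finset.erase_subset _ _)
    | 3, e' + 3 => omega
    | e + 4, 1 => simpa using hwS e (by omega)
    | e + 4, 2 => exact (hS₁.2 e (by omega)).symm.mono_right (Finset.erase_subset _ _)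
    | e + 4, 3 => exact (hS₂.2.2 e (by omega)).symm
    | e + 4, e' + 4 => exact h3 e (by omega) e' (by omega)
  · intro e he he'
    match e with
    | 2 => exact hIw
    | 3 => exact h8.sub
    | e + 4 => exact (h1 e (by omega)).sub
  · intro e he he'
    match e with
    | 2 => exact (Finset.card_le_card (Finset.sdiff_subset_sdiff (Finset.erase_subset _ _)
        subset_rfl)).trans h5.card
    | 3 => exact h8.card
    | e + 4 => exact (h1 e (by omega)).card
  · intro e he he'
    match e with
    | 2 =>
      intro z hz
      have h10 : Gadget.core (T := T) ⟨v, w, fun e => match e with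
        | 0 => {v} | 1 => {w} | 2 => S₁.erase w | 3 => S₂ | e + 4 => S e,
        fun e => match e with
        | 0 => t₁ | 1 => t₁ | 2 => t₁ | 3 => t₂ | e + 4 => t e⟩ 2 = w := rfl
      rw [h10]
      refine (h5.reach z hz).mono ?_ (by omega)
      exact (Finset.insert_erase h5.mem).ge
    | 3 => exact fun z hz => h8.reach_insert hz
    | e + 4 =>
      have h10 : ¬ e + 4 < 4 := by omega
      simp only [Gadget.core, h10, if_false]
      exact fun z hz => (h1 e (by omega)).reach_insert hz
  · rw [Gadget.body, Finset.disjoint_biUnion_left]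
    exact fun e he => (hout' e (Finset.mem_range.1 he)).mono_right Finset.subset_union_right

theorem IsGadget.card_part_le {Z : Finset V} {K s r : ℕ} {g : Gadget V T}
    (hg : IsGadget G I Z K s r g) (hI : IsPortSystem G I D r₀) (hD : 0 < D) {e : ℕ} (he : e < K) :
    (g.part e).card ≤ s + D := by
  rcases Nat.lt_or_ge e 2 with h2 | h2
  · have : e = 0 ∨ e = 1 := by omega
    rcases this with rfl | rfl
    · rw [hg.part_zero, Finset.card_singleton]; omega
    · rw [hg.part_one, Finset.card_singleton]; omega
  · have h1 := Finset.card_sdiff_add_card_eq_card (hg.sub e h2 he)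
    have h3 := hg.card e h2 he
    have h4 := hI.card (g.port e)
    omega

theorem IsGadget.card_body_le {Z : Finset V} {K s r : ℕ} {g : Gadget V T}
    (hg : IsGadget G I Z K s r g) (hI : IsPortSystem G I D r₀) (hD : 0 < D) :
    (g.body K).card ≤ K * (s + D) :=
  (Finset.card_biUnion_le_card_mul _ _ _ fun _ he =>
    hg.card_part_le hI hD (Finset.mem_range.1 he)).trans (by simp)

end Gadgets

section Hubs
open scoped Classical
variable [Fintype V] {G : SimpleGraph V} {H y₀ δ Λ : ℕ} {T : Type*} [Fintype T]
  {I : T → Finset V} {D r₀ y m q E f : ℕ}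

/-- A ball that avoids a set meeting all pieces sees few vertices of `Z`. -/
theorem card_nbr_ball_inter_lt {Z P : Finset V} {s₀ R r : ℕ} {v : V}
    (hP : ∀ X r, IsPiece G Z q s₀ R X r → ¬ Disjoint X P) (hv : v ∉ Z) (hr : r ≤ R)
    (hd : Disjoint (ball G Z {v} r) P) :
    (nbr G (ball G Z {v} r) ∩ Z).card < s₀ * (r + 1) ^ q := by
  by_contra! hcon
  refine hP _ r ⟨hr, ball_disjoint (by simpa using hv) r, ⟨v, subset_ball _ _ _ (by simp), ?_⟩,
    hcon⟩ hd
  intro x hx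
  obtain ⟨a, ha, h⟩ := exists_reach_of_mem_ball hx
  rw [Finset.mem_singleton] at ha
  exact ha ▸ h

theorem IsGoodExpander.exists_ports (h : IsGoodExpander G H y₀ δ Λ) (hH : 0 < H) (hy : y₀ ≤ y)
    (hy0 : 0 < y) {Z P : Finset V} {Δ ρ s₀ : ℕ} (hΔ : ∀ v, v ∉ Z → (nbr G {v}).card ≤ Δ)
    (hP : ∀ v, v ∉ Z → ∀ r ≤ ρ, Disjoint (ball G Z {v} r) P →
      (nbr G (ball G Z {v} r) ∩ Z).card ≤ s₀ * (r + 1) ^ q)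
    (hδ : y ^ H + s₀ ≤ δ) (herr : ∀ i < m * 2 ^ H, s₀ * (i + 2) ^ q ≤ (y + i / 2 ^ H) ^ (H - 1))
    (hn : (y + m) ^ (2 * H) ≤ Fintype.card V) (hD : 0 < D) (hDm : D ≤ (y + m) ^ H)
    (hρ : m * 2 ^ H + 1 ≤ ρ)
    (hfar : (P.card + Fintype.card T * (Δ + 1) ^ ρ) * (Δ + 1) ^ ρ + Z.card < Fintype.card V) :
    ∃ (c : T → V) (I : T → Finset V), IsPortSystem G I D (2 * (m * 2 ^ H + 1)) ∧
      (∀ t, c t ∉ Z) ∧ (∀ t, I t ⊆ ball G Z {c t} (m * 2 ^ H + 1)) ∧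
      ∀ t t', t ≠ t' → Disjoint (ball G Z {c t} ρ) (ball G Z {c t'} ρ) := by
  have key : ∀ v, v ∉ Z → Disjoint (ball G Z {v} ρ) P →
      D ≤ (ball G Z {v} (m * 2 ^ H + 1)).card := by
    intro v hv hvP
    have hvb : v ∈ ball G Z {v} 0 := subset_ball _ _ _ (by simp)
    have hsub1 : nbr G {v} \ Z ⊆ ball G Z {v} 1 := by
      intro z hz
      rw [Finset.mem_sdiff] at hz
      exact mem_ball_succ_of_mem_nbr (i := 0) hz.1 hz.2
    have hsub : ∀ i, ball G Z (nbr G {v} \ Z) i ⊆ ball G Z {v} (i + 1) := by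
      intro i
      refine (ball_subset_ball hsub1 subset_rfl i).trans ?_
      rw [ball_add, add_comm]
    have hdZ : ∀ i, Disjoint (ball G Z {v} i) Z := ball_disjoint (by simpa using hv)
    have hloc : ∀ r ≤ ρ, (nbr G (ball G Z {v} r) ∩ Z).card ≤ s₀ * (r + 1) ^ q := fun r hr =>
      hP v hv r hr (hvP.mono_left (ball_mono _ _ hr))
    refine hDm.trans ((h.growth hH hy hy0 (F := Z) (A := nbr G {v} \ Z) ?_ m ?_ hn).trans
      (Finset.card_le_card (hsub _)))
    · have h1 := h.le_degree v
      have h2 := Finset.card_sdiff_add_card_inter (nbr G {v}) Z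
      have h3 : (nbr G {v} ∩ Z).card ≤ s₀ := by
        have h4 := hloc 0 (Nat.zero_le _)
        rwa [zero_add, one_pow, mul_one] at h4
      omega
    · intro i hi
      refine (Finset.card_le_card ?_).trans ((hloc (i + 1) (by omega)).trans (herr i hi))
      intro z hz
      rw [Finset.mem_inter, mem_nbr] at hz
      obtain ⟨⟨-, u, hu, huz⟩, hzZ⟩ := hz
      exact Finset.mem_inter.2 ⟨mem_nbr.2 ⟨fun hh => Finset.disjoint_left.1 (hdZ _) hh hzZ, u,
        hsub i hu, huz⟩, hzZ⟩
  obtain ⟨c, hc, hcd⟩ := exists_disjoint_choice (ι := T) (α := V)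
    (fun _ v => v ∉ Z ∧ Disjoint (ball G Z {v} ρ) P) (fun _ v => ball G Z {v} ρ)
    ((Δ + 1) ^ ρ) <| by
      intro _ Φ hΦ
      obtain ⟨v, hv, hd⟩ := exists_far (G := G) (Z := Z) (U := P ∪ Φ) (ρ := ρ) hΔ
        (lt_of_le_of_lt (Nat.add_le_add_right (Nat.mul_le_mul_right _
          ((Finset.card_union_le _ _).trans (Nat.add_le_add_left hΦ _))) _) hfar)
      rw [Finset.disjoint_union_right] at hd
      refine ⟨v, ⟨hv, hd.1⟩, ?_, hd.2⟩
      simpa using card_ball_le (A := {v}) hΔ subset_rfl (by simpa using hv) ρ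
  choose I hI1 hI2 hI3 hI4 using fun t =>
    exists_connected_subset hD _ (key (c t) (hc t).1 (hc t).2)
  refine ⟨c, I, ⟨fun t t' htt => (hcd t t' htt).mono ((hI1 t).trans (ball_mono _ _ hρ))
    ((hI1 t').trans (ball_mono _ _ hρ)), hI2, fun t x hx z hz => ?_⟩, fun t => (hc t).1, hI1, hcd⟩
  exact ((hI4 t x hx).symm.trans_same (hI4 t z hz)).mono subset_rfl (by omega)

theorem IsGoodExpander.exists_gadgets (h : IsGoodExpander G H y₀ δ Λ) [Nonempty T]
    (hI : IsPortSystem G I D r₀) (hD : 0 < D) (hH : 0 < H) (hy : y₀ ≤ y) (hy0 : 0 < y)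
    (hq : 0 < q) (hb : LegBounds (Fintype.card V) Λ δ H q (Fintype.card T) y m E f)
    {Z P : Finset V} {Δ ρ s₀ K s : ℕ} (hΔ : ∀ v, v ∉ Z → (nbr G {v}).card ≤ Δ)
    (hP : ∀ v, v ∉ Z → ∀ r ≤ ρ, Disjoint (ball G Z {v} r) P →
      (nbr G (ball G Z {v} r) ∩ Z).card ≤ s₀ * (r + 1) ^ q)
    (hρ : m * 2 ^ H + 3 ≤ ρ) (hE : s₀ + 1 + K ≤ E) (hs : s = m * 2 ^ H + 32 * Λ ^ 3 + 1)
    (hK : 4 ≤ K) (ι : Type*) [Fintype ι]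
    (hf : Z.card + Fintype.card ι * (K * (s + D)) + 1 + K * (s + D) ≤ f)
    (hfar : (P.card + Fintype.card T * D + Fintype.card ι * (K * (s + D))) * (Δ + 1) ^ ρ + Z.card <
      Fintype.card V) :
    ∃ g : ι → Gadget V T, (∀ i, IsGadget G I Z K s (s + r₀) (g i)) ∧
      ∀ i j, i ≠ j → Disjoint ((g i).body K) ((g j).body K) := by
  refine exists_disjoint_choice (fun _ g => IsGadget G I Z K s (s + r₀) g)
    (fun _ g => g.body K) (K * (s + D)) ?_
  intro _ Φ hΦ
  have hU : (P ∪ Finset.univ.biUnion I ∪ Φ).card ≤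
      P.card + Fintype.card T * D + Fintype.card ι * (K * (s + D)) := by
    have h1 := Finset.card_union_le (P ∪ Finset.univ.biUnion I) Φ
    have h2 := Finset.card_union_le P (Finset.univ.biUnion I)
    have h3 : (Finset.univ.biUnion I).card ≤ Fintype.card T * D := by
      refine (Finset.card_biUnion_le_card_mul _ _ _ fun t _ => (hI.card t).le).trans (by simp)
    omega
  obtain ⟨v, hv, hd⟩ := exists_far (G := G) (Z := Z) (ρ := ρ) hΔ
    (lt_of_le_of_lt (Nat.add_le_add_right (Nat.mul_le_mul_right _ hU) _) hfar)
  rw [Finset.disjoint_union_right, Finset.disjoint_union_right,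
    Finset.disjoint_biUnion_right] at hd
  obtain ⟨ρ', rfl⟩ := Nat.exists_eq_add_of_le' (show 2 ≤ ρ by omega)
  obtain ⟨g, hg, hgΦ⟩ := h.exists_gadget hI hD hH hy hy0 hq hb (Φ := Φ) (ρ := ρ') (s₀ := s₀)
    (K := K) hv (by omega)
    (fun r hr => hP v hv r (by omega) (hd.1.1.mono_left (ball_mono _ _ (by omega)))) hd.2
    (fun t => hd.1.2 t (Finset.mem_univ t)) hE
    (by rw [← hs]; omega) hK
  have hsr : m * 2 ^ H + 32 * Λ ^ 3 + r₀ + 1 = s + r₀ := by omega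
  rw [← hs, hsr] at hg
  exact ⟨g, hg, hg.card_body_le hI hD, hgΦ⟩

variable {ι : Type*} {g : ι → Gadget V T} {Z : Finset V} {K s r : ℕ}

theorem part_eq_of_mem (hg : ∀ i, IsGadget G I Z K s r (g i))
    (hd : ∀ i j, i ≠ j → Disjoint ((g i).body K) ((g j).body K)) {x x' : ι × ℕ} {z : V}
    (hx : x.2 < K) (hx' : x'.2 < K) (hz : z ∈ (g x.1).part x.2) (hz' : z ∈ (g x'.1).part x'.2) :
    x = x' := by
  have hi : x.1 = x'.1 := by
    by_contra hne
    exact Finset.disjoint_left.1 (hd _ _ hne)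
      (Finset.mem_biUnion.2 ⟨_, Finset.mem_range.2 hx, hz⟩)
      (Finset.mem_biUnion.2 ⟨_, Finset.mem_range.2 hx', hz'⟩)
  rw [← hi] at hz'
  refine Prod.ext hi ?_
  rcases lt_trichotomy x.2 x'.2 with hlt | heq | hlt
  · exact absurd hz (Finset.disjoint_left.1 ((hg x.1).disj _ hx' _ hlt) hz')
  · exact heq
  · exact absurd hz' (Finset.disjoint_left.1 ((hg x.1).disj _ hx _ hlt) hz)

/-- Two parts of different gadgets can be joined while avoiding a small set. -/
theorem IsGoodExpander.exists_link_of_parts (h : IsGoodExpander G H y₀ δ Λ) (hH : 0 < H)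
    (hy : y₀ ≤ y) (hy0 : 0 < y) (hI : IsPortSystem G I D r₀) (hD : y ^ H ≤ D) [Fintype ι]
    (hg : ∀ i, IsGadget G I Z K s r (g i)) (hs : 0 < s)
    (hd : ∀ i j, i ≠ j → Disjoint ((g i).body K) ((g j).body K)) {c : T → V} {R ρ : ℕ}
    (hcI : ∀ t, I t ⊆ ball G Z {c t} R)
    (hcd : ∀ t t', t ≠ t' → Disjoint (ball G Z {c t} ρ) (ball G Z {c t'} ρ))
    (hρ : R + m * 2 ^ H + 1 ≤ ρ) {w : ℕ}
    (herr : Z.card + Fintype.card ι * (K * s) + w ≤ y ^ (H - 1))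
    (hn : (y + m) ^ (2 * H) ≤ Fintype.card V)
    (hF : 16 * Λ ^ 2 * (Z.card + Fintype.card ι * (K * (s + D)) + w) ≤ (y + m) ^ H)
    {x x' : ι × ℕ} (hxx : x.1 ≠ x'.1) (hx : 2 ≤ x.2) (hxK : x.2 < K) (hx' : 2 ≤ x'.2)
    (hxK' : x'.2 < K) {W : Finset V} (hW : W.card ≤ w) (hWX : ∀ i, Disjoint W ((g i).body K)) :
    ∃ n ≤ 2 * r + 2 * (m * 2 ^ H) + 32 * Λ ^ 3, ∃ S,
      Link G ((g x.1).core x.2) ((g x'.1).core x'.2) n S ∧ Disjoint S W ∧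
        ∀ z ∈ S, ∀ l : ι × ℕ, l.2 < K → z ∈ (g l.1).part l.2 → l = x ∨ l = x' := by
  set X := Finset.univ.biUnion fun i => (g i).body K with hX
  set F := (Z ∪ X ∪ W) \ ((g x.1).part x.2 ∪ (g x'.1).part x'.2) with hFdef
  have hyH : 0 < y ^ H := by positivity
  have hmemX : ∀ z, z ∈ X ↔ ∃ l : ι × ℕ, l.2 < K ∧ z ∈ (g l.1).part l.2 := by
    intro z
    rw [hX]
    simp only [Gadget.body, Finset.mem_biUnion, Finset.mem_univ, true_and, Finset.mem_range,
      Prod.exists]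
  have hFmem : ∀ z, z ∈ F ↔ (z ∈ Z ∨ z ∈ X ∨ z ∈ W) ∧ z ∉ (g x.1).part x.2 ∧
      z ∉ (g x'.1).part x'.2 := by
    intro z
    rw [hFdef]
    simp only [Finset.mem_sdiff, Finset.mem_union]
    tauto
  have hZF : Z ⊆ F := by
    intro z hz
    exact (hFmem z).2 ⟨Or.inl hz, fun hh => Finset.disjoint_left.1 ((hg _).disjoint _ hxK) hh hz,
      fun hh => Finset.disjoint_left.1 ((hg _).disjoint _ hxK') hh hz⟩
  have hFc : F.card ≤ Z.card + Fintype.card ι * (K * (s + D)) + w := by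
    have h1 : F.card ≤ (Z ∪ X ∪ W).card := Finset.card_le_card Finset.sdiff_subset
    have h2 := Finset.card_union_le (Z ∪ X) W
    have h3 := Finset.card_union_le Z X
    have h4 : X.card ≤ Fintype.card ι * (K * (s + D)) := by
      refine (Finset.card_biUnion_le_card_mul _ _ _ fun i _ =>
        (hg i).card_body_le hI (hyH.trans_le hD)).trans (by simp)
    omega
  -- the vertices of `X` outside the ports
  set Y := Finset.univ.biUnion fun i => (Finset.range K).biUnion fun e =>
    if e < 2 then (g i).part e else (g i).part e \ I ((g i).port e) with hY
  have hYc : Y.card ≤ Fintype.card ι * (K * s) := by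
    refine (Finset.card_biUnion_le_card_mul _ _ (K * s) fun i _ => ?_).trans (by simp)
    refine (Finset.card_biUnion_le_card_mul _ _ s fun e he => ?_).trans (by simp)
    by_cases he2 : e < 2
    · rw [if_pos he2]
      have : e = 0 ∨ e = 1 := by omega
      rcases this with rfl | rfl
      · rw [(hg i).part_zero, Finset.card_singleton]; exact hs
      · rw [(hg i).part_one, Finset.card_singleton]; exact hs
    · rw [if_neg he2]
      exact (hg i).card e (by omega) (Finset.mem_range.1 he)
  have hgrow : ∀ u : ι × ℕ, u = x ∨ u = x' →
      (y + m) ^ H ≤ (ball G F (I ((g u.1).port u.2)) (m * 2 ^ H)).card := by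
    intro u hu
    have hu2 : 2 ≤ u.2 ∧ u.2 < K := by rcases hu with rfl | rfl <;> constructor <;> assumption
    have hIu : ∀ z ∈ I ((g u.1).port u.2), z ∉ F := by
      intro z hz hzF
      have h1 := (hg u.1).sub u.2 hu2.1 hu2.2 hz
      have h2 := ((hFmem z).1 hzF).2
      rcases hu with rfl | rfl
      · exact h2.1 h1
      · exact h2.2 h1
    refine h.growth hH hy hy0 (by rwa [hI.card]) m (fun i hi => ?_) hn
    have hsub : ball G F (I ((g u.1).port u.2)) i ⊆ ball G Z {c ((g u.1).port u.2)} (i + R) := by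
      refine (ball_subset_ball (hcI _) hZF i).trans ?_
      rw [ball_add, add_comm]
    have hle : (nbr G (ball G F (I ((g u.1).port u.2)) i) ∩ F).card ≤ (Z ∪ Y ∪ W).card := by
      refine Finset.card_le_card ?_
      intro z hz
      rw [Finset.mem_inter, mem_nbr] at hz
      obtain ⟨⟨-, b, hb, hbz⟩, hzF⟩ := hz
      simp only [Finset.mem_union]
      by_cases hzZ : z ∈ Z
      · exact Or.inl (Or.inl hzZ)
      rcases ((hFmem z).1 hzF).1 with hh | hzX | hh
      · exact Or.inl (Or.inl hh)
      · refine Or.inl (Or.inr ?_)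
        obtain ⟨l, hl, hzl⟩ := (hmemX z).1 hzX
        rw [hY, Finset.mem_biUnion]
        refine ⟨l.1, Finset.mem_univ _, Finset.mem_biUnion.2 ⟨l.2, Finset.mem_range.2 hl, ?_⟩⟩
        by_cases hl2 : l.2 < 2
        · rwa [if_pos hl2]
        · rw [if_neg hl2, Finset.mem_sdiff]
          refine ⟨hzl, fun hzI => ?_⟩
          have hpt : (g l.1).port l.2 ≠ (g u.1).port u.2 := by
            intro hpt
            rw [hpt] at hzI
            exact hIu z hzI hzF
          refine Finset.disjoint_left.1 (hcd _ _ hpt)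
            (ball_mono _ _ (by omega) (hcI _ hzI)) (ball_mono _ _ ?_
              (mem_ball_succ_of_adj (hsub hb) hbz hzZ))
          omega
      · exact Or.inr hh
    have h1 := Finset.card_union_le (Z ∪ Y) W
    have h2 := Finset.card_union_le Z Y
    have h3 : y ^ (H - 1) ≤ (y + i / 2 ^ H) ^ (H - 1) :=
      Nat.pow_le_pow_left (Nat.le_add_right _ _) _
    omega
  have hIF : ∀ u : ι × ℕ, u = x ∨ u = x' → Disjoint (I ((g u.1).port u.2)) F := by
    intro u hu
    rw [Finset.disjoint_left]
    intro z hz hzF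
    have h2 := ((hFmem z).1 hzF).2
    rcases hu with rfl | rfl
    · exact h2.1 ((hg u.1).sub u.2 hx hxK hz)
    · exact h2.2 ((hg u.1).sub u.2 hx' hxK' hz)
  have hx1 := hgrow x (Or.inl rfl)
  have hx2 := hgrow x' (Or.inr rfl)
  have hpos : 0 < (y + m) ^ H := by positivity
  obtain ⟨b, hb, hb'⟩ := h.exists_mem_ball (F := F) (Finset.card_pos.1 (hpos.trans_le hx1))
    (Finset.card_pos.1 (hpos.trans_le hx2)) (ball_disjoint (hIF x' (Or.inr rfl)) _)
    (((Nat.mul_le_mul_left _ hFc).trans hF).trans hx1)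
    (((Nat.mul_le_mul_left _ hFc).trans hF).trans hx2)
  rw [ball_add] at hb'
  obtain ⟨p, hp, hpb⟩ := exists_reach_of_mem_ball hb'
  obtain ⟨p', hp', hpb'⟩ := exists_reach_of_mem_ball hb
  have hpath := (((hg x.1).reach x.2 hx hxK p hp).trans hpb).trans
    (hpb'.symm.trans ((hg x'.1).reach x'.2 hx' hxK' p' hp').symm)
  obtain ⟨n, hn', S, hS, hlink⟩ := hpath.exists_link
  have hSmem : ∀ z ∈ S, z ∈ (g x.1).part x.2 ∨ z ∈ (g x'.1).part x'.2 ∨ z ∉ F := by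
    intro z hz
    have h1 := hS hz
    simp only [Finset.mem_union, Finset.mem_insert] at h1
    have h2 : z ≠ (g x.1).core x.2 := fun hh => hlink.notMem_left (hh ▸ hz)
    have h3 : z ≠ (g x'.1).core x'.2 := fun hh => hlink.notMem_right (hh ▸ hz)
    have hout : ∀ B : Finset V, Disjoint B F → z ∈ B → z ∉ F := fun _ hB hzB =>
      Finset.disjoint_left.1 hB hzB
    have h4 := hout _ (ball_disjoint (G := G) (hIF x (Or.inl rfl)) (m * 2 ^ H + 32 * Λ ^ 3))
    have h5 := hout _ (ball_disjoint (G := G) (hIF x' (Or.inr rfl)) (m * 2 ^ H))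
    rcases h1 with ((h1 | h1) | h1) | (h1 | (h1 | h1))
    · exact absurd h1 h2
    · exact Or.inl h1
    · exact Or.inr (Or.inr (h4 h1))
    · exact Or.inr (Or.inr (h5 h1))
    · exact absurd h1 h3
    · exact Or.inr (Or.inl h1)
  have hpartX : ∀ l : ι × ℕ, l.2 < K → ∀ z ∈ (g l.1).part l.2, z ∉ W := by
    intro l hl z hz hzW
    exact Finset.disjoint_left.1 (hWX l.1) hzW
      (Finset.mem_biUnion.2 ⟨_, Finset.mem_range.2 hl, hz⟩)
  refine ⟨n, by omega, S, hlink, ?_, ?_⟩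
  · rw [Finset.disjoint_left]
    intro z hz hzW
    rcases hSmem z hz with h1 | h1 | h1
    · exact hpartX x hxK z h1 hzW
    · exact hpartX x' hxK' z h1 hzW
    · exact h1 ((hFmem z).2 ⟨Or.inr (Or.inr hzW), fun hh => hpartX x hxK z hh hzW,
        fun hh => hpartX x' hxK' z hh hzW⟩)
  · intro z hz l hl hzl
    rcases hSmem z hz with h1 | h1 | h1
    · exact Or.inl (part_eq_of_mem hg hd hl hxK hzl h1)
    · exact Or.inr (part_eq_of_mem hg hd hl hxK' hzl h1)
    · by_contra! hcon
      exact h1 ((hFmem z).2 ⟨Or.inr (Or.inl ((hmemX z).2 ⟨l, hl, hzl⟩)),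
        fun hh => hcon.1 (part_eq_of_mem hg hd hl hxK hzl hh),
        fun hh => hcon.2 (part_eq_of_mem hg hd hl hxK' hzl hh)⟩)

theorem IsGoodExpander.exists_hubSystem (h : IsGoodExpander G H y₀ δ Λ) (hH : 0 < H)
    (hy : y₀ ≤ y) (hy0 : 0 < y) (hI : IsPortSystem G I D r₀) (hD : y ^ H ≤ D) [Fintype ι]
    (hg : ∀ i, IsGadget G I Z K s r (g i)) (hs : 0 < s) (hK : 2 ≤ K)
    (hd : ∀ i j, i ≠ j → Disjoint ((g i).body K) ((g j).body K)) {c : T → V} {R ρ : ℕ}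
    (hcI : ∀ t, I t ⊆ ball G Z {c t} R)
    (hcd : ∀ t t', t ≠ t' → Disjoint (ball G Z {c t} ρ) (ball G Z {c t'} ρ))
    (hρ : R + m * 2 ^ H + 1 ≤ ρ) {L w : ℕ} (hL : L = 2 * r + 2 * (m * 2 ^ H) + 32 * Λ ^ 3)
    (herr : Z.card + Fintype.card ι * (K * s) + (L + 1) * w ≤ y ^ (H - 1))
    (hn : (y + m) ^ (2 * H) ≤ Fintype.card V)
    (hF : 16 * Λ ^ 2 * (Z.card + Fintype.card ι * (K * (s + D)) + (L + 1) * w) ≤ (y + m) ^ H) :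
    Nonempty (HubSystem G ι K L w) := by
  let lab : V → Option (ι × ℕ) := fun z =>
    if hz : ∃ l : ι × ℕ, l.2 < K ∧ z ∈ (g l.1).part l.2 then some hz.choose else none
  have hlab : ∀ z l, lab z = some l ↔ l.2 < K ∧ z ∈ (g l.1).part l.2 := by
    intro z l
    by_cases hz : ∃ l : ι × ℕ, l.2 < K ∧ z ∈ (g l.1).part l.2
    · have h1 : lab z = some hz.choose := dif_pos hz
      rw [h1, Option.some_inj]
      refine ⟨fun hh => hh ▸ hz.choose_spec, fun hh => ?_⟩
      exact part_eq_of_mem hg hd hz.choose_spec.1 hh.1 hz.choose_spec.2 hh.2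
    · have h1 : lab z = none := dif_neg hz
      rw [h1]
      exact ⟨fun hh => by simp at hh, fun hh => absurd ⟨l, hh⟩ hz⟩
  have hcore : ∀ l : ι × ℕ, (g l.1).core l.2 = if (if l.2 < 4 then 1 else 0) = 0
      then (g l.1).v else (g l.1).w := by
    intro l
    by_cases hl : l.2 < 4 <;> simp [Gadget.core, hl]
  have key : ∀ x y : ι × ℕ, ∃ n, x.1 ≠ y.1 → 2 ≤ x.2 → x.2 < K → 2 ≤ y.2 → y.2 < K → n ≤ L ∧
      ∀ W : Finset V, W.card ≤ w → (∀ z ∈ W, lab z = none) →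
        ∃ S, Link G ((g x.1).core x.2) ((g y.1).core y.2) n S ∧ Disjoint S W ∧
          ∀ z ∈ S, ∀ l, lab z = some l → l = x ∨ l = y := by
    intro x x'
    by_cases hxx : x.1 ≠ x'.1 ∧ 2 ≤ x.2 ∧ x.2 < K ∧ 2 ≤ x'.2 ∧ x'.2 < K
    · obtain ⟨h1, h2, h3, h4, h5⟩ := hxx
      obtain ⟨n, hnL, hrob⟩ := exists_robust_length
        (fun n W => ∃ S, Link G ((g x.1).core x.2) ((g x'.1).core x'.2) n S ∧ Disjoint S W ∧
          ∀ z ∈ S, ∀ l, lab z = some l → l = x ∨ l = x')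
        (fun n W W' hWW' hW' => by
          obtain ⟨S, h6, h7, h8⟩ := hW'
          exact ⟨S, h6, h7.mono_right hWW', h8⟩)
        (Finset.univ.filter fun z => lab z ≠ none) L w (by
          intro W hW hWX
          obtain ⟨n, hn', S, h6, h7, h8⟩ := h.exists_link_of_parts hH hy hy0 hI hD hg hs hd hcI hcd
            hρ herr hn hF h1 h2 h3 h4 h5 hW (fun i => by
              refine hWX.mono_right fun z hz => ?_
              rw [Gadget.body, Finset.mem_biUnion] at hz
              obtain ⟨e, he, hz⟩ := hz
              have h9 := (hlab z (i, e)).2 ⟨Finset.mem_range.1 he, hz⟩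
              simp [h9])
          exact ⟨n, hL ▸ hn', S, h6, h7, fun z hz l hl =>
            h8 z hz l ((hlab z l).1 hl).1 ((hlab z l).1 hl).2⟩)
      refine ⟨n, fun _ _ _ _ _ => ⟨hnL, fun W hW hWl => hrob W hW ?_⟩⟩
      rw [Finset.disjoint_left]
      intro z hz hz'
      exact (Finset.mem_filter.1 hz').2 (hWl z hz)
    · exact ⟨0, fun h1 h2 h3 h4 h5 => absurd ⟨h1, h2, h3, h4, h5⟩ hxx⟩
  choose len hlen using key
  refine ⟨⟨lab, fun l => if l.2 = 0 then (g l.1).v else (g l.1).w, ?_, fun i => ?_, len,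
    fun x x' h1 h2 h3 h4 h5 => (hlen x x' h1 h2 h3 h4 h5).1, fun x x' h1 h2 h3 h4 h5 => ?_⟩⟩
  · rintro ⟨i, e⟩ he
    rw [hlab]
    refine ⟨lt_of_lt_of_le he hK, ?_⟩
    have : e = 0 ∨ e = 1 := by
      simp only at he
      omega
    rcases this with rfl | rfl
    · simp [(hg i).part_zero]
    · simp [(hg i).part_one]
  · simpa using (hg i).adj
  · have h6 := (hlen x x' h1 h2 h3 h4 h5).2
    rw [hcore, hcore] at h6
    exact h6

end Hubs

section Numerics

theorem hub_bounds {U A lam k s r L w K P N z D : ℕ} (hU : 10000 ≤ U) (hA : A + 1 ≤ U)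
    (hlam : lam ≤ U) (hk : k ≤ U) (hz : z ≤ U) (hs : s = A + lam + 1)
    (hr : r = s + 2 * (A + 1)) (hL : L = 2 * r + 2 * A + lam) (hK : K = k + 9)
    (hP : P = k * k * (4 * (L + 1) * L + 1))
    (hw : w = (k * k + 1) * (4 * (L + 1) * L + 2 * L + 1))
    (hN : N = 2 * k + P * ((L + 1) * ((2 * L + 2) * 2))) (hD : U ≤ D) :
    z + N * (K * s) + (L + 1) * w ≤ U ^ 13 ∧
      z + N * (K * (s + D)) + 1 + K * (s + D) + (L + 1) * w ≤ U ^ 12 * D := by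
  have hs' : s ≤ 2 * U := by omega
  have hL' : L + 1 ≤ 20 * U := by omega
  have hL2 : (L + 1) * L ≤ 400 * U ^ 2 := by nlinarith
  have hkk : k * k ≤ U ^ 2 := by nlinarith
  have hU1 : 10000 * U ^ 4 ≤ U ^ 5 := by
    rw [pow_succ' U 4]; exact Nat.mul_le_mul_right _ hU
  have hU2 : 1 ≤ U ^ 2 := Nat.one_le_pow _ _ (by omega)
  have hin : 4 * (L + 1) * L + 2 * L + 1 ≤ 2000 * U ^ 2 := by nlinarith
  have hw' : w ≤ U ^ 5 := by
    rw [hw]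
    calc (k * k + 1) * (4 * (L + 1) * L + 2 * L + 1) ≤ (2 * U ^ 2) * (2000 * U ^ 2) :=
          Nat.mul_le_mul (by omega) hin
      _ = 4000 * U ^ 4 := by ring
      _ ≤ U ^ 5 := by omega
  have hP' : P ≤ U ^ 5 := by
    rw [hP]
    calc k * k * (4 * (L + 1) * L + 1) ≤ U ^ 2 * (2000 * U ^ 2) :=
          Nat.mul_le_mul hkk (by omega)
      _ = 2000 * U ^ 4 := by ring
      _ ≤ U ^ 5 := by omega
  have hU3 : 10000 * U ^ 7 ≤ U ^ 8 := by
    rw [pow_succ' U 7]; exact Nat.mul_le_mul_right _ hU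
  have hU4 : U ≤ U ^ 7 := Nat.le_self_pow (by omega) _
  have hN' : N ≤ U ^ 8 := by
    have h1 : P * ((L + 1) * ((2 * L + 2) * 2)) ≤ U ^ 5 * (1600 * U ^ 2) :=
      Nat.mul_le_mul hP' (by nlinarith)
    have h2 : U ^ 5 * (1600 * U ^ 2) = 1600 * U ^ 7 := by ring
    omega
  have hK' : K ≤ 2 * U := by omega
  have hpos : 0 < U := by omega
  have hLw : (L + 1) * w ≤ 20 * U ^ 6 := by
    calc (L + 1) * w ≤ 20 * U * U ^ 5 := Nat.mul_le_mul hL' hw'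
      _ = 20 * U ^ 6 := by ring
  have hNK : N * K ≤ 2 * U ^ 9 := by
    calc N * K ≤ U ^ 8 * (2 * U) := Nat.mul_le_mul hN' hK'
      _ = 2 * U ^ 9 := by ring
  have hU5 : U ≤ U ^ 10 := Nat.le_self_pow (by omega) _
  have hU6 : U ^ 6 ≤ U ^ 10 := Nat.pow_le_pow_right hpos (by omega)
  have hU7 : 10000 * U ^ 10 ≤ U ^ 11 := by
    rw [pow_succ' U 10]; exact Nat.mul_le_mul_right _ hU
  have hU8 : U ^ 11 ≤ U ^ 13 := Nat.pow_le_pow_right hpos (by omega)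
  constructor
  · have h1 : N * (K * s) ≤ 4 * U ^ 10 := by
      calc N * (K * s) = N * K * s := by ring
        _ ≤ 2 * U ^ 9 * (2 * U) := Nat.mul_le_mul hNK hs'
        _ = 4 * U ^ 10 := by ring
    omega
  · have hsD : s + D ≤ 3 * D := by omega
    have h1 : N * (K * (s + D)) ≤ 6 * (U ^ 9 * D) := by
      calc N * (K * (s + D)) = N * K * (s + D) := by ring
        _ ≤ 2 * U ^ 9 * (3 * D) := Nat.mul_le_mul hNK hsD
        _ = 6 * (U ^ 9 * D) := by ring
    have h2 : K * (s + D) ≤ 6 * (U ^ 9 * D) := by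
      calc K * (s + D) ≤ 2 * U ^ 9 * (3 * D) := Nat.mul_le_mul (hK'.trans
            (Nat.mul_le_mul_left _ (Nat.le_self_pow (by omega) _))) hsD
        _ = 6 * (U ^ 9 * D) := by ring
    have h3 : U ^ 9 * U ≤ U ^ 9 * D := Nat.mul_le_mul_left _ hD
    have h4 : U ^ 9 * U = U ^ 10 := by ring
    have h5 : 10000 * (U ^ 9 * D) ≤ U ^ 12 * D := by
      rw [← mul_assoc]
      refine Nat.mul_le_mul_right _ ?_
      calc 10000 * U ^ 9 ≤ U * U ^ 9 := Nat.mul_le_mul_right _ hU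
        _ = U ^ 10 := by ring
        _ ≤ U ^ 12 := Nat.pow_le_pow_right hpos (by omega)
    omega

theorem hub_sizes {U D Q M z x y e p n f t : ℕ} (hU : 10000 ≤ U) (hUD : U ^ 14 ≤ D)
    (hM : M + 1 ≤ U) (hQ : 0 < Q) (hz : z ≤ U) (hb : z + x + 1 + y + e ≤ U ^ 12 * D)
    (hp : p ≤ D * Q) (hbig : 4 * (D * D * D) * Q * Q + U < n) (hf : f = z + x + 1 + y)
    (ht : t = (M + 1) * f) :
    0 < t ∧ t ≤ D * D ∧ M * f ≤ D * D ∧ M * (z + x + e) ≤ D * D ∧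
      (p + t * Q) * Q + z < n ∧ (p + t * D + x) * Q + z < n := by
  have hU0 : 0 < U := by omega
  have hU13 : U ^ 13 ≤ D := (Nat.pow_le_pow_right hU0 (by norm_num)).trans hUD
  have hU12 : U ^ 12 ≤ D := (Nat.pow_le_pow_right hU0 (by norm_num)).trans hUD
  have hD0 : 0 < D := (Nat.pow_pos hU0).trans_le hU13
  have hUU : ∀ v ≤ U ^ 12 * D, (M + 1) * v ≤ D * D := by
    intro v hv
    calc (M + 1) * v ≤ U * (U ^ 12 * D) := Nat.mul_le_mul hM hv
      _ = U ^ 13 * D := by ring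
      _ ≤ D * D := Nat.mul_le_mul_right _ hU13
  have hMM : ∀ v ≤ U ^ 12 * D, M * v ≤ D * D := fun v hv =>
    (Nat.mul_le_mul_right _ (Nat.le_succ M)).trans (hUU v hv)
  have htD : t ≤ D * D := ht ▸ hUU f (by omega)
  have h1 : D * Q ≤ D * D * D * Q := by
    refine Nat.mul_le_mul_right _ ?_
    rw [mul_assoc]
    exact Nat.le_mul_of_pos_right _ (by positivity)
  have h2 : t * Q ≤ D * D * D * Q :=
    Nat.mul_le_mul_right _ (htD.trans (Nat.le_mul_of_pos_right _ hD0))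
  have h3 : t * D ≤ D * D * D * Q :=
    (Nat.mul_le_mul_right _ htD).trans (Nat.le_mul_of_pos_right _ hQ)
  have h4 : x ≤ D * D * D * Q := by
    have h5 : x ≤ U ^ 12 * D := by omega
    refine h5.trans (le_trans (Nat.mul_le_mul_right _ ?_) (Nat.le_mul_of_pos_right _ hQ))
    exact hU12.trans (Nat.le_mul_of_pos_right _ hD0)
  have h6 : 4 * (D * D * D) * Q = 4 * (D * D * D * Q) := by ring
  refine ⟨ht ▸ Nat.mul_pos (by omega) (by omega), htD, hMM _ (by omega), hMM _ (by omega), ?_, ?_⟩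
  · refine lt_of_le_of_lt (Nat.add_le_add ?_ hz) hbig
    exact Nat.mul_le_mul_right _ (by omega)
  · refine lt_of_le_of_lt (Nat.add_le_add ?_ hz) hbig
    exact Nat.mul_le_mul_right _ (by omega)

theorem hitting_size {U z ρ x : ℕ} (hU : 10000 ≤ U) (hz : z ≤ U) (hρ : ρ + 2 ≤ U) (hx : x ≤ U) :
    z * z * (2 * ρ + 3) * (8 * (ρ + 1) * x) < U ^ 6 := by
  have h1 : z * z * (2 * ρ + 3) * (8 * (ρ + 1) * x) ≤ U * U * (2 * U) * (8 * U * U) :=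
    Nat.mul_le_mul (Nat.mul_le_mul (Nat.mul_le_mul hz hz) (by omega))
      (Nat.mul_le_mul (Nat.mul_le_mul_left _ (by omega)) hx)
  have h2 : U * U * (2 * U) * (8 * U * U) = 16 * U ^ 5 := by ring
  have h3 : 10000 * U ^ 5 ≤ U ^ 6 := by
    rw [pow_succ' U 5]
    exact Nat.mul_le_mul_right _ hU
  have h4 : 0 < U ^ 5 := Nat.pow_pos (by omega)
  omega

theorem scale_bound {U D Q μ H C n : ℕ} (hU : U = μ ^ C) (hD : D = μ ^ H) (hUD : U ≤ D)
    (hU5 : 5 ≤ U) (hQ0 : 0 < Q) (hQ : Q ≤ U ^ μ ^ 4) (hμ : 0 < μ)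
    (hn : μ ^ (6 * H + 2 * C * μ ^ 4) < n) : 4 * (D * D * D) * Q * Q + U < n := by
  have hD0 : 0 < D := by omega
  obtain ⟨W, hW⟩ : ∃ W, W = U ^ μ ^ 4 := ⟨_, rfl⟩
  rw [← hW] at hQ
  have hW2 : D * (D * D * D * (W * W)) = μ ^ (4 * H + 2 * C * μ ^ 4) := by
    rw [hW, hU, hD, ← pow_mul, ← pow_add, ← pow_add, ← pow_add, ← pow_add, ← pow_add]
    congr 1
    ring
  have h1 : D * D * D * (Q * Q) ≤ D * D * D * (W * W) :=
    Nat.mul_le_mul_left _ (Nat.mul_le_mul hQ hQ)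
  have h2 : D ≤ D * D * D * (Q * Q) := by
    rw [mul_assoc, mul_assoc]
    exact Nat.le_mul_of_pos_right _ (by positivity)
  calc 4 * (D * D * D) * Q * Q + U = 4 * (D * D * D * (Q * Q)) + U := by ring
    _ ≤ 5 * (D * D * D * (Q * Q)) := by omega
    _ ≤ D * (D * D * D * (W * W)) := Nat.mul_le_mul (hU5.trans hUD) h1
    _ = μ ^ (4 * H + 2 * C * μ ^ 4) := hW2
    _ ≤ μ ^ (6 * H + 2 * C * μ ^ 4) := Nat.pow_le_pow_right hμ (by omega)
    _ < n := hn

end Numerics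

section Sparse
open scoped Classical
variable [Fintype V] {G : SimpleGraph V}

/-- The hub construction, with all the bounds on the sizes involved given in terms of two scales
`U` and `D`. -/
theorem IsGoodExpander.exists_of_scales {H y₀ δ Λ q β μ m k U D Q A Δ ρ s₀ : ℕ}
    (h : IsGoodExpander G H y₀ δ Λ) {Z P : Finset V} (hq : 0 < q) (hH0 : 0 < H) (hβ : y₀ ≤ β)
    (hβ0 : 0 < β) (hμ : y₀ ≤ μ) (hμ0 : 0 < μ) (hA : A = m * 2 ^ H) (hρ : ρ = 2 * A + 3)
    (hU : 10000 ≤ U) (hAU : A + 1 ≤ U) (hΛ : 32 * Λ ^ 3 ≤ U) (hk : k ≤ U) (hZ : Z.card ≤ U)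
    (hΔ : ∀ v, v ∉ Z → (nbr G {v}).card ≤ Δ)
    (hP : ∀ v, v ∉ Z → ∀ r ≤ ρ, Disjoint (ball G Z {v} r) P →
      (nbr G (ball G Z {v} r) ∩ Z).card ≤ s₀ * (r + 1) ^ q)
    (hδ : β ^ H + (s₀ + 1 + (k + 9)) * 3 ^ q ≤ δ)
    (herr : ∀ i, (s₀ + 1 + (k + 9)) * (i + 3) ^ q ≤ (β + i / 2 ^ H) ^ (H - 1))
    (hD : D = μ ^ H) (hUD : U ^ 14 ≤ D) (hDβ : D * D ≤ (β + m) ^ H) (hDμ : D * D ≤ (μ + m) ^ H)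
    (hcβ : (β + m) ^ (2 * H) ≤ Fintype.card V) (hcμ : (μ + m) ^ (2 * H) ≤ Fintype.card V)
    (hUH : U ^ 13 ≤ μ ^ (H - 1)) (hQ : Q = (Δ + 1) ^ ρ) (hPD : P.card ≤ D * Q)
    (hbig : 4 * (D * D * D) * Q * Q + U < Fintype.card V) : ∃ ℓ, ContainsBalSub G k ℓ := by
  have hΛ2 := h.two_le
  have hM : 16 * Λ ^ 2 + 1 ≤ U := by
    refine le_trans ?_ hΛ
    have h1 : 4 ≤ Λ ^ 2 := by nlinarith
    have h2 : 2 * Λ ^ 2 ≤ Λ ^ 3 := by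
      rw [pow_succ' Λ 2]
      exact Nat.mul_le_mul_right _ hΛ2
    omega
  have hU0 : 0 < U := by omega
  have hUleD : U ≤ D := (Nat.le_self_pow (by norm_num) U).trans hUD
  have hD0 : 0 < D := hU0.trans_le hUleD
  have hQ0 : 0 < Q := hQ ▸ Nat.pow_pos (Nat.succ_pos Δ)
  have hm1 : m * 2 ^ H + 1 ≤ ρ := by omega
  have hm3 : m * 2 ^ H + 3 ≤ ρ := by omega
  have hm2 : m * 2 ^ H + 1 + m * 2 ^ H + 1 ≤ ρ := by omega
  obtain ⟨s, hs⟩ : ∃ s, s = m * 2 ^ H + 32 * Λ ^ 3 + 1 := ⟨_, rfl⟩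
  obtain ⟨r, hr⟩ : ∃ r, r = s + 2 * (m * 2 ^ H + 1) := ⟨_, rfl⟩
  obtain ⟨L, hL⟩ : ∃ L, L = 2 * r + 2 * (m * 2 ^ H) + 32 * Λ ^ 3 := ⟨_, rfl⟩
  obtain ⟨K, hK⟩ : ∃ K, K = k + 9 := ⟨_, rfl⟩
  have hs0 : 0 < s := hs ▸ Nat.succ_pos _
  have hK4 : 4 ≤ K := by omega
  obtain ⟨p, hp⟩ : ∃ p, p = k * k * (4 * (L + 1) * L + 1) := ⟨_, rfl⟩
  obtain ⟨w, hw⟩ : ∃ w, w = (k * k + 1) * (4 * (L + 1) * L + 2 * L + 1) := ⟨_, rfl⟩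
  obtain ⟨N, hN⟩ : ∃ N, N = 2 * k + p * ((L + 1) * ((2 * L + 2) * 2)) := ⟨_, rfl⟩
  have hNcard :
      Fintype.card (Fin (2 * k) ⊕ (Fin p × Fin (L + 1) × Fin (2 * L + 2) × Bool)) = N := by
    simp [hN]
  obtain ⟨hb1, hb2⟩ := hub_bounds (z := Z.card) hU (hA ▸ hAU) hΛ hk hZ hs hr hL hK hp hw hN hUleD
  obtain ⟨f, hf⟩ : ∃ f, f = Z.card + N * (K * (s + D)) + 1 + K * (s + D) := ⟨_, rfl⟩
  obtain ⟨t, ht⟩ : ∃ t, t = (16 * Λ ^ 2 + 1) * f := ⟨_, rfl⟩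
  obtain ⟨ht0, htD, hfD, heD, hfar₁, hfar₂⟩ := hub_sizes hU hUD hM hQ0 hZ hb2 hPD hbig hf ht
  clear hb2
  rw [← hK] at hδ herr
  have : Nonempty (Fin t) := ⟨⟨0, ht0⟩⟩
  have hδ' : β ^ H + s₀ ≤ δ := by
    refine le_trans (Nat.add_le_add_left ?_ _) hδ
    refine le_trans ?_ (Nat.le_mul_of_pos_right _ (by positivity))
    rw [add_assoc]
    exact Nat.le_add_right _ _
  obtain ⟨c, I, hI, hcZ, hIc, hcd⟩ := h.exists_ports (T := Fin t) (m := m) (D := D) (P := P)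
    (ρ := ρ) hH0 hβ hβ0 hΔ hP hδ'
    (fun i _ => le_trans (Nat.mul_le_mul (by rw [add_assoc]; exact Nat.le_add_right _ _)
      (Nat.pow_le_pow_left (Nat.le_succ _) _)) (herr i))
    hcβ hD0 (le_trans (Nat.le_mul_of_pos_right _ hD0) hDβ) hm1
    (by rw [Fintype.card_fin, ← hQ]; exact hfar₁)
  have hlegs : LegBounds (Fintype.card V) Λ δ H q (Fintype.card (Fin t)) β m (s₀ + 1 + K) f :=
    ⟨hδ, fun i _ => herr i, hcβ, hfD.trans hDβ, by rw [Fintype.card_fin, ht]⟩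
  obtain ⟨g, hg, hgd⟩ := h.exists_gadgets (P := P) (ρ := ρ) (K := K) (s := s)
    (s₀ := s₀) hI hD0 hH0 hβ hβ0 hq hlegs hΔ hP hm3 le_rfl hs hK4
    (Fin (2 * k) ⊕ (Fin p × Fin (L + 1) × Fin (2 * L + 2) × Bool)) (by rw [hNcard, hf])
    (by rw [hNcard, Fintype.card_fin, ← hQ]; exact hfar₂)
  rw [← hr] at hg
  obtain ⟨S⟩ := h.exists_hubSystem (y := μ) (m := m) (L := L) (w := w) hH0 hμ hμ0
    hI hD.ge hg hs0 ((by norm_num : 2 ≤ 4).trans hK4) hgd hIc hcd hm2 hL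
    (by rw [hNcard]; exact hb1.trans hUH) hcμ (by rw [hNcard]; exact heD.trans hDμ)
  exact S.exists_containsBalSub h.bip hp hK.ge hw.ge

/-- If few vertices have large degree then the hub construction applies. -/
theorem IsGoodExpander.exists_of_sparse {H y₀ δ Λ a j β μ C Δ : ℕ}
    (h : IsGoodExpander G H y₀ δ Λ) {Z : Finset V} (ha : 0 < a) (hj : 0 < j) (hβ : y₀ ≤ β)
    (hβ0 : 0 < β) (hβμ : β ≤ μ) (hμ : 10000 ≤ μ) (hC : 4 ≤ C) (hH : 14 * C ≤ H) (hτ : 2 ^ H ≤ μ)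
    (hδ : β ^ H + (j ^ (2 * a + 1) * 16 ^ (2 * a + 2) + 1 + (j ^ a + 9)) * 3 ^ (2 * a + 2) ≤ δ)
    (herr : ∀ i, (j ^ (2 * a + 1) * 16 ^ (2 * a + 2) + 1 + (j ^ a + 9)) * (i + 3) ^ (2 * a + 2) ≤
      (β + i / 2 ^ H) ^ (H - 1))
    (hZ : Z.card ≤ μ ^ C) (hΔ : ∀ v, v ∉ Z → (nbr G {v}).card ≤ Δ) (hΔC : Δ + 1 ≤ μ ^ C)
    (hΛ : 32 * Λ ^ 3 ≤ μ ^ C) (hs₀ : j ^ (2 * a + 1) * 16 ^ (2 * a + 2) ≤ μ ^ C)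
    (hn : μ ^ (6 * H + 2 * C * μ ^ 4) < Fintype.card V) :
    ∃ ℓ, ContainsBalSub G (j ^ a) ℓ := by
  have hμ0 : 0 < μ := by omega
  have hH0 : 0 < H := by omega
  obtain ⟨U, hU⟩ : ∃ U, U = μ ^ C := ⟨_, rfl⟩
  obtain ⟨D, hD⟩ : ∃ D, D = μ ^ H := ⟨_, rfl⟩
  have hμ4U : μ ^ 4 ≤ U := hU ▸ Nat.pow_le_pow_right hμ0 hC
  have hμU : μ ≤ U := (Nat.le_self_pow (by norm_num) μ).trans hμ4U
  have hU0 : 10000 ≤ U := hμ.trans hμU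
  have hUpow : ∀ e, e ≤ 14 → C * e ≤ H := fun e he =>
    (Nat.mul_le_mul_left C he).trans (mul_comm C 14 ▸ hH)
  have hUD : U ^ 14 ≤ D := by
    rw [hU, hD, ← pow_mul]
    exact Nat.pow_le_pow_right hμ0 (hUpow 14 le_rfl)
  have hUH : U ^ 13 ≤ μ ^ (H - 1) := by
    rw [hU, ← pow_mul]
    exact Nat.pow_le_pow_right hμ0 (by omega)
  have hUleD : U ≤ D := (Nat.le_self_pow (by norm_num) U).trans hUD
  have hDD : ∀ x, D * D ≤ (x + μ ^ 2) ^ H := by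
    intro x
    calc D * D = (μ ^ 2) ^ H := by rw [hD]; ring
      _ ≤ _ := Nat.pow_le_pow_left (Nat.le_add_left _ _) _
  have hcard : ∀ x ≤ μ, (x + μ ^ 2) ^ (2 * H) ≤ Fintype.card V := by
    intro x hx
    have h3 : x + μ ^ 2 ≤ μ ^ 3 := by nlinarith
    calc (x + μ ^ 2) ^ (2 * H) ≤ (μ ^ 3) ^ (2 * H) := Nat.pow_le_pow_left h3 _
      _ = μ ^ (6 * H) := by rw [← pow_mul]; congr 1; ring
      _ ≤ μ ^ (6 * H + 2 * C * μ ^ 4) := Nat.pow_le_pow_right hμ0 (Nat.le_add_right _ _)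
      _ ≤ _ := hn.le
  obtain ⟨A, hA⟩ : ∃ A, A = μ ^ 2 * 2 ^ H := ⟨_, rfl⟩
  have hAμ : A ≤ μ ^ 3 := by
    rw [hA, pow_succ μ 2]
    exact Nat.mul_le_mul_left _ hτ
  have hμ34 : 10000 * μ ^ 3 ≤ μ ^ 4 := by
    rw [pow_succ' μ 3]
    exact Nat.mul_le_mul_right _ hμ
  have hμ3 : 0 < μ ^ 3 := by positivity
  obtain ⟨ρ, hρ⟩ : ∃ ρ, ρ = 2 * A + 3 := ⟨_, rfl⟩
  have hρμ : ρ + 2 ≤ μ ^ 4 := by clear hA hn herr hcard; omega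
  have hAU : A + 1 ≤ U := by clear hA hn herr hcard; omega
  obtain ⟨Q, hQ⟩ : ∃ Q, Q = (Δ + 1) ^ ρ := ⟨_, rfl⟩
  have hQU : Q ≤ U ^ μ ^ 4 := by
    rw [hQ]
    refine (Nat.pow_le_pow_left (hU ▸ hΔC) _).trans (Nat.pow_le_pow_right (by omega) ?_)
    exact (Nat.le_add_right _ _).trans hρμ
  have hQ0 : 0 < Q := hQ ▸ Nat.pow_pos (Nat.succ_pos Δ)
  rw [← hU] at hZ hΔC hΛ hs₀
  have hjs : ∀ e ≤ 2 * a + 1, j ^ e ≤ U := fun e he =>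
    ((Nat.pow_le_pow_right hj he).trans (Nat.le_mul_of_pos_right _ (by positivity))).trans hs₀
  rcases exists_of_pieces_or_hit (R := ρ) (N := U ^ 6) ha hj hΔ
    (hitting_size hU0 hZ (hρμ.trans hμ4U) (hjs (2 * a) (by omega))) with hdone | ⟨P, hPc, hP⟩
  · exact hdone
  rw [← hQ] at hPc
  refine h.exists_of_scales (m := μ ^ 2) (P := P) (ρ := ρ) (by omega) hH0 hβ hβ0 (hβ.trans hβμ) hμ0
    hA hρ hU0 hAU hΛ (hjs a (by omega)) hZ hΔ
    (fun v hv r hr hd => (card_nbr_ball_inter_lt hP hv hr hd).le) hδ herr hD hUD (hDD β) (hDD μ)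
    (hcard β hβμ) (hcard μ le_rfl) hUH hQ
    (hPc.trans (Nat.mul_le_mul_right _ ((Nat.pow_le_pow_right (by omega) (by norm_num)).trans hUD)))
    (scale_bound hU hD hUleD (by omega) hQ0 hQU hμ0 hn)

end Sparse

section Main
open scoped Classical
variable [Fintype V] {G : SimpleGraph V}

theorem exists_pow_le_lt (e : ℕ) (he : 0 < e) (x : ℝ) {b : ℕ} (hb : (b : ℝ) ^ e ≤ x) :
    ∃ β : ℕ, b ≤ β ∧ (β : ℝ) ^ e ≤ x ∧ x < ((β : ℝ) + 1) ^ e := by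
  have hex : ∃ m : ℕ, x < ((m : ℝ) + 1) ^ e := by
    obtain ⟨m, hm⟩ := exists_nat_gt x
    refine ⟨m, hm.trans_le ?_⟩
    have h1 : (1 : ℝ) ≤ (m : ℝ) + 1 := by linarith [Nat.cast_nonneg (α := ℝ) m]
    exact (le_add_of_nonneg_right zero_le_one).trans (le_self_pow₀ h1 he.ne')
  have hspec := Nat.find_spec hex
  have hbβ : b ≤ Nat.find hex := by
    by_contra! hlt
    have h1 : ((Nat.find hex : ℝ) + 1) ^ e ≤ (b : ℝ) ^ e := by
      have : (Nat.find hex : ℝ) + 1 ≤ b := by exact_mod_cast hlt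
      exact pow_le_pow_left₀ (by positivity) this _
    linarith
  refine ⟨Nat.find hex, hbβ, ?_, hspec⟩
  rcases Nat.eq_zero_or_pos (Nat.find hex) with h0 | h0
  · rw [h0] at hbβ ⊢
    rwa [Nat.le_zero.1 hbβ] at hb
  · have h1 := Nat.find_min hex (Nat.sub_lt h0 one_pos)
    push Not at h1
    rwa [Nat.cast_pred h0, sub_add_cancel] at h1

theorem layer_error_bound {a B β τ i : ℕ} (hB : 2 * a + 4 ≤ B) (hτ : 0 < τ)
    (hβ : 16 ^ (2 * a + 3) * (4 * τ) ^ (2 * a + 2) ≤ β) :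
    ((β ^ B) ^ (2 * a + 1) * 16 ^ (2 * a + 2) + 1 + ((β ^ B) ^ a + 9)) * (i + 3) ^ (2 * a + 2) ≤
      (β + i / τ) ^ ((2 * a + 2) * B - 1) := by
  obtain ⟨j, hj⟩ : ∃ j, j = β ^ B := ⟨_, rfl⟩
  have hβ0 : 0 < β := lt_of_lt_of_le (by positivity) hβ
  have hj0 : 0 < j := hj ▸ Nat.pow_pos hβ0
  obtain ⟨u, hu⟩ : ∃ u, u = i / τ := ⟨_, rfl⟩
  have hi : i + 3 ≤ 4 * τ * (u + 1) := by
    have h1 : i < τ * (u + 1) := hu ▸ Nat.lt_mul_div_succ i hτ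
    have h2 : 4 * τ * (u + 1) = 4 * (τ * (u + 1)) := by ring
    omega
  have hE : j ^ (2 * a + 1) * 16 ^ (2 * a + 2) + 1 + (j ^ a + 9) ≤
      j ^ (2 * a + 1) * 16 ^ (2 * a + 3) := by
    have h1 : j ^ a ≤ j ^ (2 * a + 1) := Nat.pow_le_pow_right hj0 (by omega)
    have h2 : 0 < j ^ (2 * a + 1) := Nat.pow_pos hj0
    have h3 : j ^ (2 * a + 1) ≤ j ^ (2 * a + 1) * 16 ^ (2 * a + 2) :=
      Nat.le_mul_of_pos_right _ (by positivity)
    have h4 : j ^ (2 * a + 1) * 16 ^ (2 * a + 3) = 16 * (j ^ (2 * a + 1) * 16 ^ (2 * a + 2)) := by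
      ring
    rw [h4]
    generalize j ^ (2 * a + 1) * 16 ^ (2 * a + 2) = x at *
    omega
  have hexp : (2 * a + 2) * B - 1 = B * (2 * a + 1) + ((2 * a + 2) + (B - (2 * a + 3))) := by
    have h1 : (2 * a + 2) * B = B * (2 * a + 1) + B := by ring
    omega
  rw [← hj, ← hu, hexp, pow_add (β + u), pow_add (β + u)]
  calc (j ^ (2 * a + 1) * 16 ^ (2 * a + 2) + 1 + (j ^ a + 9)) * (i + 3) ^ (2 * a + 2)
      ≤ j ^ (2 * a + 1) * 16 ^ (2 * a + 3) * (4 * τ * (u + 1)) ^ (2 * a + 2) :=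
        Nat.mul_le_mul hE (Nat.pow_le_pow_left hi _)
    _ = j ^ (2 * a + 1) * ((u + 1) ^ (2 * a + 2) *
          (16 ^ (2 * a + 3) * (4 * τ) ^ (2 * a + 2))) := by
        rw [mul_pow (4 * τ)]
        ring
    _ ≤ (β + u) ^ (B * (2 * a + 1)) *
          ((β + u) ^ (2 * a + 2) * (β + u) ^ (B - (2 * a + 3))) := by
        refine Nat.mul_le_mul ?_ (Nat.mul_le_mul (Nat.pow_le_pow_left (by omega) _) ?_)
        · rw [hj, ← pow_mul]
          exact Nat.pow_le_pow_left (Nat.le_add_right _ _) _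
        · refine hβ.trans ((Nat.le_add_right _ _).trans (Nat.le_self_pow (by omega) _))

theorem card_scale_lt {μ H C Λ n : ℕ} (hμ : 6 * H + 2 * C + 2 ≤ μ) (hΛ : μ ^ 8 ≤ Λ)
    (hn : 2 ^ (Λ - 2) ≤ n) : μ ^ (6 * H + 2 * C * μ ^ 4) < n := by
  have h0 : 2 ≤ μ := by omega
  have h4 : 0 < μ ^ 4 := Nat.pow_pos (by omega)
  have h1 : μ * (6 * H + 2 * C * μ ^ 4) ≤ μ ^ 6 := by
    have h5 : 6 * H ≤ 6 * H * μ ^ 4 := Nat.le_mul_of_pos_right _ h4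
    calc μ * (6 * H + 2 * C * μ ^ 4) ≤ μ * (6 * H * μ ^ 4 + 2 * C * μ ^ 4) :=
          Nat.mul_le_mul_left _ (Nat.add_le_add_right h5 _)
      _ = μ * ((6 * H + 2 * C) * μ ^ 4) := by ring
      _ ≤ μ * (μ * μ ^ 4) := Nat.mul_le_mul_left _ (Nat.mul_le_mul_right _ (by omega))
      _ = μ ^ 6 := by ring
  have h6 : μ ^ 6 < Λ - 2 := by
    have h7 : 4 * μ ^ 6 ≤ μ ^ 8 := by
      have : 4 ≤ μ ^ 2 := Nat.pow_le_pow_left h0 2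
      calc 4 * μ ^ 6 ≤ μ ^ 2 * μ ^ 6 := Nat.mul_le_mul_right _ this
        _ = μ ^ 8 := by ring
    have h8 : 0 < μ ^ 6 := Nat.pow_pos (by omega)
    omega
  calc μ ^ (6 * H + 2 * C * μ ^ 4) ≤ (2 ^ μ) ^ (6 * H + 2 * C * μ ^ 4) :=
        Nat.pow_le_pow_left Nat.lt_two_pow_self.le _
    _ = 2 ^ (μ * (6 * H + 2 * C * μ ^ 4)) := by rw [← pow_mul]
    _ ≤ 2 ^ μ ^ 6 := Nat.pow_le_pow_right (by norm_num) h1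
    _ < 2 ^ (Λ - 2) := Nat.pow_lt_pow_right (by norm_num) h6
    _ ≤ n := hn

theorem log_scale_bounds {μ Λ L : ℕ} (hμ : 10000 ≤ μ) (hΛ : Λ ≤ (μ + 1) ^ 8)
    (hL : L = 32 * Λ ^ 3 + 2) :
    L + 1 ≤ μ ^ 28 ∧ 8 * L ≤ μ ^ 29 ∧ 16 * Λ ^ 2 + 1 ≤ μ ^ 19 := by
  have h1 : Λ ≤ μ ^ 9 := by
    calc Λ ≤ (μ + 1) ^ 8 := hΛ
      _ ≤ (2 * μ) ^ 8 := Nat.pow_le_pow_left (by omega) _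
      _ = 256 * μ ^ 8 := by ring
      _ ≤ μ * μ ^ 8 := Nat.mul_le_mul_right _ (by omega)
      _ = μ ^ 9 := by ring
  have h27 : Λ ^ 3 ≤ μ ^ 27 := (Nat.pow_le_pow_left h1 3).trans_eq (by ring)
  have h18 : Λ ^ 2 ≤ μ ^ 18 := (Nat.pow_le_pow_left h1 2).trans_eq (by ring)
  have h28 : 10000 * μ ^ 27 ≤ μ ^ 28 := by
    rw [pow_succ' μ 27]; exact Nat.mul_le_mul_right _ hμ
  have h29 : 10000 * μ ^ 28 ≤ μ ^ 29 := by
    rw [pow_succ' μ 28]; exact Nat.mul_le_mul_right _ hμ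
  have h19 : 10000 * μ ^ 18 ≤ μ ^ 19 := by
    rw [pow_succ' μ 18]; exact Nat.mul_le_mul_right _ hμ
  have p27 : 0 < μ ^ 27 := Nat.pow_pos (by omega)
  have p18 : 0 < μ ^ 18 := Nat.pow_pos (by omega)
  generalize μ ^ 29 = x29 at *
  generalize μ ^ 28 = x28 at *
  generalize μ ^ 27 = x27 at *
  generalize μ ^ 19 = x19 at *
  generalize μ ^ 18 = x18 at *
  generalize Λ ^ 3 = y3 at *
  generalize Λ ^ 2 = y2 at *
  refine ⟨?_, ?_, ?_⟩ <;> omega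

/-- Every good expander of large minimum degree `4 * β ^ H` contains a balanced subdivision whose
order is a power of the minimum degree slightly below `1 / 2`. -/
theorem IsGoodExpander.exists_containsBalSub {a C H B y₀ β μ Λ : ℕ} (ha : 0 < a)
    (hC : C = 29 * (2 * a + 2) * (2 * a + 3) + 100) (hB : B = 14 * C) (hH : H = (2 * a + 2) * B)
    (h : IsGoodExpander G H y₀ (4 * β ^ H) Λ) (hn : 2 ^ (Λ - 2) ≤ Fintype.card V)
    (hμ : 10000 ≤ μ) (hμH : 6 * H + 2 * C + 2 ≤ μ) (hτ : 2 ^ H ≤ μ) (hΛμ : μ ^ 8 ≤ Λ)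
    (hμΛ : Λ ≤ (μ + 1) ^ 8) (hβ : y₀ ≤ β)
    (hβ' : 16 ^ (2 * a + 3) * (4 * 2 ^ H) ^ (2 * a + 2) ≤ β) :
    ∃ ℓ, ContainsBalSub G ((β ^ B) ^ a) ℓ := by
  have hβ0 : 0 < β := lt_of_lt_of_le (by positivity) hβ'
  have hμ0 : 0 < μ := by omega
  obtain ⟨L, hL⟩ : ∃ L, L = 32 * Λ ^ 3 + 2 := ⟨_, rfl⟩
  obtain ⟨hL1, hL8, hΛ2⟩ := log_scale_bounds hμ hμΛ hL
  obtain ⟨j, hj⟩ : ∃ j, j = β ^ B := ⟨_, rfl⟩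
  have hj0 : 0 < j := hj ▸ Nat.pow_pos hβ0
  have hjH : β ^ H = j ^ (2 * a + 2) := by rw [hj, hH, ← pow_mul, mul_comm]
  obtain ⟨ω, hω⟩ : ∃ ω, ω = (L + 1) * (4 * L * j ^ (2 * a)) := ⟨_, rfl⟩
  obtain ⟨Δ, hΔ⟩ : ∃ Δ, Δ = 16 * Λ ^ 2 * ω + ω := ⟨_, rfl⟩
  have hΔj : Δ ≤ μ ^ 76 * j ^ (2 * a) := by
    calc Δ = (16 * Λ ^ 2 + 1) * ((L + 1) * (4 * L * j ^ (2 * a))) := by rw [hΔ, hω]; ring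
      _ ≤ μ ^ 19 * (μ ^ 28 * (μ ^ 29 * j ^ (2 * a))) :=
        Nat.mul_le_mul hΛ2 (Nat.mul_le_mul hL1 (Nat.mul_le_mul_right _ (by omega)))
      _ = μ ^ 76 * j ^ (2 * a) := by ring
  obtain ⟨Z, hZ⟩ : ∃ Z : Finset V, Z = Finset.univ.filter fun v => Δ < (nbr G {v}).card :=
    ⟨_, rfl⟩
  have hmem : ∀ v, v ∈ Z ↔ Δ < (nbr G {v}).card := by simp [hZ]
  rcases Nat.lt_or_ge Z.card (j ^ (2 * a + 1) * (8 * L) ^ (2 * a + 2)) with hZc | hZc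
  swap
  · rw [← hj]
    exact h.exists_of_large_degrees Z a j L ω ha hj0 hL hω (fun z hz => hΔ ▸ (hmem z).1 hz) hZc
  replace hZc : Z.card < j ^ (2 * a + 1) * μ ^ (29 * (2 * a + 2)) := by
    refine hZc.trans_le (Nat.mul_le_mul_left _ ?_)
    rw [pow_mul]
    exact Nat.pow_le_pow_left hL8 _
  have hjμ : j ≤ μ ^ (29 * (2 * a + 2)) := by
    by_cases hv : ∃ v, v ∉ Z
    · obtain ⟨v, hv⟩ := hv
      rw [hmem, not_lt] at hv
      have h1 : j ^ (2 * a) * (j * j) ≤ j ^ (2 * a) * (μ ^ 38 * μ ^ 38) := by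
        calc j ^ (2 * a) * (j * j) = β ^ H := by rw [hjH]; ring
          _ ≤ 4 * β ^ H := by omega
          _ ≤ μ ^ 76 * j ^ (2 * a) := ((h.le_degree v).trans hv).trans hΔj
          _ = _ := by ring
      have h2 : j ≤ μ ^ 38 := Nat.mul_self_le_mul_self_iff.1
        (Nat.le_of_mul_le_mul_left h1 (Nat.pow_pos hj0))
      exact h2.trans (Nat.pow_le_pow_right hμ0 (by omega))
    · push Not at hv
      have hZu : Z = Finset.univ := Finset.eq_univ_of_forall hv
      obtain ⟨v⟩ : Nonempty V := Fintype.card_pos_iff.1 h.card_pos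
      have h1 : j ^ (2 * a + 1) * j ≤ j ^ (2 * a + 1) * μ ^ (29 * (2 * a + 2)) := by
        calc j ^ (2 * a + 1) * j = β ^ H := by rw [hjH]; ring
          _ ≤ 4 * β ^ H := by omega
          _ ≤ (nbr G {v}).card := h.le_degree v
          _ ≤ Z.card := hZu ▸ Finset.card_le_univ _
          _ ≤ _ := hZc.le
      exact Nat.le_of_mul_le_mul_left h1 (Nat.pow_pos hj0)
  have hc : 29 * (2 * a + 2) * (2 * a + 1) + 29 * (2 * a + 2) + 29 * (2 * a + 2) + 100 = C := by
    rw [hC]; ring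
  have hjpow : ∀ e, j ^ e ≤ μ ^ (29 * (2 * a + 2) * e) := by
    intro e
    rw [pow_mul]
    exact Nat.pow_le_pow_left hjμ e
  have hβμ : β ≤ μ := by
    have hB0 : B ≠ 0 := by omega
    refine (Nat.pow_le_pow_iff_left hB0).1 ?_
    rw [← hj]
    exact hjμ.trans (Nat.pow_le_pow_right hμ0 (by omega))
  have hBa : 2 * a + 4 ≤ B := by omega
  have herr := fun i => layer_error_bound (i := i) hBa (Nat.two_pow_pos H) hβ'
  rw [← hH, ← hj] at herr
  rw [← hj]
  refine h.exists_of_sparse (C := C) (Z := Z) (μ := μ) (Δ := Δ) ha hj0 hβ hβ0 hβμ hμ (by omega)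
    ?_ hτ ?_ herr ?_ (fun v hv => not_lt.1 (mt (hmem v).2 hv)) ?_ ?_ ?_
    (card_scale_lt hμH hΛμ hn)
  · rw [hH, hB]
    exact Nat.le_mul_of_pos_left _ (by omega)
  · have h1 := herr 0
    rw [Nat.zero_div, add_zero, zero_add] at h1
    have h2 : β ^ (H - 1) ≤ β ^ H := Nat.pow_le_pow_right hβ0 (Nat.sub_le _ _)
    have h3 := h1.trans h2
    clear h1 h2 herr hn
    omega
  · calc Z.card ≤ j ^ (2 * a + 1) * μ ^ (29 * (2 * a + 2)) := hZc.le
      _ ≤ μ ^ (29 * (2 * a + 2) * (2 * a + 1)) * μ ^ (29 * (2 * a + 2)) :=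
        Nat.mul_le_mul_right _ (hjpow _)
      _ = μ ^ (29 * (2 * a + 2) * (2 * a + 1) + 29 * (2 * a + 2)) := (pow_add _ _ _).symm
      _ ≤ μ ^ C := Nat.pow_le_pow_right hμ0 (by omega)
  · have h1 : j ^ (2 * a) ≤ μ ^ (29 * (2 * a + 2) * (2 * a + 1)) :=
      (Nat.pow_le_pow_right hj0 (Nat.le_succ _)).trans (hjpow _)
    have h2 : 0 < μ ^ (76 + 29 * (2 * a + 2) * (2 * a + 1)) := Nat.pow_pos hμ0
    calc Δ + 1 ≤ μ ^ 76 * μ ^ (29 * (2 * a + 2) * (2 * a + 1)) + 1 :=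
          Nat.add_le_add_right (hΔj.trans (Nat.mul_le_mul_left _ h1)) _
      _ = μ ^ (76 + 29 * (2 * a + 2) * (2 * a + 1)) + 1 := by rw [pow_add]
      _ ≤ μ * μ ^ (76 + 29 * (2 * a + 2) * (2 * a + 1)) := by nlinarith
      _ = μ ^ (76 + 29 * (2 * a + 2) * (2 * a + 1) + 1) := (pow_succ' _ _).symm
      _ ≤ μ ^ C := Nat.pow_le_pow_right hμ0 (by omega)
  · have h1 : 32 * Λ ^ 3 ≤ μ ^ 28 := by omega
    exact h1.trans (Nat.pow_le_pow_right hμ0 (by omega))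
  · calc j ^ (2 * a + 1) * 16 ^ (2 * a + 2) ≤
          μ ^ (29 * (2 * a + 2) * (2 * a + 1)) * μ ^ (2 * a + 2) :=
        Nat.mul_le_mul (hjpow _) (Nat.pow_le_pow_left (by omega) _)
      _ = μ ^ (29 * (2 * a + 2) * (2 * a + 1) + (2 * a + 2)) := (pow_add _ _ _).symm
      _ ≤ μ ^ C := Nat.pow_le_pow_right hμ0 (by omega)

theorem exists_containsBalSub_pow (a : ℕ) (ha : 0 < a) : ∃ B β₀ : ℕ, 0 < B ∧ 0 < β₀ ∧
    ∀ β, β₀ ≤ β → ∀ (V : Type) [Fintype V] (G : SimpleGraph V),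
      32 * (β : ℝ) ^ ((2 * a + 2) * B) ≤ avgDeg G → ∃ ℓ, ContainsBalSub G ((β ^ B) ^ a) ℓ := by
  obtain ⟨C, hC⟩ : ∃ C, C = 29 * (2 * a + 2) * (2 * a + 3) + 100 := ⟨_, rfl⟩
  obtain ⟨B, hB⟩ : ∃ B, B = 14 * C := ⟨_, rfl⟩
  obtain ⟨H, hH⟩ : ∃ H, H = (2 * a + 2) * B := ⟨_, rfl⟩
  have hB0 : 0 < B := by omega
  have hH2 : 2 ≤ H := by
    rw [hH]
    exact (by omega : 2 ≤ 2 * a + 2).trans (Nat.le_mul_of_pos_right _ hB0)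
  obtain ⟨y₀, -, hy₀⟩ := exists_isGoodExpander H hH2
  obtain ⟨M, hM⟩ : ∃ M, M = 10000 + (6 * H + 2 * C + 2) + 2 ^ H := ⟨_, rfl⟩
  obtain ⟨κ, hκ⟩ : ∃ κ, κ = 16 ^ (2 * a + 3) * (4 * 2 ^ H) ^ (2 * a + 2) := ⟨_, rfl⟩
  obtain ⟨N, hN⟩ : ∃ N, N = 2 ^ M ^ 8 := ⟨_, rfl⟩
  have hH2p : 0 < 2 ^ H := Nat.two_pow_pos H
  have hN0 : 0 < N := hN ▸ Nat.two_pow_pos _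
  refine ⟨B, y₀ + κ + N, hB0, by omega, fun β hβ V _ G hG => ?_⟩
  have hβ0 : 0 < β := by omega
  rw [← hH] at hG
  obtain ⟨V', _, G', hG', hsub⟩ := hy₀ V G (4 * β ^ H) (by positivity) (by
    push_cast
    linarith)
  have hn : 2 ^ (Nat.log 2 (Fintype.card V') + 2 - 2) ≤ Fintype.card V' := by
    rw [Nat.add_sub_cancel]
    exact Nat.pow_log_le_self 2 hG'.card_pos.ne'
  generalize Nat.log 2 (Fintype.card V') + 2 = Λ at hG' hn
  have hMΛ : M ^ 8 ≤ Λ := by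
    obtain ⟨v⟩ : Nonempty V' := Fintype.card_pos_iff.1 hG'.card_pos
    have h1 : N ≤ 2 ^ Λ := by
      calc N ≤ β := by omega
        _ ≤ β ^ H := Nat.le_self_pow (by omega) β
        _ ≤ 4 * β ^ H := by omega
        _ ≤ (nbr G' {v}).card := hG'.le_degree v
        _ ≤ Fintype.card V' := Finset.card_le_univ _
        _ ≤ 2 ^ Λ := hG'.card_lt.le
    rw [hN] at h1
    exact (Nat.pow_le_pow_iff_right (by norm_num)).1 h1
  obtain ⟨μ, hMμ, hμ1, hμ2⟩ := exists_pow_le_lt 8 (by norm_num) (Λ : ℝ) (b := M)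
    (by exact_mod_cast hMΛ)
  have hμ1' : μ ^ 8 ≤ Λ := by exact_mod_cast hμ1
  have hμ2' : Λ < (μ + 1) ^ 8 := by exact_mod_cast hμ2
  obtain ⟨ℓ, hℓ⟩ := hG'.exists_containsBalSub (μ := μ) ha hC hB hH hn (by omega) (by omega)
    (le_trans (by omega) hMμ) hμ1' hμ2'.le (by omega) (by omega)
  exact ⟨ℓ, hsub _ _ hℓ⟩

end Main

/-- For every constant `0 < c < 1/2` there exist `t > 0` and `d₀ ∈ ℕ` such
that every graph with average degree at least `d ≥ d₀` contains an `ℓ`-balanced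
subdivision of a complete graph on at least `t·d^c` vertices, for some `ℓ`. -/
theorem statement0 :
    ∀ c : ℝ, 0 < c → c < 1 / 2 →
      ∃ (t : ℝ) (d₀ : ℕ), 0 < t ∧
        ∀ d : ℝ, (d₀ : ℝ) ≤ d →
          ∀ (V : Type) [Fintype V] (G : SimpleGraph V), d ≤ avgDeg G →
            ∃ (k ℓ : ℕ), t * d ^ c ≤ (k : ℝ) ∧ ContainsBalSub G k ℓ := by
  intro c hc0 hc
  obtain ⟨a, ha⟩ := exists_nat_ge (1 / (1 - 2 * c))
  have h2c : 0 < 1 - 2 * c := by linarith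
  have haR : 1 ≤ a * (1 - 2 * c) := (div_le_iff₀ h2c).1 ha
  have ha0 : 0 < a := by
    rcases Nat.eq_zero_or_pos a with h | h
    · rw [h, Nat.cast_zero, zero_mul] at haR
      linarith
    · exact h
  obtain ⟨B, β₀, hB, hβ₀, key⟩ := exists_containsBalSub_pow a ha0
  obtain ⟨H, hH⟩ : ∃ H, H = (2 * a + 2) * B := ⟨_, rfl⟩
  rw [← hH] at key
  have hH0 : 0 < H := hH ▸ Nat.mul_pos (by omega) hB
  obtain ⟨α, hα⟩ : ∃ α : ℝ, α = a / (2 * a + 2) := ⟨_, rfl⟩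
  have hα0 : 0 ≤ α := by rw [hα]; positivity
  have hcα : c ≤ α := by
    rw [hα, le_div_iff₀ (by positivity)]
    nlinarith
  have hHα : (H : ℝ) * α = (B * a : ℕ) := by
    rw [hH, hα]
    push_cast
    field_simp
  refine ⟨(((32 : ℝ) * 2 ^ H) ^ α)⁻¹, 32 * β₀ ^ H, by positivity, fun d hd V _ G hG => ?_⟩
  push_cast at hd
  obtain ⟨β, hβ, hβ1, hβ2⟩ := exists_pow_le_lt H hH0 (d / 32) (b := β₀) (by linarith)
  have hβR : (1 : ℝ) ≤ β := by exact_mod_cast hβ₀.trans_le hβ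
  have hβH : (1 : ℝ) ≤ (β : ℝ) ^ H := one_le_pow₀ hβR
  obtain ⟨ℓ, hℓ⟩ := key β hβ V G (by linarith)
  refine ⟨_, ℓ, ?_, hℓ⟩
  rw [inv_mul_le_iff₀ (by positivity)]
  have hd2 : d ≤ 32 * 2 ^ H * (β : ℝ) ^ H := by
    have h1 : ((β : ℝ) + 1) ^ H ≤ (2 * β) ^ H := pow_le_pow_left₀ (by positivity) (by linarith) _
    rw [mul_pow] at h1
    linarith
  calc d ^ c ≤ d ^ α := Real.rpow_le_rpow_of_exponent_le (by linarith) hcα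
    _ ≤ (32 * 2 ^ H * (β : ℝ) ^ H) ^ α := Real.rpow_le_rpow (by linarith) hd2 hα0
    _ = (32 * 2 ^ H) ^ α * ((β : ℝ) ^ H) ^ α := Real.mul_rpow (by positivity) (by positivity)
    _ = (32 * 2 ^ H) ^ α * (((β ^ B) ^ a : ℕ) : ℝ) := by
      congr 1
      rw [← Real.rpow_natCast, ← Real.rpow_mul (by positivity), hHα, Real.rpow_natCast, ← pow_mul]
      push_cast
      rfl

end Balanced
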